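/- Let N ≥ 2, ρ₁, …, ρ_N > 0, and fix i ∈ {1,…,N}. Then there exists a front-like entire solution u = (u₁,…,u_N) approaching along edge i; it is unique; and it is strictly monotone increasing in t, i.e., u_j(s,x) < u_j(t,x) whenever s < t, for every j and every x ≥ 0. -/

import Mathlib

open Set Filter Topology

/-- The primitive `F(s) = ∫₀^s f(r) dr`. -/
noncomputable def F (f : ℝ → ℝ) (s : ℝ) : ℝ := ∫ r in (0:ℝ)..s, f r

/-- Bistable nonlinearity with balanced-positive integral. -/
def Bistable (f : ℝ → ℝ) (a : ℝ) : Prop :=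
  ContDiff ℝ 1 f ∧ 0 < a ∧ a < 1 ∧
  f 0 = 0 ∧ f a = 0 ∧ f 1 = 0 ∧
  (∀ s, 0 < s → s < a → f s < 0) ∧
  (∀ s, a < s → s < 1 → 0 < f s) ∧
  deriv f 0 < 0 ∧ 0 < deriv f a ∧ deriv f 1 < 0 ∧
  0 < ∫ s in (0:ℝ)..(1:ℝ), f s


/-- A classical solution of `∂_t u = ∂_x² u + f(u)` on `ℝ × [0,∞)`:
`u`, `∂_t u`, `∂_x u`, `∂_x² u` exist and are continuous there and the
equation holds. -/
def IsEntireSol (f : ℝ → ℝ) (u : ℝ → ℝ → ℝ) : Prop :=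
  ContinuousOn (fun p : ℝ × ℝ => u p.1 p.2) ((univ : Set ℝ) ×ˢ Ici 0) ∧
  (∀ t : ℝ, ∀ x : ℝ, 0 ≤ x →
    DifferentiableAt ℝ (fun τ => u τ x) t ∧
    DifferentiableAt ℝ (u t) x ∧
    DifferentiableAt ℝ (deriv (u t)) x) ∧
  ContinuousOn (fun p : ℝ × ℝ => deriv (fun τ => u τ p.2) p.1) ((univ : Set ℝ) ×ˢ Ici 0) ∧
  ContinuousOn (fun p : ℝ × ℝ => deriv (u p.1) p.2) ((univ : Set ℝ) ×ˢ Ici 0) ∧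
  ContinuousOn (fun p : ℝ × ℝ => deriv (deriv (u p.1)) p.2) ((univ : Set ℝ) ×ˢ Ici 0) ∧
  (∀ t : ℝ, ∀ x : ℝ, 0 ≤ x →
    deriv (fun τ => u τ x) t = deriv (deriv (u t)) x + f (u t x))

/-- A front-like entire solution on a star graph with `N` half-line edges of
thicknesses `ρ`, approaching along edge `i` like the traveling wave
`φ(−x − ct)` as `t → −∞`, and vanishing (uniformly) on the other edges. -/
def FrontLike (f : ℝ → ℝ) (c : ℝ) (φ : ℝ → ℝ) {N : ℕ} (ρ : Fin N → ℝ) (i : Fin N)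
    (u : Fin N → ℝ → ℝ → ℝ) : Prop :=
  (∀ j, IsEntireSol f (u j)) ∧
  (∀ j, ∀ t : ℝ, ∀ x : ℝ, 0 ≤ x → 0 < u j t x ∧ u j t x < 1) ∧
  (∀ t : ℝ, ∀ j k, u j t 0 = u k t 0) ∧
  (∀ t : ℝ, (∑ j, ρ j * derivWithin (u j t) (Ici 0) 0) = 0) ∧
  (∀ ε : ℝ, 0 < ε → ∃ T : ℝ, ∀ t : ℝ, t ≤ T → ∀ x : ℝ, 0 ≤ x →
    |u i t x - φ (-x - c * t)| < ε ∧ ∀ j, j ≠ i → |u j t x| < ε)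

/-- `φ` is the (unique, normalized) bistable traveling wave of speed `c`. -/
def TravelingWave (f : ℝ → ℝ) (a c : ℝ) (φ : ℝ → ℝ) : Prop :=
  ContDiff ℝ 2 φ ∧
  (∀ z : ℝ, deriv (deriv φ) z + c * deriv φ z + f (φ z) = 0) ∧
  (∀ z : ℝ, 0 < φ z ∧ φ z < 1) ∧
  Tendsto φ atBot (𝓝 1) ∧ Tendsto φ atTop (𝓝 0) ∧
  (∀ z : ℝ, deriv φ z < 0) ∧ φ 0 = a

/-- Regularity needed of a function on `ℝ × [0,∞)` in the parabolic minimum principle. -/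
structure StarRegular (u : ℝ → ℝ → ℝ) : Prop where
  cont : ContinuousOn (fun p : ℝ × ℝ => u p.1 p.2) ((univ : Set ℝ) ×ˢ Ici 0)
  diff_t : ∀ t x, 0 ≤ x → DifferentiableAt ℝ (fun τ => u τ x) t
  diff_x : ∀ t x, 0 ≤ x → DifferentiableAt ℝ (u t) x
  diff_xx : ∀ t x, 0 < x → DifferentiableAt ℝ (deriv (u t)) x

/-- The heat operator `∂_t - ∂_x²`. -/
noncomputable def heatOp (u : ℝ → ℝ → ℝ) (t x : ℝ) : ℝ :=
  deriv (fun τ => u τ x) t - deriv (deriv (u t)) x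

theorem StarRegular.deriv_sub_eventuallyEq {u v : ℝ → ℝ → ℝ} (hu : StarRegular u)
    (hv : StarRegular v) (t : ℝ) {x : ℝ} (hx : 0 < x) :
    deriv (fun y => u t y - v t y) =ᶠ[𝓝 x] fun y => deriv (u t) y - deriv (v t) y := by
  filter_upwards [lt_mem_nhds hx] with y hy
  exact deriv_fun_sub (hu.diff_x t y hy.le) (hv.diff_x t y hy.le)

theorem StarRegular.sub {u v : ℝ → ℝ → ℝ} (hu : StarRegular u) (hv : StarRegular v) :
    StarRegular fun t x => u t x - v t x where
  cont := hu.cont.sub hv.cont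
  diff_t t x hx := (hu.diff_t t x hx).sub (hv.diff_t t x hx)
  diff_x t x hx := (hu.diff_x t x hx).sub (hv.diff_x t x hx)
  diff_xx t x hx := ((hu.diff_xx t x hx).sub (hv.diff_xx t x hx)).congr_of_eventuallyEq
    (hu.deriv_sub_eventuallyEq hv t hx)

theorem StarRegular.heatOp_sub {u v : ℝ → ℝ → ℝ} (hu : StarRegular u) (hv : StarRegular v)
    (t : ℝ) {x : ℝ} (hx : 0 < x) :
    heatOp (fun t x => u t x - v t x) t x = heatOp u t x - heatOp v t x := by
  unfold heatOp
  rw [(hu.deriv_sub_eventuallyEq hv t hx).deriv_eq,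
    deriv_fun_sub (hu.diff_t t x hx.le) (hv.diff_t t x hx.le),
    deriv_fun_sub (hu.diff_xx t x hx) (hv.diff_xx t x hx)]
  ring

theorem IsEntireSol.starRegular {f : ℝ → ℝ} {u : ℝ → ℝ → ℝ} (hu : IsEntireSol f u) :
    StarRegular u where
  cont := hu.1
  diff_t t x hx := (hu.2.1 t x hx).1
  diff_x t x hx := (hu.2.1 t x hx).2.1
  diff_xx t x hx := (hu.2.1 t x hx.le).2.2

theorem IsEntireSol.heatOp_eq {f : ℝ → ℝ} {u : ℝ → ℝ → ℝ} (hu : IsEntireSol f u)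
    (t : ℝ) {x : ℝ} (hx : 0 ≤ x) : heatOp u t x = f (u t x) := by
  unfold heatOp
  rw [hu.2.2.2.2.2 t x hx]; ring

/-- Second-order necessary condition at a local minimum. -/
theorem IsLocalMin.deriv_deriv_nonneg {e : ℝ → ℝ} {x : ℝ} (h : IsLocalMin e x)
    (hc : ContinuousAt e x) : 0 ≤ deriv (deriv e) x := by
  by_contra! hneg
  have hmax := isLocalMax_of_deriv_deriv_neg hneg h.deriv_eq_zero hc
  have hconst : e =ᶠ[𝓝 x] fun _ => e x := by
    filter_upwards [h, hmax] with y h1 h2 using le_antisymm h2 h1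
  have h1 : deriv e =ᶠ[𝓝 x] fun _ => 0 := by
    filter_upwards [hconst.eventuallyEq_nhds] with y hy
    rw [hy.deriv_eq]; simp
  rw [h1.deriv_eq] at hneg
  simp at hneg

theorem HasDerivAt.nonpos_of_left_min {e : ℝ → ℝ} {e' s t : ℝ} (h : HasDerivAt e e' t)
    (hst : s < t) (hmin : ∀ τ, s ≤ τ → τ ≤ t → e t ≤ e τ) : e' ≤ 0 := by
  have h1 : Tendsto (slope e t) (𝓝[<] t) (𝓝 e') := (hasDerivWithinAt_iff_tendsto_slope' (by simp)).1 h.hasDerivWithinAt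
  refine le_of_tendsto h1 ?_
  filter_upwards [Ioo_mem_nhdsLT hst] with τ hτ
  rw [slope_def_field]
  exact div_nonpos_of_nonneg_of_nonpos (by linarith [hmin τ hτ.1.le hτ.2.le]) (by linarith [hτ.2])

theorem HasDerivAt.nonneg_of_right_min {e : ℝ → ℝ} {e' x R : ℝ} (h : HasDerivAt e e' x)
    (hxR : x < R) (hmin : ∀ y, x ≤ y → y ≤ R → e x ≤ e y) : 0 ≤ e' := by
  have h1 : Tendsto (slope e x) (𝓝[>] x) (𝓝 e') := (hasDerivWithinAt_iff_tendsto_slope' (by simp)).1 h.hasDerivWithinAt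
  refine ge_of_tendsto h1 ?_
  filter_upwards [Ioo_mem_nhdsGT hxR] with y hy
  rw [slope_def_field]
  exact div_nonneg (by linarith [hmin y hy.1.le hy.2.le]) (by linarith [hy.1])

/-- Minimum principle on a star graph: a function satisfying `D_t - D_xx + κ D ≥ 0` where it is
negative decays at least like `e^{-κ(t-s)}` from below. -/
theorem star_lower_bound {N : ℕ} {ρ : Fin N → ℝ} (hρ : ∀ j, 0 < ρ j) {D : Fin N → ℝ → ℝ → ℝ}
    (hD : ∀ j, StarRegular (D j)) {s T κ M B : ℝ} (hM : 0 ≤ M)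
    (hB : ∀ j t x, s ≤ t → t ≤ T → 0 ≤ x → -B ≤ D j t x)
    (h0 : ∀ j x, 0 ≤ x → -M ≤ D j s x)
    (hpde : ∀ j t x, s < t → t ≤ T → 0 < x → D j t x < 0 →
      0 ≤ heatOp (D j) t x + κ * D j t x)
    (hjun : ∀ j t, s < t → t ≤ T → D j t 0 < 0 →
      (∀ k, D k t 0 = D j t 0) ∧ ∑ k, ρ k * deriv (D k t) 0 ≤ 0) :
    ∀ j t x, s ≤ t → t ≤ T → 0 ≤ x → -(M * Real.exp (-κ * (t - s))) ≤ D j t x := by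
  intro j₀ t₀ x₀ hst₀ htT₀ hx₀
  by_contra! hneg
  set m : ℝ → ℝ := fun t => Real.exp (κ * (t - s)) with hm
  have hmpos : ∀ t, 0 < m t := fun t => Real.exp_pos _
  have hneg' : m t₀ * D j₀ t₀ x₀ + M < 0 := by
    have h1 : m t₀ * D j₀ t₀ x₀ < m t₀ * -(M * Real.exp (-κ * (t₀ - s))) :=
      mul_lt_mul_of_pos_left hneg (hmpos t₀)
    have h2 : m t₀ * Real.exp (-κ * (t₀ - s)) = 1 := by
      rw [hm, ← Real.exp_add]; simp
    have h3 : m t₀ * -(M * Real.exp (-κ * (t₀ - s))) = -M := by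
      linear_combination (-M) * h2
    linarith
  set b : ℝ → ℝ → ℝ := fun t x => (x - 1) ^ 2 + 1 + 3 * (t - s) with hb
  obtain ⟨ε, hε, hεneg⟩ : ∃ ε > 0, m t₀ * D j₀ t₀ x₀ + M + ε * b t₀ x₀ < 0 := by
    have hbpos : 0 < b t₀ x₀ := by
      simp only [hb]; nlinarith [sq_nonneg (x₀ - 1)]
    refine ⟨-(m t₀ * D j₀ t₀ x₀ + M) / (2 * b t₀ x₀), by
      apply div_pos <;> linarith, ?_⟩
    have : -(m t₀ * D j₀ t₀ x₀ + M) / (2 * b t₀ x₀) * b t₀ x₀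
        = -(m t₀ * D j₀ t₀ x₀ + M) / 2 := by field_simp
    linarith
  set E : Fin N → ℝ × ℝ → ℝ := fun j p => m p.1 * D j p.1 p.2 + M + ε * b p.1 p.2 with hE
  obtain ⟨A, hA0, hA⟩ : ∃ A, 0 ≤ A ∧ ∀ t, s ≤ t → t ≤ T → m t ≤ A := by
    refine ⟨Real.exp (|κ| * (T - s)), (Real.exp_pos _).le, fun t h1 h2 => ?_⟩
    apply Real.exp_le_exp.2
    exact mul_le_mul (le_abs_self κ) (by linarith) (by linarith) (abs_nonneg κ)
  set R : ℝ := 1 + x₀ + A * |B| / ε with hR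
  have hdiv : 0 ≤ A * |B| / ε := by positivity
  have hfar : ∀ j t x, s ≤ t → t ≤ T → R ≤ x → 0 ≤ E j (t, x) := by
    intro j t x h1 h2 h3
    have h4 : -(A * |B|) ≤ m t * D j t x := by
      have h5 : -|B| ≤ D j t x :=
        (neg_le_neg (le_abs_self B)).trans (hB j t x h1 h2 (by linarith))
      nlinarith [hA t h1 h2, hmpos t, abs_nonneg B,
        mul_le_mul_of_nonneg_left h5 (hmpos t).le,
        mul_le_mul_of_nonneg_right (hA t h1 h2) (abs_nonneg B)]
    have h6 : A * |B| ≤ ε * b t x := by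
      have h7 : A * |B| / ε ≤ b t x := by
        simp only [hb]; nlinarith [sq_nonneg (x - 1 - 1)]
      rw [div_le_iff₀ hε] at h7; linarith
    simp only [hE]; linarith
  have hcont : ∀ j, ContinuousOn (E j) (Icc s T ×ˢ Icc 0 R) := by
    intro j
    have h1 : ContinuousOn (fun p : ℝ × ℝ => D j p.1 p.2) (Icc s T ×ˢ Icc 0 R) :=
      (hD j).cont.mono (prod_mono (subset_univ _) Icc_subset_Ici_self)
    have h2 : Continuous fun p : ℝ × ℝ => m p.1 := by simp only [hm]; fun_prop
    have h3 : Continuous fun p : ℝ × ℝ => ε * b p.1 p.2 := by simp only [hb]; fun_prop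
    exact ((h2.continuousOn.mul h1).add continuousOn_const).add h3.continuousOn
  have hne : (Icc s T ×ˢ Icc 0 R : Set (ℝ × ℝ)).Nonempty :=
    ⟨(t₀, x₀), ⟨hst₀, htT₀⟩, hx₀, by linarith⟩
  have hmin : ∀ j, ∃ p ∈ (Icc s T ×ˢ Icc 0 R : Set (ℝ × ℝ)), IsMinOn (E j) (Icc s T ×ˢ Icc 0 R) p :=
    fun j => (isCompact_Icc.prod isCompact_Icc).exists_isMinOn hne (hcont j)
  choose p hp hpmin using hmin
  have : Nonempty (Fin N) := ⟨j₀⟩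
  obtain ⟨j, hj⟩ := Finite.exists_min fun j => E j (p j)
  obtain ⟨⟨hst, htT⟩, hx, hxR⟩ := hp j
  set t := (p j).1
  set x := (p j).2
  have hpjm : ∀ k τ y, s ≤ τ → τ ≤ T → 0 ≤ y → y ≤ R → E j (t, x) ≤ E k (τ, y) :=
    fun k τ y h1 h2 h3 h4 => (hj k).trans (hpmin k (show (τ, y) ∈ Icc s T ×ˢ Icc 0 R from
      ⟨⟨h1, h2⟩, h3, h4⟩))
  have hEneg : E j (t, x) < 0 :=
    (hpjm j₀ t₀ x₀ hst₀ htT₀ hx₀ (by linarith)).trans_lt hεneg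
  have hbp : ∀ τ y, s ≤ τ → 0 < b τ y := fun τ y h => by
    simp only [hb]; nlinarith [sq_nonneg (y - 1)]
  have hts : s < t := by
    refine lt_of_le_of_ne hst fun h => ?_
    have h1 := h0 j x hx
    have h2 : m t = 1 := by simp [hm, ← h]
    have h3 := mul_pos hε (hbp t x hst)
    simp only [hE, h2] at hEneg
    rw [← h] at hEneg h3
    linarith
  have hxR' : x < R := by
    by_contra! h
    linarith [hfar j t x hst htT h]
  have hmD : m t * D j t x < 0 := by
    have := mul_pos hε (hbp t x hst)
    simp only [hE] at hEneg; linarith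
  have hDneg : D j t x < 0 := by
    by_contra! h
    linarith [mul_nonneg (hmpos t).le h]
  have hEx : ∀ k, ∀ y, 0 ≤ y → HasDerivAt (fun y => E k (t, y))
      (m t * deriv (D k t) y + ε * (2 * (y - 1))) y := by
    intro k y hy
    have h1 := ((((hD k).diff_x t y hy).hasDerivAt.const_mul (m t)).add_const M)
    have h2 : HasDerivAt (fun y => ε * b t y) (ε * (2 * (y - 1))) y := by
      have h3 : HasDerivAt (fun y : ℝ => (y - 1) ^ 2) (2 * (y - 1)) y := by
        simpa using ((hasDerivAt_id y).sub_const 1).fun_pow 2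
      simpa [hb] using (((h3.add_const 1).add_const (3 * (t - s))).const_mul ε)
    exact h1.add h2
  rcases hx.eq_or_lt with hx0 | hxpos
  · rw [← hx0] at hDneg
    obtain ⟨heq, hsum⟩ := hjun j t hts htT hDneg
    have h1 : ∀ k, 0 < deriv (D k t) 0 := by
      intro k
      have h2 : 0 ≤ m t * deriv (D k t) 0 + ε * (2 * (0 - 1)) := by
        refine (hEx k 0 le_rfl).nonneg_of_right_min (R := R) (by linarith) fun y h3 h4 => ?_
        have h5 : E k (t, 0) = E j (t, x) := by simp only [hE, heq k, ← hx0]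
        rw [h5]
        exact hpjm k t y hst htT h3 h4
      by_contra! h3
      nlinarith [mul_nonpos_of_nonneg_of_nonpos (hmpos t).le h3]
    have : 0 < ∑ k, ρ k * deriv (D k t) 0 :=
      Finset.sum_pos (fun k _ => mul_pos (hρ k) (h1 k)) Finset.univ_nonempty
    linarith
  · have hxx : 0 ≤ m t * deriv (deriv (D j t)) x + ε * 2 := by
      have h1 : IsLocalMin (fun y => E j (t, y)) x := by
        filter_upwards [Ioo_mem_nhds hxpos hxR'] with y hy
        exact hpjm j t y hst htT hy.1.le hy.2.le
      have h2 := h1.deriv_deriv_nonneg (hEx j x hx).continuousAt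
      have h3 : deriv (fun y => E j (t, y)) =ᶠ[𝓝 x]
          fun y => m t * deriv (D j t) y + ε * (2 * (y - 1)) := by
        filter_upwards [lt_mem_nhds hxpos] with y hy using (hEx j y hy.le).deriv
      rw [h3.deriv_eq] at h2
      have h4 : HasDerivAt (fun y => m t * deriv (D j t) y + ε * (2 * (y - 1)))
          (m t * deriv (deriv (D j t)) x + ε * 2) x := by
        have h5 := ((hD j).diff_xx t x hxpos).hasDerivAt.const_mul (m t)
        have h6 := (((hasDerivAt_id x).sub_const 1).const_mul 2).const_mul ε
        simpa using h5.fun_add h6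
      rwa [h4.deriv] at h2
    have ht : m t * deriv (fun τ => D j τ x) t + κ * m t * D j t x + ε * 3 ≤ 0 := by
      have h1 : HasDerivAt (fun τ => E j (τ, x))
          (m t * deriv (fun τ => D j τ x) t + κ * m t * D j t x + ε * 3) t := by
        have h2 : HasDerivAt m (κ * m t) t := by
          have h5 : HasDerivAt (fun τ => κ * (τ - s)) (κ * 1) t :=
            ((hasDerivAt_id' t).sub_const s).const_mul κ
          exact h5.exp.congr_deriv (by simp only [hm]; ring)
        have h3 := ((h2.fun_mul ((hD j).diff_t t x hx).hasDerivAt).add_const M)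
        have h4 : HasDerivAt (fun τ => ε * b τ x) (ε * 3) t := by
          have h5 := ((((hasDerivAt_id t).sub_const s).const_mul 3).const_add
            ((x - 1) ^ 2 + 1)).const_mul ε
          simpa [hb] using h5
        exact (h3.fun_add h4).congr_deriv (by ring)
      exact h1.nonpos_of_left_min hts fun τ h2 h3 => hpjm j τ x h2 (h3.trans htT) hx hxR
    have h1 := mul_nonneg (hmpos t).le (hpde j t x hts htT hxpos hDneg)
    unfold heatOp at h1
    nlinarith

/-- Minimum principle on a star graph for functions bounded below on an ancient time interval. -/
theorem star_nonneg_of_ancient {N : ℕ} {ρ : Fin N → ℝ} (hρ : ∀ j, 0 < ρ j)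
    {D : Fin N → ℝ → ℝ → ℝ} (hD : ∀ j, StarRegular (D j)) {T κ B : ℝ} (hκ : 0 < κ)
    (hB : ∀ j t x, t ≤ T → 0 ≤ x → -B ≤ D j t x)
    (hpde : ∀ j t x, t ≤ T → 0 < x → D j t x < 0 → 0 ≤ heatOp (D j) t x + κ * D j t x)
    (hjun : ∀ j t, t ≤ T → D j t 0 < 0 →
      (∀ k, D k t 0 = D j t 0) ∧ ∑ k, ρ k * deriv (D k t) 0 ≤ 0) :
    ∀ j t x, t ≤ T → 0 ≤ x → 0 ≤ D j t x := by
  intro j t x ht hx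
  have h1 : ∀ s ≤ t, -(|B| * Real.exp (-κ * (t - s))) ≤ D j t x := fun s hs =>
    star_lower_bound hρ hD (abs_nonneg B) (T := T) (B := B)
      (fun j t x _ h2 h3 => hB j t x h2 h3)
      (fun j x hx => (neg_le_neg (le_abs_self B)).trans (hB j s x (hs.trans ht) hx))
      (fun j t x _ h2 h3 => hpde j t x h2 h3) (fun j t _ h2 => hjun j t h2) j t x hs ht hx
  have h2 : Tendsto (fun s => -(|B| * Real.exp (-κ * (t - s)))) atBot (𝓝 0) := by
    have h3 : Tendsto (fun s : ℝ => -κ * (t - s)) atBot atBot := by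
      have : (fun s : ℝ => -κ * (t - s)) = fun s => κ * s + -(κ * t) := by ext; ring
      rw [this]
      exact tendsto_atBot_add_const_right _ _ (tendsto_id.const_mul_atBot hκ)
    simpa using ((Real.tendsto_exp_atBot.comp h3).const_mul |B|).neg
  exact le_of_tendsto h2 ((eventually_le_atBot t).mono h1)

theorem sub_le_mul_sub_of_deriv_le {f : ℝ → ℝ} (hf : Differentiable ℝ f) {p q m : ℝ} (hpq : p ≤ q)
    (h : ∀ ξ, p ≤ ξ → ξ ≤ q → deriv f ξ ≤ m) : f q - f p ≤ m * (q - p) :=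
  (convex_Icc p q).image_sub_le_mul_sub_of_deriv_le hf.continuous.continuousOn
    hf.differentiableOn (fun ξ hξ => by
      have := interior_subset hξ
      exact h ξ this.1 this.2) p ⟨le_rfl, hpq⟩ q ⟨hpq, le_rfl⟩ hpq

theorem mul_sub_le_sub_of_le_deriv {f : ℝ → ℝ} (hf : Differentiable ℝ f) {p q m : ℝ} (hpq : p ≤ q)
    (h : ∀ ξ, p ≤ ξ → ξ ≤ q → m ≤ deriv f ξ) : m * (q - p) ≤ f q - f p :=
  (convex_Icc p q).mul_sub_le_image_sub_of_le_deriv hf.continuous.continuousOn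
    hf.differentiableOn (fun ξ hξ => by
      have := interior_subset hξ
      exact h ξ this.1 this.2) p ⟨le_rfl, hpq⟩ q ⟨hpq, le_rfl⟩ hpq

theorem exists_deriv_le_neg_near {f : ℝ → ℝ} (hf : ContDiff ℝ 1 f) {p : ℝ} (hp : deriv f p < 0) :
    ∃ η > 0, ∃ k > 0, ∀ ξ, |ξ - p| ≤ η → deriv f ξ ≤ -k := by
  have hc : ContinuousAt (deriv f) p := (hf.continuous_deriv le_rfl).continuousAt
  obtain ⟨η, hη, h⟩ := Metric.eventually_nhds_iff.1
    (hc.eventually (gt_mem_nhds (show deriv f p < deriv f p / 2 by linarith)))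
  refine ⟨η / 2, by positivity, -(deriv f p / 2), by linarith, fun ξ hξ => ?_⟩
  have := h (y := ξ) (by rw [Real.dist_eq]; linarith)
  linarith

/-- `f` is uniformly decreasing near the stable states `0` and `1`. -/
theorem Bistable.exists_decreasing {f : ℝ → ℝ} {a : ℝ} (hf : Bistable f a) :
    ∃ η > 0, ∃ k > 0, ∀ ξ, |ξ| ≤ η ∨ |ξ - 1| ≤ η → deriv f ξ ≤ -k := by
  obtain ⟨h1, -, -, -, -, -, -, -, h0, -, h2, -⟩ := hf
  obtain ⟨η₀, hη₀, k₀, hk₀, H₀⟩ := exists_deriv_le_neg_near h1 h0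
  obtain ⟨η₁, hη₁, k₁, hk₁, H₁⟩ := exists_deriv_le_neg_near h1 h2
  refine ⟨min η₀ η₁, lt_min hη₀ hη₁, min k₀ k₁, lt_min hk₀ hk₁, fun ξ hξ => ?_⟩
  rcases hξ with h | h
  · have := H₀ ξ (by rw [sub_zero]; exact h.trans (min_le_left _ _))
    linarith [min_le_left k₀ k₁]
  · have := H₁ ξ (h.trans (min_le_right _ _))
    linarith [min_le_right k₀ k₁]

theorem Bistable.exists_abs_deriv_le {f : ℝ → ℝ} {a : ℝ} (hf : Bistable f a) :
    ∃ Λ > 0, ∀ ξ, -1 ≤ ξ → ξ ≤ 2 → |deriv f ξ| ≤ Λ := by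
  obtain ⟨C, hC⟩ := (isCompact_Icc (a := (-1 : ℝ)) (b := 2)).exists_bound_of_continuousOn
    (hf.1.continuous_deriv le_rfl).continuousOn
  exact ⟨|C| + 1, by positivity, fun ξ h1 h2 => (hC ξ ⟨h1, h2⟩).trans (by linarith [le_abs_self C])⟩

theorem TravelingWave.strictAnti {f : ℝ → ℝ} {a c : ℝ} {φ : ℝ → ℝ} (hφ : TravelingWave f a c φ) :
    StrictAnti φ := strictAnti_of_deriv_neg hφ.2.2.2.2.2.1

theorem TravelingWave.exists_tails {f : ℝ → ℝ} {a c : ℝ} {φ : ℝ → ℝ} (hφ : TravelingWave f a c φ)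
    {η : ℝ} (hη : 0 < η) :
    ∃ M > 0, (∀ z, M ≤ z → φ z < η) ∧ ∀ z, z ≤ -M → 1 - η < φ z := by
  obtain ⟨-, -, -, hbot, htop, -, -⟩ := hφ
  obtain ⟨M₁, h1⟩ := eventually_atTop.1 (htop.eventually (gt_mem_nhds hη))
  obtain ⟨M₂, h2⟩ := eventually_atBot.1
    (hbot.eventually (lt_mem_nhds (show 1 - η < 1 by linarith)))
  refine ⟨|M₁| + |M₂| + 1, by positivity, fun z hz => h1 z ?_, fun z hz => h2 z ?_⟩
  · linarith [le_abs_self M₁, abs_nonneg M₂]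
  · linarith [neg_abs_le M₂, abs_nonneg M₁]

theorem StarRegular.shift {u : ℝ → ℝ → ℝ} (hu : StarRegular u) (τ : ℝ) :
    StarRegular fun t x => u (t + τ) x where
  cont := hu.cont.comp (f := fun p : ℝ × ℝ => (p.1 + τ, p.2)) (by fun_prop)
    fun p hp => ⟨mem_univ _, hp.2⟩
  diff_t t x hx := (hu.diff_t (t + τ) x hx).comp t (f := fun s => s + τ) (by fun_prop)
  diff_x t x hx := hu.diff_x (t + τ) x hx
  diff_xx t x hx := hu.diff_xx (t + τ) x hx

theorem heatOp_shift (u : ℝ → ℝ → ℝ) (τ t x : ℝ) :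
    heatOp (fun t x => u (t + τ) x) t x = heatOp u (t + τ) x := by
  unfold heatOp
  rw [deriv_comp_add_const (fun s => u s x) τ t]

theorem IsEntireSol.derivWithin_eq {f : ℝ → ℝ} {u : ℝ → ℝ → ℝ} (hu : IsEntireSol f u) (t : ℝ) :
    derivWithin (u t) (Ici 0) 0 = deriv (u t) 0 :=
  (hu.2.1 t 0 le_rfl).2.1.derivWithin (uniqueDiffOn_Ici 0 0 self_mem_Ici)

/-- Where a front-like solution shifted forward in time lies below another one at very negative
times, both are close to the same stable state, so the nonlinearity is dissipative. -/
theorem FrontLike.exists_dissipative {f : ℝ → ℝ} {a c : ℝ} {φ : ℝ → ℝ} (hf : Bistable f a)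
    (hc : 0 < c) (hφ : TravelingWave f a c φ) {N : ℕ} {ρ : Fin N → ℝ} {i : Fin N}
    {u v : Fin N → ℝ → ℝ → ℝ} (hu : FrontLike f c φ ρ i u) (hv : FrontLike f c φ ρ i v)
    {τ : ℝ} (hτ : 0 < τ) :
    ∃ T, ∃ k > 0, ∀ j t x, t ≤ T → 0 ≤ x → v j (t + τ) x < u j t x →
      0 ≤ f (v j (t + τ) x) - f (u j t x) + k * (v j (t + τ) x - u j t x) := by
  obtain ⟨η, hη, k, hk, H⟩ := hf.exists_decreasing
  obtain ⟨M₁, hM₁, hr, hl⟩ := hφ.exists_tails (half_pos hη)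
  have hcτ : 0 < c * τ := mul_pos hc hτ
  set M := M₁ + c * τ with hM
  have hφc : Continuous φ := hφ.1.continuous
  obtain ⟨m, hm, hgap⟩ : ∃ m > 0, ∀ z, -M ≤ z → z ≤ M → m ≤ φ (z - c * τ) - φ z := by
    obtain ⟨z₀, -, hz₀⟩ := (isCompact_Icc (a := -M) (b := M)).exists_isMinOn
      ⟨0, by constructor <;> linarith⟩
      (show ContinuousOn (fun z => φ (z - c * τ) - φ z) (Icc (-M) M) by fun_prop)
    exact ⟨φ (z₀ - c * τ) - φ z₀, sub_pos.2 (hφ.strictAnti (by linarith)),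
      fun z h1 h2 => hz₀ ⟨h1, h2⟩⟩
  set ε := min (m / 2) (η / 2) with hε
  have hε0 : 0 < ε := lt_min (by linarith) (by linarith)
  obtain ⟨T₁, h1⟩ := hu.2.2.2.2 ε hε0
  obtain ⟨T₂, h2⟩ := hv.2.2.2.2 ε hε0
  have hεm : ε ≤ m / 2 := min_le_left _ _
  have hεη : ε ≤ η / 2 := min_le_right _ _
  refine ⟨min T₁ (T₂ - τ), k, hk, fun j t x ht hx hlt => ?_⟩
  obtain ⟨hu1, hu2⟩ := h1 t (ht.trans (min_le_left _ _)) x hx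
  obtain ⟨hv1, hv2⟩ := h2 (t + τ) (by linarith [ht.trans (min_le_right _ _)]) x hx
  obtain ⟨hu3, hu4⟩ := hu.2.1 j t x hx
  obtain ⟨hv3, hv4⟩ := hv.2.1 j (t + τ) x hx
  have key : (u j t x ≤ η ∨ 1 - η ≤ v j (t + τ) x) := by
    by_cases hj : j = i
    · subst hj
      have e1 : -x - c * (t + τ) = (-x - c * t) - c * τ := by ring
      rw [e1] at hv1
      set z := -x - c * t with hz
      rw [abs_lt] at hu1 hv1
      rcases lt_or_ge M z with h3 | h3
      · left; linarith [hr z (by linarith)]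
      rcases lt_or_ge z (-M) with h4 | h4
      · right; linarith [hl (z - c * τ) (by linarith)]
      · linarith [hgap z h4 h3]
    · left; linarith [(abs_lt.1 (hu2 j hj)).2]
  have h3 := sub_le_mul_sub_of_deriv_le (hf.1.differentiable one_ne_zero) (m := -k) hlt.le
    fun ξ h4 h5 => H ξ (by
      rcases key with h6 | h6
      · left; rw [abs_le]; constructor <;> linarith
      · right; rw [abs_le]; constructor <;> linarith)
  linarith

/-- A front-like solution lies below every forward time shift of a front-like solution. -/
theorem FrontLike.le_shift {f : ℝ → ℝ} {a c : ℝ} {φ : ℝ → ℝ} (hf : Bistable f a)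
    (hc : 0 < c) (hφ : TravelingWave f a c φ) {N : ℕ} {ρ : Fin N → ℝ} (hρ : ∀ j, 0 < ρ j)
    {i : Fin N} {u v : Fin N → ℝ → ℝ → ℝ} (hu : FrontLike f c φ ρ i u)
    (hv : FrontLike f c φ ρ i v) {τ : ℝ} (hτ : 0 < τ) (j : Fin N) (t : ℝ) {x : ℝ} (hx : 0 ≤ x) :
    u j t x ≤ v j (t + τ) x := by
  obtain ⟨T, k, hk, H⟩ := hu.exists_dissipative hf hc hφ hv hτ
  obtain ⟨Λ, hΛ, hΛf⟩ := hf.exists_abs_deriv_le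
  set D : Fin N → ℝ → ℝ → ℝ := fun j t x => v j (t + τ) x - u j t x with hDdef
  have hD : ∀ j, StarRegular (D j) := fun j =>
    ((hv.1 j).starRegular.shift τ).sub (hu.1 j).starRegular
  have hop : ∀ j t x, 0 < x → heatOp (D j) t x = f (v j (t + τ) x) - f (u j t x) := by
    intro j t x hx
    rw [((hv.1 j).starRegular.shift τ).heatOp_sub (hu.1 j).starRegular t hx, heatOp_shift,
      (hv.1 j).heatOp_eq _ hx.le, (hu.1 j).heatOp_eq _ hx.le]
  have hB : ∀ j t x, 0 ≤ x → -1 ≤ D j t x := fun j t x hx => by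
    linarith [(hv.2.1 j (t + τ) x hx).1, (hu.2.1 j t x hx).2]
  have hjun : ∀ j t, (∀ k, D k t 0 = D j t 0) ∧ ∑ k, ρ k * deriv (D k t) 0 ≤ 0 := by
    intro j t
    refine ⟨fun k => by simp only [hDdef, hv.2.2.1 _ k j, hu.2.2.1 _ k j], le_of_eq ?_⟩
    have h1 : ∀ k, ρ k * deriv (D k t) 0 = ρ k * derivWithin (v k (t + τ)) (Ici 0) 0
        - ρ k * derivWithin (u k t) (Ici 0) 0 := by
      intro k
      rw [(hv.1 k).derivWithin_eq, (hu.1 k).derivWithin_eq, ← mul_sub]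
      congr 1
      exact deriv_fun_sub ((hv.1 k).2.1 _ 0 le_rfl).2.1 ((hu.1 k).2.1 _ 0 le_rfl).2.1
    simp only [h1, Finset.sum_sub_distrib, hv.2.2.2.1, hu.2.2.2.1, sub_self]
  have hanc : ∀ j t x, t ≤ T → 0 ≤ x → 0 ≤ D j t x := by
    refine star_nonneg_of_ancient hρ hD hk (fun j t x _ hx => hB j t x hx) ?_
      (fun j t _ _ => hjun j t)
    intro j t x ht hx hneg
    rw [hop j t x hx]
    exact H j t x ht hx.le (by simpa [hDdef] using hneg)
  suffices 0 ≤ D j t x by simpa [hDdef] using this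
  rcases le_total t T with ht | ht
  · exact hanc j t x ht hx
  have h1 := star_lower_bound hρ hD (s := T) (T := t) (κ := -Λ) le_rfl
    (fun j t x _ _ hx => hB j t x hx) (fun j x hx => by simpa using hanc j T x le_rfl hx)
    (fun j t x _ _ hx hneg => ?_) (fun j t _ _ _ => hjun j t) j t x ht le_rfl hx
  · simpa using h1
  rw [hop j t x hx]
  have h2 : v j (t + τ) x < u j t x := by simpa [hDdef] using hneg
  have h3 := sub_le_mul_sub_of_deriv_le (hf.1.differentiable one_ne_zero) (m := Λ) h2.le
    fun ξ h4 h5 => (le_abs_self _).trans (hΛf ξ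
      (by linarith [(hv.2.1 j (t + τ) x hx.le).1]) (by linarith [(hu.2.1 j t x hx.le).2]))
  simp only [hDdef]
  linarith

theorem FrontLike.mono {f : ℝ → ℝ} {a c : ℝ} {φ : ℝ → ℝ} (hf : Bistable f a)
    (hc : 0 < c) (hφ : TravelingWave f a c φ) {N : ℕ} {ρ : Fin N → ℝ} (hρ : ∀ j, 0 < ρ j)
    {i : Fin N} {u : Fin N → ℝ → ℝ → ℝ} (hu : FrontLike f c φ ρ i u) (j : Fin N) {x : ℝ}
    (hx : 0 ≤ x) : Monotone fun t => u j t x := by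
  intro s t hst
  rcases hst.eq_or_lt with h | h
  · rw [h]
  · simpa using hu.le_shift hf hc hφ hρ hu (sub_pos.2 h) j s hx

theorem FrontLike.le {f : ℝ → ℝ} {a c : ℝ} {φ : ℝ → ℝ} (hf : Bistable f a)
    (hc : 0 < c) (hφ : TravelingWave f a c φ) {N : ℕ} {ρ : Fin N → ℝ} (hρ : ∀ j, 0 < ρ j)
    {i : Fin N} {u v : Fin N → ℝ → ℝ → ℝ} (hu : FrontLike f c φ ρ i u)
    (hv : FrontLike f c φ ρ i v) (j : Fin N) (t : ℝ) {x : ℝ} (hx : 0 ≤ x) :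
    u j t x ≤ v j t x := by
  have h1 : Tendsto (fun τ => v j (t + τ) x) (𝓝[>] 0) (𝓝 (v j t x)) := by
    have h2 : ContinuousAt (fun τ => v j τ x) (t + 0) := by
      rw [add_zero]; exact ((hv.1 j).2.1 t x hx).1.continuousAt
    have h3 := (h2.comp (f := fun τ => t + τ) (by fun_prop)).tendsto.mono_left
      (nhdsWithin_le_nhds (s := Ioi 0))
    simpa [Function.comp_def] using h3
  exact ge_of_tendsto h1 (by
    filter_upwards [self_mem_nhdsWithin] with τ hτ using hu.le_shift hf hc hφ hρ hv hτ j t hx)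

theorem FrontLike.unique {f : ℝ → ℝ} {a c : ℝ} {φ : ℝ → ℝ} (hf : Bistable f a)
    (hc : 0 < c) (hφ : TravelingWave f a c φ) {N : ℕ} {ρ : Fin N → ℝ} (hρ : ∀ j, 0 < ρ j)
    {i : Fin N} {u v : Fin N → ℝ → ℝ → ℝ} (hu : FrontLike f c φ ρ i u)
    (hv : FrontLike f c φ ρ i v) (j : Fin N) (t : ℝ) {x : ℝ} (hx : 0 ≤ x) :
    u j t x = v j t x :=
  le_antisymm (hu.le hf hc hφ hρ hv j t hx) (hv.le hf hc hφ hρ hu j t hx)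

open MeasureTheory

/-- The Gaussian kernel of the heat semigroup at time one. -/
noncomputable def gaussKer (z : ℝ) : ℝ := Real.exp (-(1 / 4) * z ^ 2) / √(4 * Real.pi)

/-- The first derivative of `gaussKer`. -/
noncomputable def gaussKer' (z : ℝ) : ℝ := -(z / 2) * gaussKer z

/-- The second derivative of `gaussKer`. -/
noncomputable def gaussKer'' (z : ℝ) : ℝ := (z ^ 2 / 4 - 1 / 2) * gaussKer z

theorem gaussKer_pos (z : ℝ) : 0 < gaussKer z := by unfold gaussKer; positivity

@[fun_prop] theorem continuous_gaussKer : Continuous gaussKer := by unfold gaussKer; fun_prop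

@[fun_prop] theorem continuous_gaussKer' : Continuous gaussKer' := by unfold gaussKer'; fun_prop

@[fun_prop] theorem continuous_gaussKer'' : Continuous gaussKer'' := by unfold gaussKer''; fun_prop

@[fun_prop] theorem measurable_gaussKer'' : Measurable gaussKer'' :=
  continuous_gaussKer''.measurable

theorem hasDerivAt_gaussKer (z : ℝ) : HasDerivAt gaussKer (gaussKer' z) z := by
  have h1 : HasDerivAt (fun z : ℝ => -(1 / 4) * z ^ 2) (-(1 / 4) * (2 * z)) z := by
    simpa using ((hasDerivAt_id' z).fun_pow 2).const_mul (-(1 / 4 : ℝ))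
  refine (h1.exp.div_const (√(4 * Real.pi))).congr_deriv ?_
  unfold gaussKer' gaussKer; ring

theorem hasDerivAt_gaussKer' (z : ℝ) : HasDerivAt gaussKer' (gaussKer'' z) z := by
  have h1 : HasDerivAt (fun z : ℝ => -(z / 2)) (-(1 / 2)) z :=
    ((hasDerivAt_id' z).div_const 2).neg
  refine (h1.fun_mul (hasDerivAt_gaussKer z)).congr_deriv ?_
  unfold gaussKer'' gaussKer'; ring

theorem integral_gaussKer : ∫ z, gaussKer z = 1 := by
  unfold gaussKer
  rw [integral_div, integral_gaussian]
  rw [show Real.pi / (1 / 4) = 4 * Real.pi by ring]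
  exact div_self (by positivity)

/-- Common decay bound for the Gaussian kernel and its derivatives. -/
theorem exists_gaussKer_bound : ∃ C > 0, ∀ z, |gaussKer z| * (1 + |z|) ≤ C * (1 + z ^ 2)⁻¹ ∧
    |gaussKer' z| * (1 + |z|) ≤ C * (1 + z ^ 2)⁻¹ ∧
    |gaussKer'' z| * (1 + |z|) ≤ C * (1 + z ^ 2)⁻¹ := by
  have hA : 0 < √(4 * Real.pi) := by positivity
  refine ⟨2 * 16 ^ 4 / √(4 * Real.pi), by positivity, fun z => ?_⟩
  have hw : 0 < 1 + z ^ 2 := by positivity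
  have hexp : Real.exp (-(1 / 4) * z ^ 2) ≤ 16 ^ 4 / (1 + z ^ 2) ^ 4 := by
    have h1 : (1 + z ^ 2) / 16 ≤ Real.exp (z ^ 2 / 16) := by
      have := Real.add_one_le_exp (z ^ 2 / 16)
      nlinarith [sq_nonneg z]
    have h2 : ((1 + z ^ 2) / 16) ^ 4 ≤ Real.exp (z ^ 2 / 4) := by
      have h3 := pow_le_pow_left₀ (by positivity) h1 4
      rwa [← Real.exp_nat_mul, show ((4 : ℕ) : ℝ) * (z ^ 2 / 16) = z ^ 2 / 4 by
        push_cast; ring] at h3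
    rw [show -(1 / 4) * z ^ 2 = -(z ^ 2 / 4) by ring, Real.exp_neg]
    have h4 := inv_anti₀ (by positivity) h2
    refine h4.trans (le_of_eq ?_)
    rw [div_pow, inv_div]
  have hg : gaussKer z ≤ 16 ^ 4 / √(4 * Real.pi) / (1 + z ^ 2) ^ 4 := by
    unfold gaussKer
    rw [div_right_comm]
    gcongr
  have habs : |z| ^ 2 = z ^ 2 := sq_abs z
  have hz0 := abs_nonneg z
  have h1 : 1 + |z| ≤ 2 * (1 + z ^ 2) := by nlinarith [sq_nonneg (|z| - 1)]
  have key : ∀ p : ℝ, |p| ≤ 1 + z ^ 2 →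
      |p * gaussKer z| * (1 + |z|) ≤ 2 * 16 ^ 4 / √(4 * Real.pi) * (1 + z ^ 2)⁻¹ := by
    intro p hp
    rw [abs_mul, abs_of_pos (gaussKer_pos z)]
    calc |p| * gaussKer z * (1 + |z|)
        ≤ (1 + z ^ 2) * (16 ^ 4 / √(4 * Real.pi) / (1 + z ^ 2) ^ 4) * (2 * (1 + z ^ 2)) := by
          have := (gaussKer_pos z).le
          gcongr
      _ = 2 * 16 ^ 4 / √(4 * Real.pi) * ((1 + z ^ 2)⁻¹ * (1 + z ^ 2)⁻¹) := by
          field_simp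
      _ ≤ 2 * 16 ^ 4 / √(4 * Real.pi) * (1 + z ^ 2)⁻¹ := by
          have : (1 + z ^ 2)⁻¹ ≤ 1 := inv_le_one_of_one_le₀ (by nlinarith)
          gcongr
          exact mul_le_of_le_one_right (by positivity) this
  refine ⟨?_, ?_, ?_⟩
  · have := key 1 (by rw [abs_one]; nlinarith)
    rwa [one_mul] at this
  · exact key _ (by rw [abs_neg, abs_div, abs_two]; nlinarith [sq_nonneg (|z| - 1)])
  · exact key _ (by rw [abs_le]; constructor <;> nlinarith)

theorem integrable_of_le_inv_one_add_sq {k : ℝ → ℝ} (hk : Continuous k) {C : ℝ}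
    (h : ∀ z, |k z| ≤ C * (1 + z ^ 2)⁻¹) : Integrable k :=
  (integrable_inv_one_add_sq.const_mul C).mono' hk.aestronglyMeasurable
    (Eventually.of_forall h)

theorem abs_le_of_mul_one_add_abs_le {p z C : ℝ} (h : |p| * (1 + |z|) ≤ C) : |p| ≤ C := by
  nlinarith [abs_nonneg p, abs_nonneg z, mul_nonneg (abs_nonneg p) (abs_nonneg z)]

theorem abs_mul_le_of_mul_one_add_abs_le {p z C : ℝ} (h : |p| * (1 + |z|) ≤ C) :
    |p * z| ≤ C := by
  rw [abs_mul]
  nlinarith [abs_nonneg p]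

theorem integrable_gaussKer : Integrable gaussKer := by
  obtain ⟨C, -, h⟩ := exists_gaussKer_bound
  exact integrable_of_le_inv_one_add_sq continuous_gaussKer fun z =>
    abs_le_of_mul_one_add_abs_le (h z).1

theorem integrable_gaussKer' : Integrable gaussKer' := by
  obtain ⟨C, -, h⟩ := exists_gaussKer_bound
  exact integrable_of_le_inv_one_add_sq continuous_gaussKer' fun z =>
    abs_le_of_mul_one_add_abs_le (h z).2.1

theorem integrable_gaussKer'' : Integrable gaussKer'' := by
  obtain ⟨C, -, h⟩ := exists_gaussKer_bound
  exact integrable_of_le_inv_one_add_sq continuous_gaussKer'' fun z =>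
    abs_le_of_mul_one_add_abs_le (h z).2.2

theorem integrable_gaussKer''_mul_id : Integrable fun z => gaussKer'' z * z := by
  obtain ⟨C, -, h⟩ := exists_gaussKer_bound
  exact integrable_of_le_inv_one_add_sq (by fun_prop) fun z =>
    abs_mul_le_of_mul_one_add_abs_le (h z).2.2

/-- Differentiation of a convolution through its kernel. -/
theorem hasDerivAt_integral_kernel {k k' H : ℝ → ℝ} (hk : ∀ z, HasDerivAt k (k' z) z)
    (hk' : Continuous k') {C B : ℝ} (hC : ∀ z, |k z| ≤ C * (1 + z ^ 2)⁻¹)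
    (hC' : ∀ z, |k' z| ≤ C * (1 + z ^ 2)⁻¹) (hH : Continuous H) (hB : ∀ x, |H x| ≤ B) (x : ℝ) :
    HasDerivAt (fun x => ∫ z, k z * H (x - z)) (∫ z, k' z * H (x - z)) x := by
  have hkc : Continuous k := continuous_iff_continuousAt.2 fun z => (hk z).continuousAt
  have hform : ∀ (q : ℝ → ℝ) (x : ℝ), ∫ z, q z * H (x - z) = ∫ y, q (x - y) * H y := by
    intro q x
    rw [← integral_sub_left_eq_self _ volume x]
    simp
  simp only [hform]
  have hB0 : 0 ≤ B := (abs_nonneg _).trans (hB 0)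
  have hC0 : 0 ≤ C := by simpa using (abs_nonneg _).trans (hC 0)
  refine (hasDerivAt_integral_of_dominated_loc_of_deriv_le
    (F := fun x y => k (x - y) * H y) (F' := fun x y => k' (x - y) * H y)
    (bound := fun y => 3 * C * (1 + (x - y) ^ 2)⁻¹ * B) (Metric.ball_mem_nhds x one_pos)
    (Eventually.of_forall fun _ => Continuous.aestronglyMeasurable (by fun_prop)) ?_
    (Continuous.aestronglyMeasurable (by fun_prop)) ?_ ?_ ?_).2
  · refine Integrable.mono' (g := fun y => C * (1 + (x - y) ^ 2)⁻¹ * B) ?_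
      (Continuous.aestronglyMeasurable (by fun_prop)) (Eventually.of_forall fun y => ?_)
    · exact ((integrable_inv_one_add_sq.comp_sub_left x).const_mul C).mul_const B
    · rw [Real.norm_eq_abs, abs_mul]
      exact mul_le_mul (hC _) (hB _) (abs_nonneg _) (by positivity)
  · refine Eventually.of_forall fun y x' hx' => ?_
    rw [Real.norm_eq_abs, abs_mul]
    refine mul_le_mul ((hC' _).trans ?_) (hB _) (abs_nonneg _) (by positivity)
    have h1 : |x' - x| < 1 := by simpa [Real.dist_eq] using hx'
    have h2 : (x' - x) ^ 2 < 1 := by rw [← sq_abs]; nlinarith [abs_nonneg (x' - x)]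
    have h3 : (1 + (x' - y) ^ 2)⁻¹ ≤ 3 * (1 + (x - y) ^ 2)⁻¹ := by
      rw [inv_le_iff_one_le_mul₀ (by positivity), ← div_eq_mul_inv, div_mul_eq_mul_div,
        one_le_div (by positivity)]
      nlinarith [sq_nonneg ((x' - y) + (x' - x))]
    nlinarith
  · exact ((integrable_inv_one_add_sq.comp_sub_left x).const_mul (3 * C)).mul_const B
  · refine Eventually.of_forall fun y x' _ => ?_
    exact ((hk (x' - y)).comp_sub_const x' y).mul_const (H y)

theorem hasDerivAt_integral_kernel_scaled {k k' H : ℝ → ℝ} (hk : ∀ z, HasDerivAt k (k' z) z)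
    (hk' : Continuous k') {C B : ℝ} (hC : ∀ z, |k z| ≤ C * (1 + z ^ 2)⁻¹)
    (hC' : ∀ z, |k' z| ≤ C * (1 + z ^ 2)⁻¹) (hH : Continuous H) (hB : ∀ x, |H x| ≤ B)
    {σ : ℝ} (hσ : 0 < σ) (x : ℝ) :
    HasDerivAt (fun x => ∫ z, k z * H (x - σ * z)) (σ⁻¹ * ∫ z, k' z * H (x - σ * z)) x := by
  have h1 := hasDerivAt_integral_kernel hk hk' hC hC' (H := fun w => H (σ * w))
    (by fun_prop) (fun x => hB _) (x / σ)
  have h2 := h1.comp x ((hasDerivAt_id' x).div_const σ)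
  have h3 : ∀ x z, σ * (x / σ - z) = x - σ * z := fun x z => by field_simp
  simp only [Function.comp_def, h3] at h2
  exact h2.congr_deriv (by ring)

theorem integral_kernel_rescale (k h : ℝ → ℝ) {σ : ℝ} (hσ : 0 < σ) (x : ℝ) :
    ∫ y, σ⁻¹ * k ((x - y) / σ) * h y = ∫ z, k z * h (x - σ * z) := by
  rw [← integral_sub_left_eq_self _ volume x]
  have h1 := Measure.integral_comp_div (fun z => k z * h (x - σ * z)) σ
  rw [smul_eq_mul, abs_of_pos hσ] at h1
  calc _ = ∫ y, σ⁻¹ * (k (y / σ) * h (x - σ * (y / σ))) := by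
        congr 1
        ext y
        have : σ * (y / σ) = y := by field_simp
        simp only [sub_sub_cancel, this]
        ring
    _ = _ := by rw [integral_const_mul, h1, inv_mul_cancel_left₀ hσ.ne']

theorem integral_gaussKer'' : ∫ z, gaussKer'' z = 0 := by
  obtain ⟨C, -, h⟩ := exists_gaussKer_bound
  have h1 := hasDerivAt_integral_kernel hasDerivAt_gaussKer' continuous_gaussKer''
    (fun z => abs_le_of_mul_one_add_abs_le (h z).2.1)
    (fun z => abs_le_of_mul_one_add_abs_le (h z).2.2) (H := fun _ => 1) (B := 1)
    continuous_const (by simp) 0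
  simpa using h1.unique (hasDerivAt_const 0 _)

/-- The measure on (square root of elapsed time, rescaled space) used for heat potentials. -/
noncomputable abbrev heatMeasure : Measure (ℝ × ℝ) := (volume.restrict (Ioi 0)).prod volume

/-- The bounded solution of `U_t = U_xx - K U + H`. -/
noncomputable def heatPot (K : ℝ) (H : ℝ → ℝ → ℝ) (t x : ℝ) : ℝ :=
  ∫ p, 2 * p.1 * Real.exp (-K * p.1 ^ 2) * gaussKer p.2 * H (t - p.1 ^ 2) (x - p.1 * p.2)
    ∂heatMeasure

/-- The spatial derivative of `heatPot`. -/
noncomputable def heatPotX (K : ℝ) (H : ℝ → ℝ → ℝ) (t x : ℝ) : ℝ :=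
  ∫ p, 2 * Real.exp (-K * p.1 ^ 2) * gaussKer' p.2 * H (t - p.1 ^ 2) (x - p.1 * p.2)
    ∂heatMeasure

/-- The second spatial derivative of `heatPot`. -/
noncomputable def heatPotXX (K : ℝ) (H : ℝ → ℝ → ℝ) (t x : ℝ) : ℝ :=
  ∫ p, 2 * Real.exp (-K * p.1 ^ 2) * p.1⁻¹ * gaussKer'' p.2 *
    (H (t - p.1 ^ 2) (x - p.1 * p.2) - H (t - p.1 ^ 2) x) ∂heatMeasure

/-- Jointly continuous, bounded by `B` and `L`-Lipschitz in space. -/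
structure HeatSource (H : ℝ → ℝ → ℝ) (B L : ℝ) : Prop where
  cont : Continuous fun p : ℝ × ℝ => H p.1 p.2
  bdd : ∀ t x, |H t x| ≤ B
  lip : ∀ t x y, |H t x - H t y| ≤ L * |x - y|

theorem HeatSource.continuous_comp {H : ℝ → ℝ → ℝ} {B L : ℝ} (h : HeatSource H B L)
    {α : Type*} [TopologicalSpace α] {p q : α → ℝ} (hp : Continuous p) (hq : Continuous q) :
    Continuous fun a => H (p a) (q a) :=
  h.cont.comp (hp.prodMk hq)

theorem HeatSource.bdd_nonneg {H : ℝ → ℝ → ℝ} {B L : ℝ} (h : HeatSource H B L) : 0 ≤ B :=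
  (abs_nonneg _).trans (h.bdd 0 0)

theorem integrable_heatWeight {w k : ℝ → ℝ}
    (hw : Integrable w) (hk : Integrable k) :
    Integrable (fun p : ℝ × ℝ => w p.1 * k p.2) heatMeasure :=
  hw.restrict.mul_prod hk

theorem integrable_two_mul_exp {K : ℝ} (hK : 0 < K) :
    Integrable fun r : ℝ => 2 * Real.exp (-K * r ^ 2) :=
  (integrable_exp_neg_mul_sq hK).const_mul 2

theorem integrable_two_mul_mul_exp {K : ℝ} (hK : 0 < K) :
    Integrable fun r : ℝ => 2 * r * Real.exp (-K * r ^ 2) := by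
  simpa only [mul_assoc] using (integrable_mul_exp_neg_mul_sq hK).const_mul 2

theorem ae_heatMeasure_pos : ∀ᵐ p ∂heatMeasure, 0 < p.1 := by
  have h : ∀ᵐ r ∂(volume.restrict (Ioi (0 : ℝ))), 0 < r := ae_restrict_mem measurableSet_Ioi
  exact Measure.quasiMeasurePreserving_fst.ae h

section bounds

variable {H : ℝ → ℝ → ℝ} {B L K : ℝ}

theorem HeatSource.norm_le₀ (h : HeatSource H B L) (p : ℝ × ℝ) (t x : ℝ) :
    ‖2 * p.1 * Real.exp (-K * p.1 ^ 2) * gaussKer p.2 * H (t - p.1 ^ 2) (x - p.1 * p.2)‖ ≤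
      |2 * p.1 * Real.exp (-K * p.1 ^ 2)| * |gaussKer p.2| * B := by
  rw [Real.norm_eq_abs, abs_mul, abs_mul]
  exact mul_le_mul_of_nonneg_left (h.bdd _ _) (by positivity)

theorem HeatSource.norm_le₁ (h : HeatSource H B L) (p : ℝ × ℝ) (t x : ℝ) :
    ‖2 * Real.exp (-K * p.1 ^ 2) * gaussKer' p.2 * H (t - p.1 ^ 2) (x - p.1 * p.2)‖ ≤
      |2 * Real.exp (-K * p.1 ^ 2)| * |gaussKer' p.2| * B := by
  rw [Real.norm_eq_abs, abs_mul, abs_mul]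
  exact mul_le_mul_of_nonneg_left (h.bdd _ _) (by positivity)

theorem HeatSource.norm_le₂ (h : HeatSource H B L) {p : ℝ × ℝ} (hp : 0 < p.1) (t x : ℝ) :
    ‖2 * Real.exp (-K * p.1 ^ 2) * p.1⁻¹ * gaussKer'' p.2 *
      (H (t - p.1 ^ 2) (x - p.1 * p.2) - H (t - p.1 ^ 2) x)‖ ≤
      |2 * Real.exp (-K * p.1 ^ 2)| * |gaussKer'' p.2 * p.2| * L := by
  have h1 := h.lip (t - p.1 ^ 2) (x - p.1 * p.2) x
  rw [sub_sub_cancel_left, abs_neg, abs_mul, abs_of_pos hp] at h1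
  rw [Real.norm_eq_abs, abs_mul, abs_mul, abs_mul, abs_mul (gaussKer'' _), abs_inv,
    abs_of_pos hp]
  calc _ ≤ |2 * Real.exp (-K * p.1 ^ 2)| * p.1⁻¹ * |gaussKer'' p.2| * (L * (p.1 * |p.2|)) :=
        mul_le_mul_of_nonneg_left h1 (by positivity)
    _ = _ := by field_simp

theorem integrable_heatBound₀ (hK : 0 < K) (B : ℝ) : Integrable (fun p : ℝ × ℝ =>
    |2 * p.1 * Real.exp (-K * p.1 ^ 2)| * |gaussKer p.2| * B) heatMeasure :=
  (integrable_heatWeight (integrable_two_mul_mul_exp hK).abs integrable_gaussKer.abs).mul_const B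

theorem integrable_heatBound₁ (hK : 0 < K) (B : ℝ) : Integrable (fun p : ℝ × ℝ =>
    |2 * Real.exp (-K * p.1 ^ 2)| * |gaussKer' p.2| * B) heatMeasure :=
  (integrable_heatWeight (integrable_two_mul_exp hK).abs integrable_gaussKer'.abs).mul_const B

theorem integrable_heatBound₂ (hK : 0 < K) (L : ℝ) : Integrable (fun p : ℝ × ℝ =>
    |2 * Real.exp (-K * p.1 ^ 2)| * |gaussKer'' p.2 * p.2| * L) heatMeasure :=
  (integrable_heatWeight (integrable_two_mul_exp hK).abs
    integrable_gaussKer''_mul_id.abs).mul_const L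

theorem HeatSource.integrable₀ (h : HeatSource H B L) (hK : 0 < K) (t x : ℝ) :
    Integrable (fun p : ℝ × ℝ => 2 * p.1 * Real.exp (-K * p.1 ^ 2) * gaussKer p.2 *
      H (t - p.1 ^ 2) (x - p.1 * p.2)) heatMeasure := by
  refine (integrable_heatBound₀ hK B).mono' (Continuous.aestronglyMeasurable ?_)
    (Eventually.of_forall fun p => h.norm_le₀ p t x)
  have := h.continuous_comp (α := ℝ × ℝ) (p := fun p => t - p.1 ^ 2)
    (q := fun p => x - p.1 * p.2) (by fun_prop) (by fun_prop)
  exact Continuous.mul (by fun_prop) this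

theorem HeatSource.integrable₁ (h : HeatSource H B L) (hK : 0 < K) (t x : ℝ) :
    Integrable (fun p : ℝ × ℝ => 2 * Real.exp (-K * p.1 ^ 2) * gaussKer' p.2 *
      H (t - p.1 ^ 2) (x - p.1 * p.2)) heatMeasure := by
  refine (integrable_heatBound₁ hK B).mono' (Continuous.aestronglyMeasurable ?_)
    (Eventually.of_forall fun p => h.norm_le₁ p t x)
  have := h.continuous_comp (α := ℝ × ℝ) (p := fun p => t - p.1 ^ 2)
    (q := fun p => x - p.1 * p.2) (by fun_prop) (by fun_prop)
  exact Continuous.mul (by fun_prop) this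

theorem HeatSource.aestronglyMeasurable₂ (h : HeatSource H B L) (t x : ℝ) :
    AEStronglyMeasurable (fun p : ℝ × ℝ => 2 * Real.exp (-K * p.1 ^ 2) * p.1⁻¹ * gaussKer'' p.2 *
      (H (t - p.1 ^ 2) (x - p.1 * p.2) - H (t - p.1 ^ 2) x)) heatMeasure := by
  have h1 := (h.continuous_comp (α := ℝ × ℝ) (p := fun p => t - p.1 ^ 2)
    (q := fun p => x - p.1 * p.2) (by fun_prop) (by fun_prop)).measurable
  have h2 := (h.continuous_comp (α := ℝ × ℝ) (p := fun p => t - p.1 ^ 2)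
    (q := fun p => x) (by fun_prop) (by fun_prop)).measurable
  exact (Measurable.mul (by fun_prop) (h1.sub h2)).aestronglyMeasurable

theorem HeatSource.integrable₂ (h : HeatSource H B L) (hK : 0 < K) (t x : ℝ) :
    Integrable (fun p : ℝ × ℝ => 2 * Real.exp (-K * p.1 ^ 2) * p.1⁻¹ * gaussKer'' p.2 *
      (H (t - p.1 ^ 2) (x - p.1 * p.2) - H (t - p.1 ^ 2) x)) heatMeasure :=
  (integrable_heatBound₂ hK L).mono' (h.aestronglyMeasurable₂ t x)
    (ae_heatMeasure_pos.mono fun _ hp => h.norm_le₂ hp t x)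

theorem HeatSource.abs_heatPotX_le (h : HeatSource H B L) (hK : 0 < K) (t x : ℝ) :
    |heatPotX K H t x| ≤
      (∫ p : ℝ × ℝ, |2 * Real.exp (-K * p.1 ^ 2)| * |gaussKer' p.2| ∂heatMeasure) * B := by
  rw [← integral_mul_const]
  exact norm_integral_le_of_norm_le (integrable_heatBound₁ hK B)
    (Eventually.of_forall fun p => h.norm_le₁ p t x)

theorem HeatSource.abs_heatPotXX_le (h : HeatSource H B L) (hK : 0 < K) (t x : ℝ) :
    |heatPotXX K H t x| ≤
      (∫ p : ℝ × ℝ, |2 * Real.exp (-K * p.1 ^ 2)| * |gaussKer'' p.2 * p.2| ∂heatMeasure) *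
        L := by
  rw [← integral_mul_const]
  exact norm_integral_le_of_norm_le (integrable_heatBound₂ hK L)
    (ae_heatMeasure_pos.mono fun p hp => h.norm_le₂ hp t x)

end bounds

section continuity

variable {α : Type*} [TopologicalSpace α] [FirstCountableTopology α] {H : α → ℝ → ℝ → ℝ}
  {B L K : ℝ} {τ ξ : α → ℝ}

theorem continuous_heatPot (hK : 0 < K) (h : ∀ a, HeatSource (H a) B L)
    (hH : Continuous fun q : α × ℝ × ℝ => H q.1 q.2.1 q.2.2)
    (hτ : Continuous τ) (hξ : Continuous ξ) :
    Continuous fun a => heatPot K (H a) (τ a) (ξ a) := by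
  refine continuous_of_dominated (bound := fun p : ℝ × ℝ =>
    |2 * p.1 * Real.exp (-K * p.1 ^ 2)| * |gaussKer p.2| * B)
    (fun a => ((h a).integrable₀ hK _ _).aestronglyMeasurable)
    (fun a => Eventually.of_forall fun p => (h a).norm_le₀ p _ _) (integrable_heatBound₀ hK B)
    (Eventually.of_forall fun p => ?_)
  exact continuous_const.mul (hH.comp (continuous_id.prodMk
    ((hτ.sub continuous_const).prodMk (hξ.sub continuous_const))))

theorem continuous_heatPotX (hK : 0 < K) (h : ∀ a, HeatSource (H a) B L)
    (hH : Continuous fun q : α × ℝ × ℝ => H q.1 q.2.1 q.2.2)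
    (hτ : Continuous τ) (hξ : Continuous ξ) :
    Continuous fun a => heatPotX K (H a) (τ a) (ξ a) := by
  refine continuous_of_dominated (bound := fun p : ℝ × ℝ =>
    |2 * Real.exp (-K * p.1 ^ 2)| * |gaussKer' p.2| * B)
    (fun a => ((h a).integrable₁ hK _ _).aestronglyMeasurable)
    (fun a => Eventually.of_forall fun p => (h a).norm_le₁ p _ _) (integrable_heatBound₁ hK B)
    (Eventually.of_forall fun p => ?_)
  exact continuous_const.mul (hH.comp (continuous_id.prodMk
    ((hτ.sub continuous_const).prodMk (hξ.sub continuous_const))))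

theorem continuous_heatPotXX (hK : 0 < K) (h : ∀ a, HeatSource (H a) B L)
    (hH : Continuous fun q : α × ℝ × ℝ => H q.1 q.2.1 q.2.2)
    (hτ : Continuous τ) (hξ : Continuous ξ) :
    Continuous fun a => heatPotXX K (H a) (τ a) (ξ a) := by
  refine continuous_of_dominated (bound := fun p : ℝ × ℝ =>
    |2 * Real.exp (-K * p.1 ^ 2)| * |gaussKer'' p.2 * p.2| * L)
    (fun a => ((h a).integrable₂ hK _ _).aestronglyMeasurable)
    (fun a => ae_heatMeasure_pos.mono fun p hp => (h a).norm_le₂ hp _ _)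
    (integrable_heatBound₂ hK L) (Eventually.of_forall fun p => ?_)
  exact continuous_const.mul ((hH.comp (continuous_id.prodMk
    ((hτ.sub continuous_const).prodMk (hξ.sub continuous_const)))).sub
    (hH.comp (continuous_id.prodMk ((hτ.sub continuous_const).prodMk hξ))))

end continuity

section space

variable {H : ℝ → ℝ → ℝ} {B L K : ℝ}

theorem HeatSource.heatPot_eq (h : HeatSource H B L) (hK : 0 < K) (t x : ℝ) :
    heatPot K H t x = ∫ r in Ioi 0, 2 * r * Real.exp (-K * r ^ 2) *
      ∫ z, gaussKer z * H (t - r ^ 2) (x - r * z) := by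
  rw [heatPot, integral_prod _ (h.integrable₀ hK t x)]
  simp only [mul_assoc, integral_const_mul]

theorem HeatSource.heatPotX_eq (h : HeatSource H B L) (hK : 0 < K) (t x : ℝ) :
    heatPotX K H t x = ∫ r in Ioi 0, 2 * Real.exp (-K * r ^ 2) *
      ∫ z, gaussKer' z * H (t - r ^ 2) (x - r * z) := by
  rw [heatPotX, integral_prod _ (h.integrable₁ hK t x)]
  simp only [mul_assoc, integral_const_mul]

theorem HeatSource.integrable_mul (h : HeatSource H B L) {k : ℝ → ℝ} (hk : Integrable k)
    (t x r : ℝ) : Integrable fun z => k z * H t (x - r * z) :=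
  hk.mul_bdd (c := B)
    (h.continuous_comp continuous_const (by fun_prop)).aestronglyMeasurable
    (Eventually.of_forall fun _ => h.bdd _ _)

theorem HeatSource.heatPotXX_eq (h : HeatSource H B L) (hK : 0 < K) (t x : ℝ) :
    heatPotXX K H t x = ∫ r in Ioi 0, 2 * Real.exp (-K * r ^ 2) * (r⁻¹ *
      ∫ z, gaussKer'' z * H (t - r ^ 2) (x - r * z)) := by
  rw [heatPotXX, integral_prod _ (h.integrable₂ hK t x)]
  simp only [mul_assoc, integral_const_mul]
  congr 2
  funext r
  congr 2
  simp only [mul_sub]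
  rw [integral_sub (h.integrable_mul integrable_gaussKer'' _ _ _)
    (integrable_gaussKer''.mul_const _), integral_mul_const, integral_gaussKer'', zero_mul,
    sub_zero]

end space

section space_derivatives

variable {H : ℝ → ℝ → ℝ} {B L K : ℝ}

theorem HeatSource.hasDerivAt_kernel (h : HeatSource H B L) {r : ℝ} (hr : 0 < r) (t x : ℝ) :
    HasDerivAt (fun x => ∫ z, gaussKer z * H t (x - r * z))
      (r⁻¹ * ∫ z, gaussKer' z * H t (x - r * z)) x := by
  obtain ⟨C, -, hC⟩ := exists_gaussKer_bound
  exact hasDerivAt_integral_kernel_scaled hasDerivAt_gaussKer continuous_gaussKer'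
    (C := C) (fun z => abs_le_of_mul_one_add_abs_le (hC z).1)
    (fun z => abs_le_of_mul_one_add_abs_le (hC z).2.1) (H := H t)
    (h.continuous_comp continuous_const continuous_id) (h.bdd t) hr x

theorem HeatSource.hasDerivAt_kernel' (h : HeatSource H B L) {r : ℝ} (hr : 0 < r) (t x : ℝ) :
    HasDerivAt (fun x => ∫ z, gaussKer' z * H t (x - r * z))
      (r⁻¹ * ∫ z, gaussKer'' z * H t (x - r * z)) x := by
  obtain ⟨C, -, hC⟩ := exists_gaussKer_bound
  exact hasDerivAt_integral_kernel_scaled hasDerivAt_gaussKer' continuous_gaussKer''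
    (C := C) (fun z => abs_le_of_mul_one_add_abs_le (hC z).2.1)
    (fun z => abs_le_of_mul_one_add_abs_le (hC z).2.2) (H := H t)
    (h.continuous_comp continuous_const continuous_id) (h.bdd t) hr x

theorem HeatSource.abs_integral_mul_le (h : HeatSource H B L) {k : ℝ → ℝ} (hk : Integrable k)
    (t x r : ℝ) : |∫ z, k z * H t (x - r * z)| ≤ (∫ z, |k z|) * B := by
  rw [← integral_mul_const, ← Real.norm_eq_abs]
  refine norm_integral_le_of_norm_le (hk.abs.mul_const B) (Eventually.of_forall fun z => ?_)
  rw [Real.norm_eq_abs, abs_mul]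
  exact mul_le_mul_of_nonneg_left (h.bdd _ _) (abs_nonneg _)

theorem HeatSource.abs_integral_gaussKer''_le (h : HeatSource H B L) {r : ℝ} (hr : 0 < r)
    (t x : ℝ) : |r⁻¹ * ∫ z, gaussKer'' z * H t (x - r * z)| ≤
      (∫ z, |gaussKer'' z * z|) * L := by
  have h1 : ∫ z, gaussKer'' z * H t (x - r * z) =
      ∫ z, gaussKer'' z * (H t (x - r * z) - H t x) := by
    simp only [mul_sub]
    rw [integral_sub (h.integrable_mul integrable_gaussKer'' _ _ _)
      (integrable_gaussKer''.mul_const _), integral_mul_const, integral_gaussKer'', zero_mul,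
      sub_zero]
  rw [h1, abs_mul, abs_of_pos (inv_pos.2 hr), inv_mul_le_iff₀ hr, mul_left_comm,
    ← integral_mul_const, ← Real.norm_eq_abs]
  refine norm_integral_le_of_norm_le (integrable_gaussKer''_mul_id.abs.mul_const _) (Eventually.of_forall fun z => ?_)
  have h2 := h.lip t (x - r * z) x
  rw [sub_sub_cancel_left, abs_neg, abs_mul, abs_of_pos hr] at h2
  rw [Real.norm_eq_abs, abs_mul, abs_mul]
  calc _ ≤ |gaussKer'' z| * (L * (r * |z|)) := mul_le_mul_of_nonneg_left h2 (abs_nonneg _)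
    _ = _ := by ring

theorem HeatSource.integrable_iterated₀ (h : HeatSource H B L) (hK : 0 < K) (t x : ℝ) :
    Integrable (fun r => 2 * r * Real.exp (-K * r ^ 2) *
      ∫ z, gaussKer z * H (t - r ^ 2) (x - r * z)) (volume.restrict (Ioi 0)) := by
  simpa only [mul_assoc, integral_const_mul] using (h.integrable₀ hK t x).integral_prod_left

theorem HeatSource.integrable_iterated₁ (h : HeatSource H B L) (hK : 0 < K) (t x : ℝ) :
    Integrable (fun r => 2 * Real.exp (-K * r ^ 2) *
      ∫ z, gaussKer' z * H (t - r ^ 2) (x - r * z)) (volume.restrict (Ioi 0)) := by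
  simpa only [mul_assoc, integral_const_mul] using (h.integrable₁ hK t x).integral_prod_left

theorem HeatSource.integrable_iterated₂ (h : HeatSource H B L) (hK : 0 < K) (t x : ℝ) :
    Integrable (fun r => 2 * Real.exp (-K * r ^ 2) * (r⁻¹ *
      ∫ z, gaussKer'' z * H (t - r ^ 2) (x - r * z))) (volume.restrict (Ioi 0)) := by
  have h0 : ∀ r, ∫ z, gaussKer'' z * (H (t - r ^ 2) (x - r * z) - H (t - r ^ 2) x) =
      ∫ z, gaussKer'' z * H (t - r ^ 2) (x - r * z) := fun r => by
    simp only [mul_sub]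
    rw [integral_sub (h.integrable_mul integrable_gaussKer'' _ _ _)
      (integrable_gaussKer''.mul_const _), integral_mul_const, integral_gaussKer'', zero_mul,
      sub_zero]
  simpa only [mul_assoc, integral_const_mul, h0] using (h.integrable₂ hK t x).integral_prod_left

theorem HeatSource.hasDerivAt_heatPot (h : HeatSource H B L) (hK : 0 < K) (t x : ℝ) :
    HasDerivAt (heatPot K H t) (heatPotX K H t x) x := by
  rw [funext (h.heatPot_eq hK t), h.heatPotX_eq hK]
  refine (hasDerivAt_integral_of_dominated_loc_of_deriv_le
    (F := fun x r => 2 * r * Real.exp (-K * r ^ 2) *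
      ∫ z, gaussKer z * H (t - r ^ 2) (x - r * z))
    (F' := fun x r => 2 * Real.exp (-K * r ^ 2) *
      ∫ z, gaussKer' z * H (t - r ^ 2) (x - r * z))
    (bound := fun r => |2 * Real.exp (-K * r ^ 2)| * ((∫ z, |gaussKer' z|) * B)) univ_mem
    (Eventually.of_forall fun x => (h.integrable_iterated₀ hK t x).aestronglyMeasurable)
    (h.integrable_iterated₀ hK t x) (h.integrable_iterated₁ hK t x).aestronglyMeasurable
    (Eventually.of_forall fun r x _ => ?_)
    ((integrable_two_mul_exp hK).abs.restrict.mul_const _) ?_).2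
  · rw [Real.norm_eq_abs, abs_mul]
    exact mul_le_mul_of_nonneg_left (h.abs_integral_mul_le integrable_gaussKer' _ _ _)
      (abs_nonneg _)
  · filter_upwards [ae_restrict_mem measurableSet_Ioi] with r hr x _
    refine ((h.hasDerivAt_kernel hr (t - r ^ 2) x).const_mul _).congr_deriv ?_
    have : r ≠ 0 := (mem_Ioi.1 hr).ne'
    field_simp

theorem HeatSource.hasDerivAt_heatPotX (h : HeatSource H B L) (hK : 0 < K) (t x : ℝ) :
    HasDerivAt (heatPotX K H t) (heatPotXX K H t x) x := by
  rw [funext (h.heatPotX_eq hK t), h.heatPotXX_eq hK]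
  refine (hasDerivAt_integral_of_dominated_loc_of_deriv_le
    (F := fun x r => 2 * Real.exp (-K * r ^ 2) *
      ∫ z, gaussKer' z * H (t - r ^ 2) (x - r * z))
    (F' := fun x r => 2 * Real.exp (-K * r ^ 2) * (r⁻¹ *
      ∫ z, gaussKer'' z * H (t - r ^ 2) (x - r * z)))
    (bound := fun r => |2 * Real.exp (-K * r ^ 2)| * ((∫ z, |gaussKer'' z * z|) * L)) univ_mem
    (Eventually.of_forall fun x => (h.integrable_iterated₁ hK t x).aestronglyMeasurable)
    (h.integrable_iterated₁ hK t x) (h.integrable_iterated₂ hK t x).aestronglyMeasurable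
    ?_ ((integrable_two_mul_exp hK).abs.restrict.mul_const _) ?_).2
  · filter_upwards [ae_restrict_mem measurableSet_Ioi] with r hr x _
    rw [Real.norm_eq_abs, abs_mul]
    exact mul_le_mul_of_nonneg_left (h.abs_integral_gaussKer''_le hr _ _) (abs_nonneg _)
  · filter_upwards [ae_restrict_mem measurableSet_Ioi] with r hr x _
    exact (h.hasDerivAt_kernel' hr (t - r ^ 2) x).const_mul _

end space_derivatives

section time_derivative

variable {H H' : ℝ → ℝ → ℝ} {B B' L L' K : ℝ}

theorem HeatSource.hasDerivAt_integral_radius (h : HeatSource H B L) (h' : HeatSource H' B' L')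
    (hd : ∀ t x, HasDerivAt (fun τ => H τ x) (H' t x) t) (t x : ℝ) {r : ℝ} (hr : 0 < r) :
    HasDerivAt (fun r => ∫ z, gaussKer z * H (t - r ^ 2) (x - r * z))
      (2 * (r⁻¹ * ∫ z, gaussKer'' z * H (t - r ^ 2) (x - r * z)) -
        2 * r * ∫ z, gaussKer z * H' (t - r ^ 2) (x - r * z)) r := by
  obtain ⟨C, hC0, hC⟩ := exists_gaussKer_bound
  have hB := h.bdd_nonneg
  have hB' := h'.bdd_nonneg
  have hF : ∀ r, 0 < r → ∫ y, r⁻¹ * gaussKer ((x - y) / r) * H (t - r ^ 2) y =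
      ∫ z, gaussKer z * H (t - r ^ 2) (x - r * z) :=
    fun r hr => integral_kernel_rescale _ (H (t - r ^ 2)) hr x
  set F' : ℝ → ℝ → ℝ := fun r y => 2 * r⁻¹ * (r⁻¹ * gaussKer'' ((x - y) / r) * H (t - r ^ 2) y) -
    2 * r * (r⁻¹ * gaussKer ((x - y) / r) * H' (t - r ^ 2) y) with hF'
  have hint : ∀ (k G : ℝ → ℝ) (b : ℝ), Continuous k → (∀ z, |k z| ≤ C * (1 + z ^ 2)⁻¹) →
      Continuous G → (∀ y, |G y| ≤ b) → ∀ r, 0 < r →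
      Integrable fun y => r⁻¹ * k ((x - y) / r) * G y := by
    intro k G b hk hkb hG hGb r hr
    refine Integrable.mul_bdd (c := b) ?_ hG.aestronglyMeasurable (Eventually.of_forall hGb)
    exact (((integrable_of_le_inv_one_add_sq hk hkb).comp_div hr.ne').comp_sub_left x).const_mul _
  have hg0 : ∀ z, |gaussKer z| ≤ C * (1 + z ^ 2)⁻¹ := fun z =>
    abs_le_of_mul_one_add_abs_le (hC z).1
  have hg2 : ∀ z, |gaussKer'' z| ≤ C * (1 + z ^ 2)⁻¹ := fun z =>
    abs_le_of_mul_one_add_abs_le (hC z).2.2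
  have hHc : ∀ s, Continuous (H s) := fun s => h.continuous_comp continuous_const continuous_id
  have hHc' : ∀ s, Continuous (H' s) := fun s => h'.continuous_comp continuous_const continuous_id
  have i0 := hint gaussKer (H (t - r ^ 2)) B continuous_gaussKer hg0 (hHc _) (h.bdd _) r hr
  have i1 := hint gaussKer'' (H (t - r ^ 2)) B continuous_gaussKer'' hg2 (hHc _) (h.bdd _) r hr
  have i2 := hint gaussKer (H' (t - r ^ 2)) B' continuous_gaussKer hg0 (hHc' _) (h'.bdd _) r hr
  have hmain := (hasDerivAt_integral_of_dominated_loc_of_deriv_le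
    (F := fun r y => r⁻¹ * gaussKer ((x - y) / r) * H (t - r ^ 2) y) (F' := F') (x₀ := r)
    (μ := volume)
    (bound := fun y => (2 * (r / 2)⁻¹ * (r / 2)⁻¹ * B + 2 * B') *
      (C * (1 + ((x - y) / (2 * r)) ^ 2)⁻¹))
    (Ioo_mem_nhds (show r / 2 < r by linarith) (show r < 2 * r by linarith)) ?_ i0
    ((i1.const_mul _).sub (i2.const_mul _)).aestronglyMeasurable ?_ ?_ ?_).2
  · have e : ∫ y, F' r y = 2 * (r⁻¹ * ∫ z, gaussKer'' z * H (t - r ^ 2) (x - r * z)) -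
        2 * r * ∫ z, gaussKer z * H' (t - r ^ 2) (x - r * z) := by
      rw [hF', integral_sub (i1.const_mul _) (i2.const_mul _), integral_const_mul,
        integral_const_mul, integral_kernel_rescale _ (H (t - r ^ 2)) hr x,
        integral_kernel_rescale _ (H' (t - r ^ 2)) hr x, mul_assoc]
    rw [← e]
    refine hmain.congr_of_eventuallyEq ?_
    filter_upwards [lt_mem_nhds hr] with s hs
    exact (hF s hs).symm
  · filter_upwards with s
    have := hHc (t - s ^ 2)
    exact Continuous.aestronglyMeasurable (by fun_prop)
  · refine Eventually.of_forall fun y s hs => ?_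
    have hs0 : 0 < s := by linarith [hs.1]
    have hdec : (1 + ((x - y) / s) ^ 2)⁻¹ ≤ (1 + ((x - y) / (2 * r)) ^ 2)⁻¹ := by
      refine inv_anti₀ (by positivity) ?_
      rw [div_pow, div_pow]
      have : s ^ 2 ≤ (2 * r) ^ 2 := pow_le_pow_left₀ hs0.le hs.2.le 2
      gcongr
    have e0 := (hg0 ((x - y) / s)).trans (mul_le_mul_of_nonneg_left hdec hC0.le)
    have e2 := (hg2 ((x - y) / s)).trans (mul_le_mul_of_nonneg_left hdec hC0.le)
    have hinv : s⁻¹ ≤ (r / 2)⁻¹ := inv_anti₀ (by linarith) hs.1.le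
    have eB := h.bdd (t - s ^ 2) y
    have eB' := h'.bdd (t - s ^ 2) y
    have hsi : 0 < s⁻¹ := inv_pos.2 hs0
    set E := C * (1 + ((x - y) / (2 * r)) ^ 2)⁻¹
    have hE : 0 ≤ E := (abs_nonneg _).trans e0
    rw [Real.norm_eq_abs, hF']
    refine (abs_sub _ _).trans ?_
    simp only [abs_mul, abs_two, abs_of_pos hsi, abs_of_pos hs0]
    have a1 : 2 * s⁻¹ * (s⁻¹ * |gaussKer'' ((x - y) / s)| * |H (t - s ^ 2) y|) ≤
        2 * (r / 2)⁻¹ * ((r / 2)⁻¹ * E * B) := by gcongr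
    have a2 : 2 * s * (s⁻¹ * |gaussKer ((x - y) / s)| * |H' (t - s ^ 2) y|) ≤ 2 * (E * B') := by
      rw [show 2 * s * (s⁻¹ * |gaussKer ((x - y) / s)| * |H' (t - s ^ 2) y|) =
        2 * (|gaussKer ((x - y) / s)| * |H' (t - s ^ 2) y|) by field_simp]
      gcongr
    linarith
  · exact ((((integrable_inv_one_add_sq.comp_div (by positivity : (2 * r) ≠ 0)).comp_sub_left
      x).const_mul _)).const_mul _
  · refine Eventually.of_forall fun y s hs => ?_
    have hs0 : 0 < s := by linarith [hs.1]
    have d1 : HasDerivAt (fun s : ℝ => s⁻¹) (-(s ^ 2)⁻¹) s := hasDerivAt_inv hs0.ne'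
    have d2 : HasDerivAt (fun s : ℝ => (x - y) / s) ((x - y) * -(s ^ 2)⁻¹) s := by
      simpa only [div_eq_mul_inv] using d1.const_mul (x - y)
    have d3 := (hasDerivAt_gaussKer ((x - y) / s)).comp s d2
    have d4 : HasDerivAt (fun s : ℝ => t - s ^ 2) (-(2 * s)) s := by
      simpa using ((hasDerivAt_id' s).fun_pow 2).const_sub t
    have d5 := (hd (t - s ^ 2) y).comp s d4
    refine ((d1.fun_mul d3).fun_mul d5).congr_deriv ?_
    simp only [hF', Function.comp_def, gaussKer', gaussKer'']
    field_simp
    ring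

end time_derivative

section time_derivative

variable {H H' : ℝ → ℝ → ℝ} {B B' L L' K : ℝ}

theorem HeatSource.continuous_integral_radius (h : HeatSource H B L) (t x : ℝ) :
    Continuous fun r => ∫ z, gaussKer z * H (t - r ^ 2) (x - r * z) := by
  refine continuous_of_dominated (bound := fun z => |gaussKer z| * B)
    (fun r => (h.integrable_mul integrable_gaussKer _ _ _).aestronglyMeasurable)
    (fun r => Eventually.of_forall fun z => ?_) (integrable_gaussKer.abs.mul_const B)
    (Eventually.of_forall fun z => ?_)
  · rw [Real.norm_eq_abs, abs_mul]
    exact mul_le_mul_of_nonneg_left (h.bdd _ _) (abs_nonneg _)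
  · exact continuous_const.mul (h.continuous_comp (by fun_prop) (by fun_prop))

theorem HeatSource.heatPot_deriv_source (h : HeatSource H B L) (h' : HeatSource H' B' L')
    (hK : 0 < K) (hd : ∀ t x, HasDerivAt (fun τ => H τ x) (H' t x) t) (t x : ℝ) :
    heatPot K H' t x = heatPotXX K H t x - K * heatPot K H t x + H t x := by
  have hexp : ∀ r : ℝ, HasDerivAt (fun r : ℝ => Real.exp (-K * r ^ 2))
      (Real.exp (-K * r ^ 2) * (-K * (2 * r))) r := fun r => by
    simpa using (((hasDerivAt_id' r).fun_pow 2).const_mul (-K)).exp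
  have hJ := h.continuous_integral_radius t x
  set J : ℝ → ℝ := fun r => ∫ z, gaussKer z * H (t - r ^ 2) (x - r * z) with hJdef
  have hJ0 : J 0 = H t x := by
    simp [hJdef, integral_mul_const, integral_gaussKer]
  have j0 := (h.integrable_iterated₀ hK t x).const_mul (-K)
  have j1 := h.integrable_iterated₂ hK t x
  have j2 := h'.integrable_iterated₀ hK t x
  have key := integral_Ioi_of_hasDerivAt_of_tendsto (a := (0 : ℝ)) (m := 0)
    (f := fun r => Real.exp (-K * r ^ 2) * J r)
    (f' := fun r => -K * (2 * r * Real.exp (-K * r ^ 2) *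
        ∫ z, gaussKer z * H (t - r ^ 2) (x - r * z)) +
      2 * Real.exp (-K * r ^ 2) * (r⁻¹ * ∫ z, gaussKer'' z * H (t - r ^ 2) (x - r * z)) -
      2 * r * Real.exp (-K * r ^ 2) * ∫ z, gaussKer z * H' (t - r ^ 2) (x - r * z))
    (Continuous.continuousWithinAt (by fun_prop)) (fun r hr => ?_) ((j0.add j1).sub j2) ?_
  · rw [integral_sub (j0.fun_add j1) j2, integral_add j0 j1, integral_const_mul, ← h.heatPot_eq hK,
      ← h.heatPotXX_eq hK, ← h'.heatPot_eq hK] at key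
    simp only [hJ0] at key
    norm_num at key
    linarith
  · exact ((hexp r).fun_mul (h.hasDerivAt_integral_radius h' hd t x hr)).congr_deriv (by
      ring)
  · have hlim : Tendsto (fun r : ℝ => Real.exp (-K * r ^ 2)) atTop (𝓝 0) := by
      refine Real.tendsto_exp_atBot.comp ?_
      exact (tendsto_pow_atTop two_ne_zero).const_mul_atTop_of_neg (neg_lt_zero.2 hK)
    refine hlim.zero_mul_isBoundedUnder_le ?_
    exact isBoundedUnder_of ⟨_, fun r => h.abs_integral_mul_le integrable_gaussKer _ _ _⟩

/-- Average of `H` over the time window between `t` and `t + a`. -/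
noncomputable def timeAverage (H : ℝ → ℝ → ℝ) (a t x : ℝ) : ℝ := ∫ τ in (0 : ℝ)..1, H (t + a * τ) x

theorem HeatSource.continuous_timeAverage (h : HeatSource H B L) :
    Continuous fun q : ℝ × ℝ × ℝ => timeAverage H q.1 q.2.1 q.2.2 := by
  refine intervalIntegral.continuous_parametric_intervalIntegral_of_continuous'
    (f := fun (q : ℝ × ℝ × ℝ) τ => H (q.2.1 + q.1 * τ) q.2.2) ?_ 0 1
  exact h.continuous_comp (by fun_prop) (by fun_prop)

theorem HeatSource.heatSource_timeAverage (h : HeatSource H B L) (a : ℝ) :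
    HeatSource (timeAverage H a) B L where
  cont := h.continuous_timeAverage.comp (Continuous.prodMk_right a)
  bdd t x := by
    have := intervalIntegral.norm_integral_le_of_norm_le_const (a := 0) (b := 1)
      (f := fun τ => H (t + a * τ) x) (C := B) fun τ _ => h.bdd _ _
    simpa [timeAverage] using this
  lip t x y := by
    have hc : ∀ x, Continuous fun τ => H (t + a * τ) x := fun x =>
      h.continuous_comp (by fun_prop) (by fun_prop)
    have := intervalIntegral.norm_integral_le_of_norm_le_const (a := 0) (b := 1)
      (f := fun τ => H (t + a * τ) x - H (t + a * τ) y) (C := L * |x - y|) fun τ _ => h.lip _ _ _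
    rw [intervalIntegral.integral_sub ((hc x).intervalIntegrable _ _)
      ((hc y).intervalIntegrable _ _)] at this
    simpa [timeAverage] using this

theorem HeatSource.hasDerivAt_timeAverage (h : HeatSource H B L) {a : ℝ} (ha : a ≠ 0) (t x : ℝ) :
    HasDerivAt (fun τ => timeAverage H a τ x) (a⁻¹ * (H (t + a) x - H t x)) t := by
  have hc : Continuous fun τ => H τ x := h.continuous_comp (by fun_prop) (by fun_prop)
  have hΦ : ∀ t, HasDerivAt (fun t => ∫ τ in (0 : ℝ)..t, H τ x) (H t x) t := fun t =>
    (hc.integral_hasStrictDerivAt 0 t).hasDerivAt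
  have e : ∀ t, timeAverage H a t x =
      a⁻¹ * ((∫ τ in (0 : ℝ)..(t + a), H τ x) - ∫ τ in (0 : ℝ)..t, H τ x) := fun t => by
    rw [timeAverage, intervalIntegral.integral_comp_add_mul (fun τ => H τ x) ha,
      intervalIntegral.integral_interval_sub_left (hc.intervalIntegrable _ _)
        (hc.intervalIntegrable _ _)]
    simp
  simp only [e]
  exact (((hΦ (t + a)).comp_add_const t a).sub (hΦ t)).const_mul _

theorem HeatSource.heatPot_sub (h : HeatSource H B L) (hK : 0 < K) (b a t x : ℝ) :
    heatPot K (fun t x => b * (H (t + a) x - H t x)) t x =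
      b * (heatPot K H (t + a) x - heatPot K H t x) := by
  simp only [heatPot]
  rw [← integral_sub (h.integrable₀ hK _ _) (h.integrable₀ hK _ _), ← integral_const_mul]
  congr 1
  funext p
  rw [show t - p.1 ^ 2 + a = t + a - p.1 ^ 2 by ring]
  ring

theorem HeatSource.heatSource_sub (h : HeatSource H B L) (b a : ℝ) :
    HeatSource (fun t x => b * (H (t + a) x - H t x)) (|b| * (B + B)) (|b| * (L + L)) where
  cont := continuous_const.mul ((h.continuous_comp (by fun_prop) (by fun_prop)).sub
    (h.continuous_comp (by fun_prop) (by fun_prop)))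
  bdd t x := by
    rw [abs_mul]
    exact mul_le_mul_of_nonneg_left ((abs_sub _ _).trans (add_le_add (h.bdd _ _) (h.bdd _ _)))
      (abs_nonneg _)
  lip t x y := by
    rw [← mul_sub, abs_mul, mul_assoc]
    refine mul_le_mul_of_nonneg_left ?_ (abs_nonneg _)
    rw [show H (t + a) x - H t x - (H (t + a) y - H t y) =
      H (t + a) x - H (t + a) y - (H t x - H t y) by ring, add_mul]
    exact (abs_sub _ _).trans (add_le_add (h.lip _ _ _) (h.lip _ _ _))

theorem HeatSource.hasDerivAt_heatPot_time (h : HeatSource H B L) (hK : 0 < K) (t x : ℝ) :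
    HasDerivAt (fun τ => heatPot K H τ x)
      (heatPotXX K H t x - K * heatPot K H t x + H t x) t := by
  set Q : ℝ → ℝ := fun a => heatPotXX K (timeAverage H a) t x -
    K * heatPot K (timeAverage H a) t x + timeAverage H a t x with hQ
  have hQc : Continuous Q :=
    ((continuous_heatPotXX hK h.heatSource_timeAverage h.continuous_timeAverage continuous_const
      continuous_const).sub (continuous_const.mul (continuous_heatPot hK h.heatSource_timeAverage
      h.continuous_timeAverage continuous_const continuous_const))).add
      (h.continuous_timeAverage.comp (Continuous.prodMk_left (t, x)))
  have h0 : timeAverage H 0 = H := by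
    funext t x
    simp [timeAverage]
  rw [hasDerivAt_iff_tendsto_slope_zero]
  have hlim : Tendsto Q (𝓝[≠] 0) (𝓝 (Q 0)) := (hQc.tendsto 0).mono_left nhdsWithin_le_nhds
  simp only [hQ, h0] at hlim
  refine hlim.congr' ?_
  filter_upwards [self_mem_nhdsWithin] with a ha
  rw [smul_eq_mul, ← h.heatPot_sub hK, ← (h.heatSource_timeAverage a).heatPot_deriv_source
    (h.heatSource_sub a⁻¹ a) hK fun t x => h.hasDerivAt_timeAverage ha t x]

end time_derivative

section heatPot_consequences

variable {H H' : ℝ → ℝ → ℝ} {B B' L L' K : ℝ}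

theorem HeatSource.continuous_heatPot (h : HeatSource H B L) (hK : 0 < K) :
    Continuous fun p : ℝ × ℝ => heatPot K H p.1 p.2 :=
  _root_.continuous_heatPot hK (fun _ => h) (h.continuous_comp (by fun_prop) (by fun_prop))
    continuous_fst continuous_snd

theorem HeatSource.continuous_heatPotX (h : HeatSource H B L) (hK : 0 < K) :
    Continuous fun p : ℝ × ℝ => heatPotX K H p.1 p.2 :=
  _root_.continuous_heatPotX hK (fun _ => h) (h.continuous_comp (by fun_prop) (by fun_prop))
    continuous_fst continuous_snd

theorem HeatSource.continuous_heatPotXX (h : HeatSource H B L) (hK : 0 < K) :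
    Continuous fun p : ℝ × ℝ => heatPotXX K H p.1 p.2 :=
  _root_.continuous_heatPotXX hK (fun _ => h) (h.continuous_comp (by fun_prop) (by fun_prop))
    continuous_fst continuous_snd

theorem HeatSource.deriv_heatPot (h : HeatSource H B L) (hK : 0 < K) (t : ℝ) :
    deriv (heatPot K H t) = heatPotX K H t :=
  funext fun x => (h.hasDerivAt_heatPot hK t x).deriv

theorem HeatSource.deriv_deriv_heatPot (h : HeatSource H B L) (hK : 0 < K) (t : ℝ) :
    deriv (deriv (heatPot K H t)) = heatPotXX K H t := by
  rw [h.deriv_heatPot hK]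
  exact funext fun x => (h.hasDerivAt_heatPotX hK t x).deriv

theorem heatPot_const (hK : 0 < K) (b t x : ℝ) : heatPot K (fun _ _ => b) t x = b / K := by
  have h : HeatSource (fun _ _ => b) |b| 0 :=
    ⟨continuous_const, fun _ _ => le_rfl, fun _ _ _ => by simp⟩
  have h0 : HeatSource (fun _ _ => 0) 0 0 :=
    ⟨continuous_const, fun _ _ => by simp, fun _ _ _ => by simp⟩
  have := h.heatPot_deriv_source h0 hK (fun t x => hasDerivAt_const t b) t x
  simp only [heatPot, heatPotXX, sub_self, mul_zero, integral_zero] at this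
  rw [eq_div_iff hK.ne', heatPot]
  linarith

end heatPot_consequences

theorem Bistable.nonpos {f : ℝ → ℝ} {a : ℝ} (hf : Bistable f a) {s : ℝ} (h0 : 0 ≤ s)
    (h1 : s ≤ a) : f s ≤ 0 := by
  obtain ⟨-, -, -, f0, fa, -, hneg, -⟩ := hf
  rcases h0.eq_or_lt with rfl | h0
  · exact f0.le
  rcases h1.eq_or_lt with rfl | h1
  · exact fa.le
  exact (hneg s h0 h1).le

theorem Bistable.nonneg {f : ℝ → ℝ} {a : ℝ} (hf : Bistable f a) {s : ℝ} (h0 : a ≤ s)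
    (h1 : s ≤ 1) : 0 ≤ f s := by
  obtain ⟨-, -, -, -, fa, f1, -, hpos, -⟩ := hf
  rcases h0.eq_or_lt with rfl | h0
  · exact fa.ge
  rcases h1.eq_or_lt with rfl | h1
  · exact f1.ge
  exact (hpos s h0 h1).le

section travelling_wave

variable {f : ℝ → ℝ} {a c : ℝ} {φ : ℝ → ℝ}

theorem TravelingWave.hasDerivAt (hφ : TravelingWave f a c φ) (z : ℝ) :
    HasDerivAt φ (deriv φ z) z :=
  ((hφ.1.differentiable two_ne_zero) z).hasDerivAt

theorem TravelingWave.contDiff_deriv (hφ : TravelingWave f a c φ) : ContDiff ℝ 1 (deriv φ) :=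
  ((contDiff_succ_iff_deriv (n := 1)).1 (by simpa [one_add_one_eq_two] using hφ.1)).2.2

theorem TravelingWave.hasDerivAt_deriv (hφ : TravelingWave f a c φ) (z : ℝ) :
    HasDerivAt (deriv φ) (deriv (deriv φ) z) z :=
  ((hφ.contDiff_deriv.differentiable one_ne_zero) z).hasDerivAt

theorem TravelingWave.neg_deriv_le_exp (hf : Bistable f a) (hφ : TravelingWave f a c φ) {z : ℝ}
    (hz : 0 ≤ z) : -deriv φ z ≤ -deriv φ 0 * Real.exp (-(c * z)) := by
  have hexp : ∀ z, HasDerivAt (fun z => Real.exp (c * z)) (Real.exp (c * z) * c) z := fun z => by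
    simpa using ((hasDerivAt_id' z).const_mul c).exp
  have hd : ∀ z, HasDerivAt (fun z => Real.exp (c * z) * deriv φ z)
      (-(Real.exp (c * z) * f (φ z))) z := fun z =>
    ((hexp z).fun_mul (hφ.hasDerivAt_deriv z)).congr_deriv (by
      linear_combination Real.exp (c * z) * hφ.2.1 z)
  have hmono : MonotoneOn (fun z => Real.exp (c * z) * deriv φ z) (Ici 0) := by
    refine monotoneOn_of_deriv_nonneg (convex_Ici 0)
      (fun z _ => (hd z).continuousAt.continuousWithinAt)
      (fun z _ => (hd z).differentiableAt.differentiableWithinAt) fun z hz => ?_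
    rw [interior_Ici, mem_Ioi] at hz
    rw [(hd z).deriv]
    have h1 : φ z ≤ a := hφ.2.2.2.2.2.2 ▸ (hφ.strictAnti hz).le
    have := hf.nonpos (hφ.2.2.1 z).1.le h1
    nlinarith [Real.exp_pos (c * z)]
  have h := hmono self_mem_Ici (mem_Ici.2 hz) hz
  simp only [mul_zero, Real.exp_zero, one_mul] at h
  rw [Real.exp_neg, ← div_eq_mul_inv, le_div_iff₀ (Real.exp_pos _)]
  linarith

theorem TravelingWave.le_exp (hf : Bistable f a) (hc : 0 < c) (hφ : TravelingWave f a c φ) {z : ℝ}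
    (hz : 0 ≤ z) : φ z ≤ -deriv φ 0 / c * Real.exp (-(c * z)) := by
  have hexp : ∀ z, HasDerivAt (fun z => Real.exp (-(c * z))) (Real.exp (-(c * z)) * -c) z :=
    fun z => by simpa using ((hasDerivAt_id' z).const_mul c).neg.exp
  have hd : ∀ z, HasDerivAt (fun z => φ z - -deriv φ 0 / c * Real.exp (-(c * z)))
      (deriv φ z + -deriv φ 0 * Real.exp (-(c * z))) z := fun z =>
    ((hφ.hasDerivAt z).sub ((hexp z).const_mul _)).congr_deriv (by field_simp; ring)
  have hmono : MonotoneOn (fun z => φ z - -deriv φ 0 / c * Real.exp (-(c * z))) (Ici 0) := by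
    refine monotoneOn_of_deriv_nonneg (convex_Ici 0)
      (fun z _ => (hd z).continuousAt.continuousWithinAt)
      (fun z _ => (hd z).differentiableAt.differentiableWithinAt) fun z hz => ?_
    rw [interior_Ici, mem_Ioi] at hz
    rw [(hd z).deriv]
    linarith [hφ.neg_deriv_le_exp hf hz.le]
  have hlim : Tendsto (fun z => φ z - -deriv φ 0 / c * Real.exp (-(c * z))) atTop (𝓝 0) := by
    have h1 : Tendsto (fun z : ℝ => Real.exp (-(c * z))) atTop (𝓝 0) :=
      Real.tendsto_exp_neg_atTop_nhds_zero.comp (tendsto_id.const_mul_atTop hc)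
    simpa using hφ.2.2.2.2.1.sub (h1.const_mul (-deriv φ 0 / c))
  have : φ z - -deriv φ 0 / c * Real.exp (-(c * z)) ≤ 0 := by
    refine ge_of_tendsto hlim ?_
    filter_upwards [eventually_ge_atTop z] with y hy
    exact hmono (mem_Ici.2 hz) (mem_Ici.2 (hz.trans hy)) hy
  linarith

theorem TravelingWave.neg_deriv_le (hf : Bistable f a) (hc : 0 < c) (hφ : TravelingWave f a c φ)
    (z : ℝ) : -deriv φ z ≤ c - deriv φ 0 := by
  rcases le_or_gt 0 z with hz | hz
  · have h1 := hφ.neg_deriv_le_exp hf hz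
    have h2 : Real.exp (-(c * z)) ≤ 1 := Real.exp_le_one_iff.2 (by nlinarith)
    have h3 := hφ.2.2.2.2.2.1 0
    nlinarith
  · have hd : ∀ z, HasDerivAt (fun z => deriv φ z + c * φ z) (-f (φ z)) z := fun z =>
      ((hφ.hasDerivAt_deriv z).add ((hφ.hasDerivAt z).const_mul c)).congr_deriv
        (by linarith [hφ.2.1 z])
    have hanti : AntitoneOn (fun z => deriv φ z + c * φ z) (Iic 0) := by
      refine antitoneOn_of_deriv_nonpos (convex_Iic 0)
        (fun z _ => (hd z).continuousAt.continuousWithinAt)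
        (fun z _ => (hd z).differentiableAt.differentiableWithinAt) fun z hz => ?_
      rw [interior_Iic, mem_Iio] at hz
      rw [(hd z).deriv]
      have h1 : a ≤ φ z := hφ.2.2.2.2.2.2 ▸ (hφ.strictAnti hz).le
      linarith [hf.nonneg h1 (hφ.2.2.1 z).2.le]
    have h := hanti (mem_Iic.2 hz.le) self_mem_Iic hz.le
    simp only at h
    nlinarith [hφ.2.2.1 z, hφ.2.2.1 0]

theorem TravelingWave.exists_exp_bound (hf : Bistable f a) (hc : 0 < c)
    (hφ : TravelingWave f a c φ) :
    ∃ C > 0, ∀ z, -deriv φ z ≤ C * Real.exp (-(c * z)) ∧ φ z ≤ C * Real.exp (-(c * z)) := by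
  have h0 := hφ.2.2.2.2.2.1 0
  set A := -deriv φ 0 with hA
  have hA0 : 0 < A := by linarith
  have hAc : 0 < A / c := by positivity
  refine ⟨1 + A + c + A / c, by positivity, fun z => ?_⟩
  have hE := Real.exp_pos (-(c * z))
  rcases le_or_gt 0 z with hz | hz
  · have h1 := hφ.neg_deriv_le_exp hf hz
    have h2 := hφ.le_exp hf hc hz
    rw [← hA] at h1 h2
    exact ⟨h1.trans (by gcongr; linarith), h2.trans (by gcongr; linarith)⟩
  · have h1 : 1 ≤ Real.exp (-(c * z)) := Real.one_le_exp (by nlinarith)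
    have h2 := hφ.neg_deriv_le hf hc z
    have h3 := (hφ.2.2.1 z).2
    constructor <;> nlinarith

theorem TravelingWave.abs_sub_le (hf : Bistable f a) (hc : 0 < c) (hφ : TravelingWave f a c φ)
    (x y : ℝ) : |φ x - φ y| ≤ (c - deriv φ 0) * |x - y| := by
  refine Convex.norm_image_sub_le_of_norm_deriv_le (s := univ)
    (fun z _ => (hφ.hasDerivAt z).differentiableAt) (fun z _ => ?_) convex_univ (mem_univ y)
    (mem_univ x)
  rw [Real.norm_eq_abs, abs_of_neg (hφ.2.2.2.2.2.1 z)]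
  exact hφ.neg_deriv_le hf hc z

theorem TravelingWave.exists_dissipation (hf : Bistable f a) (hφ : TravelingWave f a c φ) :
    ∃ σ > 0, ∃ δ > 0, δ ≤ 1 / 2 ∧ ∀ z ξ, |ξ - φ z| ≤ δ → deriv f ξ ≤ -(σ * deriv φ z) := by
  obtain ⟨η, hη, k, hk, hdec⟩ := hf.exists_decreasing
  obtain ⟨Λ, hΛ, hbd⟩ := hf.exists_abs_deriv_le
  obtain ⟨M, hM, hR, hL⟩ := hφ.exists_tails (half_pos hη)
  obtain ⟨z₀, -, hz₀⟩ := isCompact_Icc.exists_isMaxOn (s := Icc (-M) M)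
    (nonempty_Icc.2 (by linarith)) hφ.contDiff_deriv.continuous.continuousOn
  have hm := hφ.2.2.2.2.2.1 z₀
  refine ⟨Λ / -deriv φ z₀, div_pos hΛ (by linarith), min (η / 2) (1 / 2), by positivity,
    min_le_right _ _, fun z ξ hξ => ?_⟩
  have h1 := abs_le.1 (hξ.trans (min_le_left _ _))
  have h2 := abs_le.1 (hξ.trans (min_le_right _ _))
  have hz := hφ.2.2.1 z
  have hσ : 0 ≤ -(Λ / -deriv φ z₀ * deriv φ z) := by
    have : 0 < Λ / -deriv φ z₀ := div_pos hΛ (by linarith)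
    nlinarith [hφ.2.2.2.2.2.1 z]
  rcases le_or_gt M z with hMz | hMz
  · have := hR z hMz
    have := hdec ξ (Or.inl (abs_le.2 ⟨by linarith, by linarith⟩))
    linarith
  rcases le_or_gt z (-M) with hzM | hzM
  · have := hL z hzM
    have := hdec ξ (Or.inr (abs_le.2 ⟨by linarith, by linarith⟩))
    linarith
  · have h3 := (abs_le.1 (hbd ξ (by linarith) (by linarith))).2
    have h4 : deriv φ z ≤ deriv φ z₀ := hz₀ ⟨hzM.le, hMz.le⟩
    refine h3.trans ?_
    rw [← mul_neg, div_mul_eq_mul_div, le_div_iff₀ (by linarith)]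
    nlinarith

end travelling_wave

/-- Amplitude `q` and phase shift `ζ` turning the travelling wave into a sub- and a
supersolution of the star-graph problem. -/
structure WaveBarrier (f φ : ℝ → ℝ) (c κ : ℝ) (q q' ζ ζ' : ℝ → ℝ) : Prop where
  hasDerivAt_q : ∀ t, HasDerivAt q (q' t) t
  hasDerivAt_ζ : ∀ t, HasDerivAt ζ (ζ' t) t
  q_pos : ∀ t, 0 < q t
  ζ_nonneg : ∀ t, 0 ≤ ζ t
  κ_pos : 0 < κ
  tendsto_q : Tendsto q atBot (𝓝 0)
  tendsto_ζ : Tendsto ζ atBot (𝓝 0)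
  super : ∀ t z e, 0 ≤ e → e ≤ 1 → φ z + q t * (1 + κ * e) < 1 →
    f (φ z + q t * (1 + κ * e)) ≤
      f (φ z) - ζ' t * deriv φ z + q' t * (1 + κ * e) - q t * (κ * e)
  sub : ∀ t z, 0 < φ z - q t → f (φ z) + ζ' t * deriv φ z - q' t ≤ f (φ z - q t)
  super_junction : ∀ t, φ (-(c * t) - ζ t) + q t * (1 + κ) < 1 →
    -deriv φ (-(c * t) - ζ t) ≤ κ * q t
  sub_junction : ∀ t, φ (-(c * t) + ζ t) ≤ q t

theorem exists_waveBarrier {f : ℝ → ℝ} {a c : ℝ} {φ : ℝ → ℝ} (hf : Bistable f a) (hc : 0 < c)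
    (hφ : TravelingWave f a c φ) : ∃ κ q q' ζ ζ', WaveBarrier f φ c κ q q' ζ ζ' := by
  obtain ⟨σ, hσ, δ, hδ, hδ', hdis⟩ := hφ.exists_dissipation hf
  obtain ⟨Λ, hΛ, hbd⟩ := hf.exists_abs_deriv_le
  obtain ⟨C, hC, hCφ⟩ := hφ.exists_exp_bound hf hc
  have hfd : Differentiable ℝ f := hf.1.differentiable one_ne_zero
  set μ : ℝ := c ^ 2 with hμ
  have hμ0 : 0 < μ := by positivity
  set κ : ℝ := min 1 μ with hκ
  have hκ0 : 0 < κ := by positivity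
  have hκ1 : κ ≤ 1 := min_le_left _ _
  have hκμ : κ ≤ μ := min_le_right _ _
  set M : ℝ := max μ (2 * Λ + 2) with hM
  have hMμ : μ ≤ M := le_max_left _ _
  have hMΛ : 2 * Λ + 2 ≤ M := le_max_right _ _
  have hM0 : 0 < M := hμ0.trans_le hMμ
  set ε : ℝ := δ / 4 with hε
  have hε0 : 0 < ε := by positivity
  obtain ⟨t₀, ht₀⟩ : ∃ t₀, C * Real.exp (2 * σ / μ * c) ≤ κ * ε * Real.exp (μ * t₀) := by
    have h1 : Tendsto (fun t₀ => κ * ε * Real.exp (μ * t₀)) atTop atTop :=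
      (Real.tendsto_exp_atTop.comp (tendsto_id.const_mul_atTop hμ0)).const_mul_atTop
        (by positivity)
    exact (h1.eventually_ge_atTop _).exists
  have hE : ∀ m t : ℝ, HasDerivAt (fun t => Real.exp (m * (t + t₀)))
      (Real.exp (m * (t + t₀)) * m) t := fun m t => by
    simpa using (((hasDerivAt_id' t).add_const t₀).const_mul m).exp
  have hlim : ∀ m : ℝ, 0 < m → Tendsto (fun t => Real.exp (m * (t + t₀))) atBot (𝓝 0) :=
    fun m hm => Real.tendsto_exp_atBot.comp
      ((tendsto_atBot_add_const_right _ t₀ tendsto_id).const_mul_atBot hm)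
  set q : ℝ → ℝ := fun t => ε * (Real.exp (μ * (t + t₀)) + Real.exp (M * (t + t₀))) with hq
  set q' : ℝ → ℝ := fun t => ε * (Real.exp (μ * (t + t₀)) * μ + Real.exp (M * (t + t₀)) * M)
    with hq'
  set ζ : ℝ → ℝ := fun t =>
    2 * σ * ε * (Real.exp (μ * (t + t₀)) / μ + Real.exp (M * (t + t₀)) / M) with hζ
  have hqpos : ∀ t, 0 < q t := fun t => by positivity
  have hζ0 : ∀ t, 0 ≤ ζ t := fun t => by positivity
  have hq'μ : ∀ t, μ * q t ≤ q' t := fun t => by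
    have := Real.exp_pos (M * (t + t₀))
    have h2 : Real.exp (M * (t + t₀)) * μ ≤ Real.exp (M * (t + t₀)) * M := by gcongr
    simp only [hq, hq']
    nlinarith
  have hζq : ∀ t, ζ t ≤ 2 * σ / μ * q t := fun t => by
    simp only [hq, hζ]
    have h2 : Real.exp (M * (t + t₀)) / M ≤ Real.exp (M * (t + t₀)) / μ := by gcongr
    calc _ ≤ 2 * σ * ε * (Real.exp (μ * (t + t₀)) / μ + Real.exp (M * (t + t₀)) / μ) := by gcongr
      _ = _ := by field_simp
  have hlarge : ∀ t, δ / 2 < q t → (Λ + 1) * q t ≤ q' t := fun t ht => by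
    have h0 : 0 ≤ t + t₀ := by
      by_contra! hneg
      have h1 : Real.exp (μ * (t + t₀)) ≤ 1 := Real.exp_le_one_iff.2 (by nlinarith)
      have h2 : Real.exp (M * (t + t₀)) ≤ 1 := Real.exp_le_one_iff.2 (by nlinarith)
      simp only [hq] at ht
      nlinarith
    have h1 : Real.exp (μ * (t + t₀)) ≤ Real.exp (M * (t + t₀)) :=
      Real.exp_le_exp.2 (by nlinarith)
    have h2 := Real.exp_pos (μ * (t + t₀))
    simp only [hq, hq']
    rw [mul_left_comm]
    refine mul_le_mul_of_nonneg_left ?_ hε0.le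
    nlinarith
  have hCE : ∀ t, C * Real.exp (2 * σ / μ * c) * Real.exp (μ * t) ≤ κ * q t := fun t => by
    calc _ ≤ κ * ε * Real.exp (μ * t₀) * Real.exp (μ * t) := by gcongr
      _ = κ * (ε * Real.exp (μ * (t + t₀))) := by rw [mul_add, Real.exp_add]; ring
      _ ≤ κ * q t := by
        have := Real.exp_pos (M * (t + t₀))
        simp only [hq]
        gcongr
        linarith
  have hdq : ∀ t, HasDerivAt q (q' t) t := fun t => ((hE μ t).add (hE M t)).const_mul ε
  have hdζ : ∀ t, HasDerivAt ζ (2 * σ * q t) t := fun t => by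
    refine ((((hE μ t).div_const μ).add ((hE M t).div_const M)).const_mul (2 * σ * ε)).congr_deriv
      ?_
    simp only [hq]
    field_simp
  have hlq : Tendsto q atBot (𝓝 0) := by
    simpa using ((hlim μ hμ0).add (hlim M hM0)).const_mul ε
  have hlζ : Tendsto ζ atBot (𝓝 0) := by
    simpa using (((hlim μ hμ0).div_const μ).add ((hlim M hM0).div_const M)).const_mul (2 * σ * ε)
  clear_value q q' ζ κ μ M ε
  refine ⟨κ, q, q', ζ, fun t => 2 * σ * q t, hdq, hdζ, hqpos, hζ0, hκ0, hlq, hlζ,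
    fun t z e he0 he1 hlt => ?_, fun t z hlt => ?_, fun t hlt => ?_, fun t => ?_⟩
  · have hz := hφ.2.2.1 z
    have hd := hφ.2.2.2.2.2.1 z
    have hqt := hqpos t
    set h := 1 + κ * e with hh
    have hκe : 0 ≤ κ * e := by positivity
    have hκe1 : κ * e ≤ κ := mul_le_of_le_one_right hκ0.le he1
    have hh1 : 1 ≤ h := by linarith
    have hh2 : h ≤ 2 := by linarith
    have hp : 0 < q t * h := by positivity
    have hqh : q t ≤ q t * h := le_mul_of_one_le_right hqt.le hh1
    have hqh2 := mul_le_mul_of_nonneg_left hh2 hqt.le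
    rcases le_or_gt (q t) (δ / 2) with hs | hs
    · have h1 := sub_le_mul_sub_of_deriv_le hfd (p := φ z) (q := φ z + q t * h)
        (m := -(σ * deriv φ z)) (by linarith) fun ξ h1 h2 => hdis z ξ (by
          rw [abs_of_nonneg (by linarith)]; linarith)
      rw [add_sub_cancel_left] at h1
      have h2 : -(σ * deriv φ z) * (q t * h) ≤ -(2 * σ * q t * deriv φ z) := by
        have h3 : 0 ≤ σ * -deriv φ z * q t :=
          mul_nonneg (mul_nonneg hσ.le (by linarith)) hqt.le
        have h4 := mul_le_mul_of_nonneg_left hh2 h3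
        linarith
      have h3 : q t * (κ * e) ≤ q' t * h := by
        have h4 : q t * (κ * e) ≤ μ * q t := by
          rw [mul_comm μ]
          exact mul_le_mul_of_nonneg_left (hκe1.trans hκμ) hqt.le
        have h5 : 0 ≤ q' t := (mul_pos hμ0 hqt).le.trans (hq'μ t)
        exact (h4.trans (hq'μ t)).trans (le_mul_of_one_le_right h5 hh1)
      linarith
    · have h1 := sub_le_mul_sub_of_deriv_le hfd (p := φ z) (q := φ z + q t * h)
        (m := Λ) (by linarith) fun ξ h1 h2 => (le_abs_self _).trans
          (hbd ξ (by linarith) (by linarith))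
      rw [add_sub_cancel_left] at h1
      have h2 : 0 ≤ -(2 * σ * q t * deriv φ z) := by
        have := mul_nonneg (mul_pos hσ hqt).le (by linarith : 0 ≤ -deriv φ z)
        linarith
      have h3 := mul_le_mul_of_nonneg_right (hlarge t hs) (by linarith : (0 : ℝ) ≤ h)
      have h4 : q t * (κ * e) ≤ q t * h := by
        gcongr
        linarith
      linarith
  · have hz := hφ.2.2.1 z
    have hd := hφ.2.2.2.2.2.1 z
    have hqt := hqpos t
    have hp := mul_nonneg (mul_pos hσ hqt).le (by linarith : 0 ≤ -deriv φ z)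
    have hμq := mul_pos hμ0 hqt
    rcases le_or_gt (q t) (δ / 2) with hs | hs
    · have h1 := sub_le_mul_sub_of_deriv_le hfd (p := φ z - q t) (q := φ z)
        (m := -(σ * deriv φ z)) (by linarith) fun ξ h1 h2 => hdis z ξ (by
          rw [abs_of_nonpos (by linarith)]; linarith)
      have h3 := hq'μ t
      linarith
    · have h1 := sub_le_mul_sub_of_deriv_le hfd (p := φ z - q t) (q := φ z)
        (m := Λ) (by linarith) fun ξ h1 h2 => (le_abs_self _).trans
          (hbd ξ (by linarith) (by linarith))
      have h3 := hlarge t hs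
      linarith
  · have hqt := hqpos t
    have h1 : q t ≤ 1 := by
      have := (hφ.2.2.1 (-(c * t) - ζ t)).1
      nlinarith
    have h2 : ζ t ≤ 2 * σ / μ := (hζq t).trans (mul_le_of_le_one_right (by positivity) h1)
    refine ((hCφ _).1.trans ?_).trans (hCE t)
    rw [mul_assoc, ← Real.exp_add]
    gcongr
    rw [hμ] at *
    nlinarith
  · have h1 : κ * q t ≤ q t := mul_le_of_le_one_left (hqpos t).le hκ1
    refine (((hCφ _).2.trans ?_).trans (hCE t)).trans h1
    rw [mul_assoc, ← Real.exp_add]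
    gcongr
    have : 0 ≤ 2 * σ / μ * c := by positivity
    have := hζ0 t
    rw [hμ] at *
    nlinarith

section weighted_mean

variable {N : ℕ} {ρ : Fin N → ℝ}

/-- Mean of a tuple with respect to the weights `ρ`. -/
noncomputable def weightedMean (ρ a : Fin N → ℝ) : ℝ := (∑ k, ρ k * a k) / ∑ k, ρ k

theorem sum_weights_pos (hρ : ∀ j, 0 < ρ j) (j : Fin N) : 0 < ∑ k, ρ k :=
  Finset.sum_pos (fun k _ => hρ k) ⟨j, Finset.mem_univ j⟩

theorem weightedMean_const (hρ : ∀ j, 0 < ρ j) (j : Fin N) (b : ℝ) :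
    weightedMean ρ (fun _ => b) = b := by
  rw [weightedMean, ← Finset.sum_mul, mul_div_cancel_left₀ _ (sum_weights_pos hρ j).ne']

theorem weightedMean_sub (a b : Fin N → ℝ) :
    weightedMean ρ (fun k => a k - b k) = weightedMean ρ a - weightedMean ρ b := by
  simp only [weightedMean, mul_sub, Finset.sum_sub_distrib, sub_div]

theorem weightedMean_mono (hρ : ∀ j, 0 < ρ j) {a b : Fin N → ℝ} (h : ∀ k, a k ≤ b k) :
    weightedMean ρ a ≤ weightedMean ρ b := by
  refine div_le_div_of_nonneg_right (Finset.sum_le_sum fun k _ => ?_)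
    (Finset.sum_nonneg fun k _ => (hρ k).le)
  exact mul_le_mul_of_nonneg_left (h k) (hρ k).le

theorem abs_weightedMean_le (hρ : ∀ j, 0 < ρ j) (j : Fin N) {a : Fin N → ℝ} {B : ℝ}
    (h : ∀ k, |a k| ≤ B) : |weightedMean ρ a| ≤ B := by
  rw [abs_le]
  constructor
  · rw [← weightedMean_const hρ j (-B)]
    exact weightedMean_mono hρ fun k => (abs_le.1 (h k)).1
  · rw [← weightedMean_const hρ j B]
    exact weightedMean_mono hρ fun k => (abs_le.1 (h k)).2

theorem eq_zero_of_weightedMean_eq_zero (hρ : ∀ j, 0 < ρ j) {a : Fin N → ℝ} (h : ∀ k, 0 ≤ a k)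
    (h0 : weightedMean ρ a = 0) (j : Fin N) : a j = 0 := by
  rw [weightedMean, div_eq_zero_iff, or_iff_left (sum_weights_pos hρ j).ne',
    Finset.sum_eq_zero_iff_of_nonneg fun k _ => mul_nonneg (hρ k).le (h k)] at h0
  exact (mul_eq_zero.1 (h0 j (Finset.mem_univ j))).resolve_left (hρ j).ne'

end weighted_mean

/-- A tuple of sources on the star graph: continuous, bounded, Lipschitz along edges and
continuous at the junction. -/
structure StarSource {N : ℕ} (S : Fin N → ℝ → ℝ → ℝ) (B L : ℝ) : Prop where
  cont : ∀ j, ContinuousOn (fun p : ℝ × ℝ => S j p.1 p.2) ((univ : Set ℝ) ×ˢ Ici 0)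
  bdd : ∀ j t x, 0 ≤ x → |S j t x| ≤ B
  lip : ∀ j t x y, 0 ≤ x → 0 ≤ y → |S j t x - S j t y| ≤ L * |x - y|
  junction : ∀ j k t, S j t 0 = S k t 0

/-- Extension to the line of the source on edge `j`, reflecting the transmission condition at the
junction: for `x > 0` it equals `S j`, for `x < 0` it is `2 * mean - S j` evaluated at `-x`. -/
noncomputable def starExt {N : ℕ} (ρ : Fin N → ℝ) (S : Fin N → ℝ → ℝ → ℝ) (j : Fin N)
    (t x : ℝ) : ℝ :=
  S j t (max x 0) + 2 * weightedMean ρ (fun k => S k t (max (-x) 0)) - S j t (max (-x) 0) - S j t 0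

section extension

variable {N : ℕ} {ρ : Fin N → ℝ} {S S' : Fin N → ℝ → ℝ → ℝ} {B L B' L' : ℝ}

theorem StarSource.lip_nonneg (h : StarSource S B L) (j : Fin N) : 0 ≤ L := by
  simpa using (abs_nonneg _).trans (h.lip j 0 1 0 zero_le_one le_rfl)

theorem StarSource.sub (h : StarSource S B L) (h' : StarSource S' B' L') :
    StarSource (fun j t x => S j t x - S' j t x) (B + B') (L + L') where
  cont j := (h.cont j).sub (h'.cont j)
  bdd j t x hx := (abs_sub _ _).trans (add_le_add (h.bdd j t x hx) (h'.bdd j t x hx))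
  lip j t x y hx hy := by
    rw [sub_sub_sub_comm, add_mul]
    exact (abs_sub _ _).trans (add_le_add (h.lip j t x y hx hy) (h'.lip j t x y hx hy))
  junction j k t := by rw [h.junction j k, h'.junction j k]

theorem StarSource.comp_lipschitz (h : StarSource S B L) {g : ℝ → ℝ} (hg : Continuous g)
    {m M : ℝ} {s : Set ℝ} (hs : ∀ j t x, 0 ≤ x → S j t x ∈ s)
    (hlip : ∀ p ∈ s, ∀ q ∈ s, |g p - g q| ≤ m * |p - q|) (hm : 0 ≤ m)
    (hbd : ∀ p ∈ s, |g p| ≤ M) :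
    StarSource (fun j t x => g (S j t x)) M (m * L) where
  cont j := hg.comp_continuousOn (h.cont j)
  bdd j t x hx := hbd _ (hs j t x hx)
  lip j t x y hx hy := by
    rw [mul_assoc]
    exact (hlip _ (hs j t x hx) _ (hs j t y hy)).trans
      (mul_le_mul_of_nonneg_left (h.lip j t x y hx hy) hm)
  junction j k t := by rw [h.junction j k]

theorem abs_max_zero_sub_le (x y : ℝ) : |max x 0 - max y 0| ≤ |x - y| :=
  abs_max_sub_max_le_abs x y 0

theorem StarSource.heatSource (hρ : ∀ j, 0 < ρ j) (h : StarSource S B L) (j : Fin N) :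
    HeatSource (starExt ρ S j) (5 * B) (4 * L) where
  cont := by
    have hc : ∀ k {q : ℝ → ℝ}, Continuous q →
        Continuous fun p : ℝ × ℝ => S k p.1 (max (q p.2) 0) := fun k q hq =>
      (h.cont k).comp_continuous (f := fun p : ℝ × ℝ => (p.1, max (q p.2) 0)) (by fun_prop)
        fun p => ⟨mem_univ _, mem_Ici.2 (le_max_right _ _)⟩
    have hc0 : Continuous fun p : ℝ × ℝ => S j p.1 0 :=
      (h.cont j).comp_continuous (f := fun p : ℝ × ℝ => (p.1, (0 : ℝ))) (by fun_prop)
        fun p => ⟨mem_univ _, self_mem_Ici⟩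
    refine (((hc j continuous_id).add (continuous_const.mul ?_)).sub (hc j continuous_neg)).sub hc0
    exact (continuous_finsetSum _ fun k _ =>
      continuous_const.mul (hc k continuous_neg)).div_const _
  bdd t x := by
    have h1 := abs_le.1 (h.bdd j t (max x 0) (le_max_right _ _))
    have h2 := abs_le.1 (h.bdd j t (max (-x) 0) (le_max_right _ _))
    have h3 := abs_le.1 (h.bdd j t 0 le_rfl)
    have h4 := abs_le.1 (abs_weightedMean_le hρ j fun k =>
      h.bdd k t (max (-x) 0) (le_max_right _ _))
    rw [starExt, abs_le]
    constructor <;> linarith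
  lip t x y := by
    have hL := h.lip_nonneg j
    have e1 : L * |max x 0 - max y 0| ≤ L * |x - y| :=
      mul_le_mul_of_nonneg_left (abs_max_zero_sub_le x y) hL
    have e2 : L * |max (-x) 0 - max (-y) 0| ≤ L * |x - y| := by
      refine mul_le_mul_of_nonneg_left ((abs_max_zero_sub_le _ _).trans (le_of_eq ?_)) hL
      rw [neg_sub_neg, abs_sub_comm]
    have h1 := abs_le.1 ((h.lip j t (max x 0) (max y 0) (le_max_right _ _)
      (le_max_right _ _)).trans e1)
    have h2 := abs_le.1 ((h.lip j t (max (-x) 0) (max (-y) 0) (le_max_right _ _)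
      (le_max_right _ _)).trans e2)
    have h3 := abs_le.1 (abs_weightedMean_le hρ j fun k =>
      (h.lip k t (max (-x) 0) (max (-y) 0) (le_max_right _ _) (le_max_right _ _)).trans e2)
    rw [weightedMean_sub] at h3
    rw [starExt, starExt, abs_le]
    constructor <;> linarith

theorem StarSource.starExt_of_nonneg (hρ : ∀ j, 0 < ρ j) (h : StarSource S B L) (j : Fin N)
    (t : ℝ) {x : ℝ} (hx : 0 ≤ x) : starExt ρ S j t x = S j t x := by
  have h1 : weightedMean ρ (fun k => S k t 0) = S j t 0 := by
    rw [← weightedMean_const hρ j (S j t 0)]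
    congr 1
    funext k
    exact h.junction k j t
  rw [starExt, max_eq_left hx, max_eq_right (neg_nonpos.2 hx), h1]
  ring

theorem StarSource.starExt_neg (j : Fin N)
    (t : ℝ) {x : ℝ} (hx : 0 ≤ x) :
    starExt ρ S j t (-x) = 2 * weightedMean ρ (fun k => S k t x) - S j t x := by
  rw [starExt, neg_neg, max_eq_left hx, max_eq_right (neg_nonpos.2 hx)]
  ring

theorem StarSource.sum_starExt_neg (hρ : ∀ j, 0 < ρ j) (h : StarSource S B L) (t x : ℝ) :
    ∑ j, ρ j * starExt ρ S j t (-x) = ∑ j, ρ j * starExt ρ S j t x := by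
  have key : ∀ y, 0 ≤ y → ∑ j, ρ j * starExt ρ S j t (-y) = ∑ j, ρ j * starExt ρ S j t y := by
    intro y hy
    rcases isEmpty_or_nonempty (Fin N) with _ | ⟨⟨j⟩⟩
    · simp
    simp only [h.starExt_of_nonneg hρ _ t hy, StarSource.starExt_neg _ t hy, mul_sub,
      Finset.sum_sub_distrib, ← Finset.sum_mul]
    rw [weightedMean]
    have := (sum_weights_pos hρ j).ne'
    field_simp
    ring
  rcases le_total 0 x with hx | hx
  · exact key x hx
  · simpa using (key (-x) (neg_nonneg.2 hx)).symm

theorem StarSource.starExt_sub_neg (hρ : ∀ j, 0 < ρ j) (h : StarSource S B L) (j k : Fin N)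
    (t x : ℝ) : starExt ρ S j t (-x) - starExt ρ S k t (-x) =
      -(starExt ρ S j t x - starExt ρ S k t x) := by
  have key : ∀ y, 0 ≤ y → starExt ρ S j t (-y) - starExt ρ S k t (-y) =
      -(starExt ρ S j t y - starExt ρ S k t y) := by
    intro y hy
    simp only [h.starExt_of_nonneg hρ _ t hy, StarSource.starExt_neg _ t hy]
    ring
  rcases le_total 0 x with hx | hx
  · exact key x hx
  · have := key (-x) (neg_nonneg.2 hx)
    rw [neg_neg] at this
    linarith

theorem starExt_sub (j : Fin N) (t x : ℝ) :
    starExt ρ (fun j t x => S j t x - S' j t x) j t x =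
      starExt ρ S j t x - starExt ρ S' j t x := by
  simp only [starExt, weightedMean_sub]
  ring

theorem starExt_congr (h : ∀ j t x, 0 ≤ x → S j t x = S' j t x) : starExt ρ S = starExt ρ S' := by
  funext j t x
  simp only [starExt, h _ _ _ (le_max_right _ _), h j t 0 le_rfl]

end extension

/-- Solution of `U_t = U_xx - K U + S` on the star graph. -/
noncomputable def starPot {N : ℕ} (K : ℝ) (ρ : Fin N → ℝ) (S : Fin N → ℝ → ℝ → ℝ) (j : Fin N) :
    ℝ → ℝ → ℝ := heatPot K (starExt ρ S j)

section potential

variable {N : ℕ} {ρ : Fin N → ℝ} {S S' : Fin N → ℝ → ℝ → ℝ} {B L B' L' K : ℝ}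

theorem integral_eq_zero_of_odd {k : ℝ → ℝ} (h : ∀ z, k (-z) = -k z) : ∫ z, k z = 0 := by
  have h1 := integral_neg_eq_self k volume
  simp only [h, integral_neg] at h1
  linarith

theorem gaussKer_neg (z : ℝ) : gaussKer (-z) = gaussKer z := by simp [gaussKer]

theorem gaussKer'_neg (z : ℝ) : gaussKer' (-z) = -gaussKer' z := by
  simp only [gaussKer', gaussKer_neg]; ring

theorem StarSource.starPot_junction (hρ : ∀ j, 0 < ρ j) (hK : 0 < K) (h : StarSource S B L)
    (j k : Fin N) (t : ℝ) : starPot K ρ S j t 0 = starPot K ρ S k t 0 := by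
  have hj := h.heatSource hρ j
  have hk := h.heatSource hρ k
  rw [starPot, starPot, hj.heatPot_eq hK, hk.heatPot_eq hK]
  congr 1
  funext r
  congr 1
  rw [← sub_eq_zero, ← integral_sub (hj.integrable_mul integrable_gaussKer _ _ _)
    (hk.integrable_mul integrable_gaussKer _ _ _)]
  refine integral_eq_zero_of_odd fun z => ?_
  have := h.starExt_sub_neg hρ j k (t - r ^ 2) (0 - r * z)
  rw [gaussKer_neg, show 0 - r * -z = -(0 - r * z) by ring]
  linear_combination gaussKer z * this

theorem StarSource.sum_deriv_starPot (hρ : ∀ j, 0 < ρ j) (hK : 0 < K) (h : StarSource S B L)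
    (t : ℝ) : ∑ j, ρ j * deriv (starPot K ρ S j t) 0 = 0 := by
  have e : ∀ j, ρ j * deriv (starPot K ρ S j t) 0 = ∫ r in Ioi 0, ρ j *
      (2 * Real.exp (-K * r ^ 2) * ∫ z, gaussKer' z * starExt ρ S j (t - r ^ 2) (0 - r * z)) :=
    fun j => by
      have hj := h.heatSource hρ j
      rw [starPot, (hj.hasDerivAt_heatPot hK t 0).deriv, hj.heatPotX_eq hK, integral_const_mul]
  simp only [e]
  rw [← integral_finsetSum _ fun j _ =>
    ((h.heatSource hρ j).integrable_iterated₁ hK t 0).const_mul (ρ j)]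
  refine integral_eq_zero_of_ae (Eventually.of_forall fun r => ?_)
  have key : ∑ j, ρ j * ∫ z, gaussKer' z * starExt ρ S j (t - r ^ 2) (0 - r * z) = 0 := by
    simp only [← integral_const_mul]
    rw [← integral_finsetSum _ fun j _ => by
      exact ((h.heatSource hρ j).integrable_mul integrable_gaussKer' _ _ _).const_mul (ρ j)]
    refine integral_eq_zero_of_odd fun z => ?_
    have := h.sum_starExt_neg hρ (t - r ^ 2) (0 - r * z)
    simp only [gaussKer'_neg, show 0 - r * -z = -(0 - r * z) by ring, mul_left_comm (ρ _),
      ← Finset.mul_sum, this]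
    ring
  simp only [mul_left_comm (ρ _) (2 * Real.exp _), ← Finset.mul_sum, Pi.zero_apply, key, mul_zero]

theorem StarSource.starRegular_starPot (hρ : ∀ j, 0 < ρ j) (hK : 0 < K) (h : StarSource S B L)
    (j : Fin N) : StarRegular (starPot K ρ S j) where
  cont := ((h.heatSource hρ j).continuous_heatPot hK).continuousOn
  diff_t t x _ := ((h.heatSource hρ j).hasDerivAt_heatPot_time hK t x).differentiableAt
  diff_x t x _ := ((h.heatSource hρ j).hasDerivAt_heatPot hK t x).differentiableAt
  diff_xx t x _ := by
    rw [starPot, (h.heatSource hρ j).deriv_heatPot hK]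
    exact ((h.heatSource hρ j).hasDerivAt_heatPotX hK t x).differentiableAt

theorem StarSource.heatOp_starPot (hρ : ∀ j, 0 < ρ j) (hK : 0 < K) (h : StarSource S B L)
    (j : Fin N) (t : ℝ) {x : ℝ} (hx : 0 ≤ x) :
    heatOp (starPot K ρ S j) t x = S j t x - K * starPot K ρ S j t x := by
  have hj := h.heatSource hρ j
  rw [heatOp, starPot, (hj.hasDerivAt_heatPot_time hK t x).deriv, hj.deriv_deriv_heatPot hK,
    h.starExt_of_nonneg hρ j t hx]
  ring

theorem StarSource.starPot_sub (hρ : ∀ j, 0 < ρ j) (hK : 0 < K) (h : StarSource S B L)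
    (h' : StarSource S' B' L') (j : Fin N) (t x : ℝ) :
    starPot K ρ (fun j t x => S j t x - S' j t x) j t x =
      starPot K ρ S j t x - starPot K ρ S' j t x := by
  simp only [starPot, heatPot]
  rw [← integral_sub ((h.heatSource hρ j).integrable₀ hK t x)
    ((h'.heatSource hρ j).integrable₀ hK t x)]
  simp only [starExt_sub, mul_sub]

theorem starPot_const (hρ : ∀ j, 0 < ρ j) (hK : 0 < K) (b : ℝ) (j : Fin N) (t x : ℝ) :
    starPot K ρ (fun _ _ _ => b) j t x = b / K := by
  have : starExt ρ (fun _ _ _ => b) j = fun _ _ => b := by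
    funext t x
    simp only [starExt, weightedMean_const hρ j]
    ring
  rw [starPot, this, heatPot_const hK]

/-- The Gaussian average of an extended nonnegative source is nonnegative, and vanishes only if
the source does. -/
theorem StarSource.integral_gaussKer_starExt (hρ : ∀ j, 0 < ρ j) (h : StarSource S B L)
    (hS : ∀ j t x, 0 ≤ x → 0 ≤ S j t x) (j : Fin N) (t : ℝ) {x r : ℝ} (hx : 0 ≤ x) (hr : 0 < r) :
    0 ≤ ∫ z, gaussKer z * starExt ρ S j t (x - r * z) ∧
    ((∫ z, gaussKer z * starExt ρ S j t (x - r * z)) = 0 → ∀ k y, 0 ≤ y → S k t y = 0) := by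
  have hj := h.heatSource hρ j
  set Φ : ℝ → ℝ := fun z => gaussKer z * starExt ρ S j t (x - r * z) with hΦ
  have hΦi : Integrable Φ := hj.integrable_mul integrable_gaussKer t x r
  have hΦc : Continuous Φ :=
    continuous_gaussKer.mul (hj.continuous_comp continuous_const (by fun_prop))
  set b : ℝ := x / r with hb
  have hb0 : 0 ≤ b := by positivity
  have hrb : r * b = x := by rw [hb]; field_simp
  set Ψ : ℝ → ℝ := fun z => Φ z + Φ (2 * b - z) with hΨ
  have hint : ∫ z, Ψ z = 2 * ∫ z, Φ z := by
    rw [hΨ, integral_add hΦi (hΦi.comp_sub_left _), integral_sub_left_eq_self]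
    ring
  have hmean : ∀ y, 0 ≤ y → 0 ≤ weightedMean ρ (fun k => S k t y) := fun y hy => by
    rw [← weightedMean_const hρ j 0]
    exact weightedMean_mono hρ fun k => hS k t y hy
  have hle : ∀ z, z ≤ b →
      2 * gaussKer (2 * b - z) * weightedMean ρ (fun k => S k t (x - r * z)) ≤ Ψ z := by
    intro z hz
    have hy : 0 ≤ x - r * z := by nlinarith
    have hker : gaussKer (2 * b - z) ≤ gaussKer z := by
      unfold gaussKer
      gcongr ?_ / _
      refine Real.exp_le_exp.2 ?_
      nlinarith
    simp only [hΨ, hΦ]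
    rw [show x - r * (2 * b - z) = -(x - r * z) by rw [← hrb]; ring,
      h.starExt_of_nonneg hρ j t hy, StarSource.starExt_neg j t hy]
    have := mul_le_mul_of_nonneg_right hker (hS j t _ hy)
    linarith
  have hnn : ∀ z, z ≤ b → 0 ≤ Ψ z := fun z hz => by
    refine le_trans ?_ (hle z hz)
    have := gaussKer_pos (2 * b - z)
    have := hmean (x - r * z) (by nlinarith)
    positivity
  have hΨ0 : ∀ z, 0 ≤ Ψ z := fun z => by
    rcases le_total z b with hz | hz
    · exact hnn z hz
    · have := hnn (2 * b - z) (by linarith)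
      simp only [hΨ, sub_sub_cancel] at this ⊢
      linarith
  refine ⟨by linarith [integral_nonneg (μ := volume) (f := Ψ) fun z => hΨ0 z], fun h0 k y hy => ?_⟩
  have hΨz : Ψ = 0 := by
    refine (Continuous.ae_eq_iff_eq volume (hΦc.add (hΦc.comp (by fun_prop))) continuous_zero).1 ?_
    refine (integral_eq_zero_iff_of_nonneg hΨ0 (hΦi.add (hΦi.comp_sub_left _))).1 ?_
    rw [hint, h0, mul_zero]
  have hz : (x - y) / r ≤ b := div_le_div_of_nonneg_right (by linarith) hr.le
  have hxy : x - r * ((x - y) / r) = y := by field_simp; ring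
  have h1 := hle _ hz
  rw [hΨz, Pi.zero_apply, hxy] at h1
  have h2 : weightedMean ρ (fun k => S k t y) ≤ 0 := by
    by_contra! hpos
    have := gaussKer_pos (2 * b - (x - y) / r)
    have := mul_pos (mul_pos two_pos this) hpos
    linarith
  exact eq_zero_of_weightedMean_eq_zero hρ (fun k => hS k t y hy) (h2.antisymm (hmean y hy)) k

theorem StarSource.starPot_nonneg (hρ : ∀ j, 0 < ρ j) (hK : 0 < K) (h : StarSource S B L)
    (hS : ∀ j t x, 0 ≤ x → 0 ≤ S j t x) (j : Fin N) (t : ℝ) {x : ℝ} (hx : 0 ≤ x) :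
    0 ≤ starPot K ρ S j t x := by
  rw [starPot, (h.heatSource hρ j).heatPot_eq hK]
  refine setIntegral_nonneg measurableSet_Ioi fun r hr => ?_
  have := (h.integral_gaussKer_starExt hρ hS j (t - r ^ 2) hx hr).1
  have : (0 : ℝ) < r := hr
  positivity

theorem StarSource.eq_zero_of_starPot_eq_zero (hρ : ∀ j, 0 < ρ j) (hK : 0 < K)
    (h : StarSource S B L) (hS : ∀ j t x, 0 ≤ x → 0 ≤ S j t x) {j : Fin N} {t x : ℝ} (hx : 0 ≤ x)
    (h0 : starPot K ρ S j t x = 0) (k : Fin N) {s y : ℝ} (hs : s < t) (hy : 0 ≤ y) :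
    S k s y = 0 := by
  have hj := h.heatSource hρ j
  rw [starPot, hj.heatPot_eq hK] at h0
  have hpos : ∀ r ∈ Ioi (0 : ℝ), 0 ≤ 2 * r * Real.exp (-K * r ^ 2) *
      ∫ z, gaussKer z * starExt ρ S j (t - r ^ 2) (x - r * z) := fun r hr => by
    have := (h.integral_gaussKer_starExt hρ hS j (t - r ^ 2) hx hr).1
    have : (0 : ℝ) < r := hr
    positivity
  rw [setIntegral_eq_zero_iff_of_nonneg_ae
    ((ae_restrict_mem measurableSet_Ioi).mono hpos) (hj.integrable_iterated₀ hK t x)] at h0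
  have hc := hj.continuous_integral_radius t x
  have hEq := Measure.eqOn_open_of_ae_eq h0 isOpen_Ioi
    (Continuous.continuousOn (by fun_prop)) continuousOn_const
  have hr : 0 < √(t - s) := Real.sqrt_pos.2 (by linarith)
  have h1 := hEq hr
  simp only [Pi.zero_apply] at h1
  have h2 : (0 : ℝ) < 2 * √(t - s) * Real.exp (-K * √(t - s) ^ 2) := by positivity
  have h3 := (h.integral_gaussKer_starExt hρ hS j _ hx hr).2
    ((mul_eq_zero.1 h1).resolve_left h2.ne') k y hy
  rwa [Real.sq_sqrt (by linarith), sub_sub_cancel] at h3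

end potential

/-- A nonlinearity `v ↦ f v + K v` which is increasing on `[0,1]`, with stable states `0` and `1`. -/
structure MonoReaction (g : ℝ → ℝ) (K : ℝ) : Prop where
  pos : 0 < K
  cont : Continuous g
  zero : g 0 = 0
  one : g 1 = K
  strictMono : StrictMonoOn g (Icc 0 1)
  lip : ∀ p ∈ Icc (0 : ℝ) 1, ∀ q ∈ Icc (0 : ℝ) 1, |g p - g q| ≤ 2 * K * |p - q|

theorem Bistable.exists_monoReaction {f : ℝ → ℝ} {a : ℝ} (hf : Bistable f a) :
    ∃ K, MonoReaction (fun v => f v + K * v) K := by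
  obtain ⟨Λ, hΛ, hbd⟩ := hf.exists_abs_deriv_le
  have hfd : Differentiable ℝ f := hf.1.differentiable one_ne_zero
  have hlo : ∀ p q, 0 ≤ p → p ≤ q → q ≤ 1 → -Λ * (q - p) ≤ f q - f p := fun p q h0 h h1 =>
    mul_sub_le_sub_of_le_deriv hfd h fun ξ _ _ =>
      (abs_le.1 (hbd ξ (by linarith) (by linarith))).1
  have hup : ∀ p q, 0 ≤ p → p ≤ q → q ≤ 1 → f q - f p ≤ Λ * (q - p) := fun p q h0 h h1 =>
    sub_le_mul_sub_of_deriv_le hfd h fun ξ _ _ =>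
      (abs_le.1 (hbd ξ (by linarith) (by linarith))).2
  refine ⟨Λ + 1, by linarith, hfd.continuous.add (by fun_prop), by simp [hf.2.2.2.1],
    by simp [hf.2.2.2.2.2.1], fun p hp q hq hpq => ?_, ?_⟩
  · have := hlo p q hp.1 hpq.le hq.2
    linarith
  · have key : ∀ p q, 0 ≤ p → p ≤ q → q ≤ 1 →
        |(f q + (Λ + 1) * q) - (f p + (Λ + 1) * p)| ≤ 2 * (Λ + 1) * |q - p| := by
      intro p q h0 h h1
      rw [abs_of_nonneg (sub_nonneg.2 h), abs_le]
      constructor <;> linarith [hlo p q h0 h h1, hup p q h0 h h1]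
    intro p hp q hq
    rcases le_total p q with h | h
    · rw [abs_sub_comm, abs_sub_comm p]
      exact key p q hp.1 h hq.2
    · exact key q p hq.1 h hp.2

section iteration

variable {N : ℕ} {ρ : Fin N → ℝ} {g : ℝ → ℝ} {K L L' : ℝ} {V V' : Fin N → ℝ → ℝ → ℝ}

theorem MonoReaction.mem_Icc (hg : MonoReaction g K) {v : ℝ} (hv : v ∈ Icc (0 : ℝ) 1) :
    g v ∈ Icc 0 K := by
  constructor
  · rw [← hg.zero]
    exact hg.strictMono.monotoneOn ⟨le_rfl, zero_le_one⟩ hv hv.1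
  · rw [← hg.one]
    exact hg.strictMono.monotoneOn hv ⟨zero_le_one, le_rfl⟩ hv.2

/-- A Lipschitz profile on the star graph with values in `[0,1]`. -/
structure StarProfile (V : Fin N → ℝ → ℝ → ℝ) (L : ℝ) : Prop where
  source : StarSource V 1 L
  mem : ∀ j t x, 0 ≤ x → V j t x ∈ Icc (0 : ℝ) 1

/-- One step of the monotone iteration for `U_t = U_xx - K U + g(U)`. -/
noncomputable def starStep (K : ℝ) (ρ : Fin N → ℝ) (g : ℝ → ℝ) (V : Fin N → ℝ → ℝ → ℝ) :
    Fin N → ℝ → ℝ → ℝ :=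
  starPot K ρ fun j t x => g (V j t x)

/-- Bound for the spatial Lipschitz constant of `starStep`. -/
noncomputable def stepLip (K : ℝ) : ℝ :=
  (∫ p : ℝ × ℝ, |2 * Real.exp (-K * p.1 ^ 2)| * |gaussKer' p.2| ∂heatMeasure) * (5 * K)

/-- Bound for the temporal Lipschitz constant of `starStep`. -/
noncomputable def stepTimeLip (K L : ℝ) : ℝ :=
  (∫ p : ℝ × ℝ, |2 * Real.exp (-K * p.1 ^ 2)| * |gaussKer'' p.2 * p.2| ∂heatMeasure) *
    (4 * (2 * K * L)) + 2 * K

theorem StarProfile.comp (hV : StarProfile V L) (hg : MonoReaction g K) :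
    StarSource (fun j t x => g (V j t x)) K (2 * K * L) :=
  hV.source.comp_lipschitz hg.cont hV.mem hg.lip (by linarith [hg.pos]) fun p hp => by
    rw [abs_of_nonneg (hg.mem_Icc hp).1]
    exact (hg.mem_Icc hp).2

theorem starSource_const (b : ℝ) : StarSource (N := N) (fun _ _ _ => b) |b| 0 where
  cont _ := continuousOn_const
  bdd _ _ _ _ := le_rfl
  lip _ _ _ _ _ _ := by simp
  junction _ _ _ := rfl

theorem StarSource.starPot_mono {S S' : Fin N → ℝ → ℝ → ℝ} {B B' L L' : ℝ} (hρ : ∀ j, 0 < ρ j)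
    (hK : 0 < K) (h : StarSource S B L)
    (h' : StarSource S' B' L') (hle : ∀ j t x, 0 ≤ x → S j t x ≤ S' j t x) (j : Fin N) (t : ℝ)
    {x : ℝ} (hx : 0 ≤ x) : starPot K ρ S j t x ≤ starPot K ρ S' j t x := by
  rw [← sub_nonneg, ← h'.starPot_sub hρ hK h]
  exact (h'.sub h).starPot_nonneg hρ hK (fun j t x hx => sub_nonneg.2 (hle j t x hx)) j t hx

theorem StarProfile.starStep_mono (hρ : ∀ j, 0 < ρ j) (hg : MonoReaction g K)
    (hV : StarProfile V L) (hV' : StarProfile V' L')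
    (hle : ∀ j t x, 0 ≤ x → V j t x ≤ V' j t x) (j : Fin N) (t : ℝ) {x : ℝ} (hx : 0 ≤ x) :
    starStep K ρ g V j t x ≤ starStep K ρ g V' j t x :=
  (hV.comp hg).starPot_mono hρ hg.pos (hV'.comp hg) (fun j t x hx =>
    hg.strictMono.monotoneOn (hV.mem j t x hx) (hV'.mem j t x hx) (hle j t x hx)) j t hx

theorem StarProfile.starStep_mem (hρ : ∀ j, 0 < ρ j) (hg : MonoReaction g K)
    (hV : StarProfile V L) (j : Fin N) (t x : ℝ) (hx : 0 ≤ x) :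
    starStep K ρ g V j t x ∈ Icc (0 : ℝ) 1 := by
  refine ⟨(hV.comp hg).starPot_nonneg hρ hg.pos
    (fun j t x hx => (hg.mem_Icc (hV.mem j t x hx)).1) j t hx, ?_⟩
  rw [← div_self hg.pos.ne', ← starPot_const hρ hg.pos K j t x]
  exact (hV.comp hg).starPot_mono hρ hg.pos (starSource_const K)
    (fun j t x hx => (hg.mem_Icc (hV.mem j t x hx)).2) j t hx

theorem StarProfile.step (hρ : ∀ j, 0 < ρ j) (hg : MonoReaction g K)
    (hV : StarProfile V L) (hL : stepLip K ≤ L') : StarProfile (starStep K ρ g V) L' where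
  mem := hV.starStep_mem hρ hg
  source := by
    refine ⟨fun j => ((hV.comp hg).starRegular_starPot hρ hg.pos j).cont, fun j t x hx => ?_,
      fun j t x y _ _ => ?_, fun j k t => (hV.comp hg).starPot_junction hρ hg.pos j k t⟩
    · have := hV.starStep_mem hρ hg j t x hx
      rw [abs_of_nonneg this.1]
      exact this.2
    · have hj := (hV.comp hg).heatSource hρ j
      refine le_trans ?_ (mul_le_mul_of_nonneg_right hL (abs_nonneg _))
      exact convex_univ.norm_image_sub_le_of_norm_hasDerivWithin_le
        (fun y _ => (hj.hasDerivAt_heatPot hg.pos t y).hasDerivWithinAt)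
        (fun y _ => hj.abs_heatPotX_le hg.pos t y) (mem_univ y) (mem_univ x)

theorem StarProfile.abs_starStep_sub_le (hρ : ∀ j, 0 < ρ j) (hg : MonoReaction g K)
    (hV : StarProfile V L) (j : Fin N) (t s : ℝ) {x : ℝ} (hx : 0 ≤ x) :
    |starStep K ρ g V j t x - starStep K ρ g V j s x| ≤
      stepTimeLip K L * |t - s| := by
  have hS := hV.comp hg
  have hj := hS.heatSource hρ j
  refine convex_univ.norm_image_sub_le_of_norm_hasDerivWithin_le
    (f := fun t => starStep K ρ g V j t x)
    (fun τ _ => (hj.hasDerivAt_heatPot_time hg.pos τ x).hasDerivWithinAt)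
    (fun τ _ => ?_) (mem_univ s) (mem_univ t)
  have h1 := abs_le.1 (hj.abs_heatPotXX_le hg.pos τ x)
  have h2 := hV.starStep_mem hρ hg j τ x hx
  have h3 := hg.mem_Icc (hV.mem j τ x hx)
  rw [hS.starExt_of_nonneg hρ j τ hx, Real.norm_eq_abs, abs_le, stepTimeLip]
  change _ ∧ _ - K * starStep K ρ g V j τ x + _ ≤ _
  have h4 := mul_le_mul_of_nonneg_left h2.2 hg.pos.le
  have h5 := mul_nonneg hg.pos.le h2.1
  constructor
  · change _ ≤ _ - K * starStep K ρ g V j τ x + _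
    linarith [h3.1, hg.pos, h1.1]
  · linarith [h3.2, hg.pos, h1.2]

/-- A pointwise limit of profiles with common Lipschitz constants is a profile. -/
theorem StarProfile.of_tendsto {V : ℕ → Fin N → ℝ → ℝ → ℝ} {U : Fin N → ℝ → ℝ → ℝ} {C : ℝ}
    (hV : ∀ n, StarProfile (V n) L)
    (hC : ∀ n j t s x, 0 ≤ x → |V n j t x - V n j s x| ≤ C * |t - s|)
    (hU : ∀ j t x, 0 ≤ x → Tendsto (fun n => V n j t x) atTop (𝓝 (U j t x))) :
    StarProfile U L := by
  have hmem : ∀ j t x, 0 ≤ x → U j t x ∈ Icc (0 : ℝ) 1 := fun j t x hx =>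
    isClosed_Icc.mem_of_tendsto (hU j t x hx) (Eventually.of_forall fun n => (hV n).mem j t x hx)
  have hlip : ∀ j t x y, 0 ≤ x → 0 ≤ y → |U j t x - U j t y| ≤ L * |x - y| :=
    fun j t x y hx hy => le_of_tendsto ((hU j t x hx).sub (hU j t y hy)).abs
      (Eventually.of_forall fun n => (hV n).source.lip j t x y hx hy)
  have hlipt : ∀ j t s x, 0 ≤ x → |U j t x - U j s x| ≤ C * |t - s| :=
    fun j t s x hx => le_of_tendsto ((hU j t x hx).sub (hU j s x hx)).abs
      (Eventually.of_forall fun n => hC n j t s x hx)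
  refine ⟨⟨fun j p hp => ?_, fun j t x hx => ?_, hlip, fun j k t => ?_⟩, hmem⟩
  · rw [ContinuousWithinAt, tendsto_iff_norm_sub_tendsto_zero]
    have hlim : Tendsto (fun p' : ℝ × ℝ => C * |p'.1 - p.1| + L * |p'.2 - p.2|)
        (𝓝[univ ×ˢ Ici 0] p) (𝓝 0) := by
      have : Continuous fun p' : ℝ × ℝ => C * |p'.1 - p.1| + L * |p'.2 - p.2| := by fun_prop
      simpa using (this.tendsto p).mono_left nhdsWithin_le_nhds
    refine squeeze_zero' (Eventually.of_forall fun _ => norm_nonneg _) ?_ hlim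
    filter_upwards [self_mem_nhdsWithin] with p' hp'
    rw [Real.norm_eq_abs, show U j p'.1 p'.2 - U j p.1 p.2 =
      (U j p'.1 p'.2 - U j p.1 p'.2) + (U j p.1 p'.2 - U j p.1 p.2) by ring]
    exact (abs_add_le _ _).trans
      (add_le_add (hlipt j _ _ _ hp'.2) (hlip j _ _ _ hp'.2 hp.2))
  · rw [abs_of_nonneg (hmem j t x hx).1]
    exact (hmem j t x hx).2
  · refine tendsto_nhds_unique (hU j t 0 le_rfl) ?_
    simpa only [(hV _).source.junction j k t] using hU k t 0 le_rfl

theorem tendsto_starPot {S : ℕ → Fin N → ℝ → ℝ → ℝ} {R : Fin N → ℝ → ℝ → ℝ} {B : ℝ}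
    (hρ : ∀ j, 0 < ρ j) (hK : 0 < K) (h : ∀ n, StarSource (S n) B L)
    (hlim : ∀ j t x, 0 ≤ x → Tendsto (fun n => S n j t x) atTop (𝓝 (R j t x)))
    (j : Fin N) (t x : ℝ) :
    Tendsto (fun n => starPot K ρ (S n) j t x) atTop (𝓝 (starPot K ρ R j t x)) := by
  refine tendsto_integral_of_dominated_convergence _
    (fun n => (((h n).heatSource hρ j).integrable₀ hK t x).aestronglyMeasurable)
    (integrable_heatBound₀ hK (5 * B))
    (fun n => Eventually.of_forall fun p => ((h n).heatSource hρ j).norm_le₀ p t x)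
    (Eventually.of_forall fun p => Tendsto.const_mul _ ?_)
  have hx : ∀ k τ y, Tendsto (fun n => S n k τ (max y 0)) atTop (𝓝 (R k τ (max y 0))) :=
    fun k τ y => hlim k τ _ (le_max_right _ _)
  have hmean : ∀ τ y, Tendsto (fun n => weightedMean ρ fun k => S n k τ (max y 0)) atTop
      (𝓝 (weightedMean ρ fun k => R k τ (max y 0))) := fun τ y =>
    (tendsto_finsetSum _ fun k _ => (hx k τ y).const_mul _).div_const _
  exact (((hx j _ _).add ((hmean _ _).const_mul 2)).sub (hx j _ _)).sub (hlim j _ 0 le_rfl)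

/-- Monotone iteration between an ordered pair of barriers. -/
theorem exists_starStep_eq (hρ : ∀ j, 0 < ρ j) (hg : MonoReaction g K) {V₀ W : Fin N → ℝ → ℝ → ℝ}
    (hV₀ : StarProfile V₀ L) (hL : stepLip K ≤ L)
    (hsub : ∀ j t x, 0 ≤ x → V₀ j t x ≤ starStep K ρ g V₀ j t x)
    (hW : ∀ j t x, 0 ≤ x → V₀ j t x ≤ W j t x)
    (hsuper : ∀ V, StarProfile V L → (∀ j t x, 0 ≤ x → V j t x ≤ W j t x) →
      ∀ j t x, 0 ≤ x → starStep K ρ g V j t x ≤ W j t x) :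
    ∃ U, StarProfile U L ∧ (∀ j t x, 0 ≤ x → starStep K ρ g U j t x = U j t x) ∧
      (∀ j t x, 0 ≤ x → V₀ j t x ≤ U j t x) ∧ ∀ j t x, 0 ≤ x → U j t x ≤ W j t x := by
  set V : ℕ → Fin N → ℝ → ℝ → ℝ := fun n => (starStep K ρ g)^[n] V₀ with hVdef
  have hsucc : ∀ n, V (n + 1) = starStep K ρ g (V n) := fun n =>
    Function.iterate_succ_apply' _ _ _
  have hV : ∀ n, StarProfile (V n) L := by
    intro n
    induction n with
    | zero => exact hV₀
    | succ n ih => rw [hsucc]; exact ih.step hρ hg hL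
  have hVW : ∀ n j t x, 0 ≤ x → V n j t x ≤ W j t x := by
    intro n
    induction n with
    | zero => exact hW
    | succ n ih => rw [hsucc]; exact hsuper _ (hV n) ih
  have hstep : ∀ n j t x, 0 ≤ x → V n j t x ≤ V (n + 1) j t x := by
    intro n
    induction n with
    | zero => exact hsub
    | succ n ih =>
      intro j t x hx
      rw [hsucc (n + 1), hsucc n]
      rw [hsucc n] at ih
      exact (hV n).starStep_mono hρ hg (hsucc n ▸ hV (n + 1)) ih j t hx
  have hmono : ∀ j t x, 0 ≤ x → Monotone fun n => V n j t x := fun j t x hx =>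
    monotone_nat_of_le_succ fun n => hstep n j t x hx
  have hU : ∀ j t x, 0 ≤ x → Tendsto (fun n => V n j t x) atTop (𝓝 (⨆ n, V n j t x)) :=
    fun j t x hx => tendsto_atTop_ciSup (hmono j t x hx)
      ⟨1, by rintro _ ⟨n, rfl⟩; exact ((hV n).mem j t x hx).2⟩
  have hUp : StarProfile (fun j t x => ⨆ n, V n j t x) L :=
    StarProfile.of_tendsto (V := fun n => V (n + 1)) (C := stepTimeLip K L)
      (fun n => hV (n + 1)) (fun n j t s x hx => by
        rw [hsucc]; exact (hV n).abs_starStep_sub_le hρ hg j t s hx)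
      fun j t x hx => (hU j t x hx).comp (tendsto_add_atTop_nat 1)
  refine ⟨_, hUp, fun j t x hx => ?_, fun j t x hx => (hmono j t x hx).ge_of_tendsto
    (hU j t x hx) 0, fun j t x hx => le_of_tendsto' (hU j t x hx) fun n => hVW n j t x hx⟩
  refine tendsto_nhds_unique ?_ ((hU j t x hx).comp (tendsto_add_atTop_nat 1))
  simp only [Function.comp_def, hsucc]
  exact tendsto_starPot hρ hg.pos (fun n => (hV n).comp hg)
    (fun j t x hx => (hg.cont.tendsto _).comp (hU j t x hx)) j t x

end iteration

section barriers

/-- A wave with phase correction `ξ` and amplitude correction `p * (1 + k * exp (-x))`. -/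
noncomputable def perturbedWave (φ : ℝ → ℝ) (c e k : ℝ) (p ξ : ℝ → ℝ) (t x : ℝ) : ℝ :=
  φ (e * x - c * t + ξ t) + p t * (1 + k * Real.exp (-x))

variable {f φ : ℝ → ℝ} {a c e k : ℝ} {p p' ξ ξ' : ℝ → ℝ}

theorem hasDerivAt_perturbedWave (hφ : TravelingWave f a c φ) (e k : ℝ) (p ξ : ℝ → ℝ) (t x : ℝ) :
    HasDerivAt (perturbedWave φ c e k p ξ t)
      (e * deriv φ (e * x - c * t + ξ t) - p t * (k * Real.exp (-x))) x := by
  have h1 : HasDerivAt (fun x => e * x - c * t + ξ t) e x := by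
    simpa using (((hasDerivAt_id' x).const_mul e).sub_const (c * t)).add_const (ξ t)
  have h2 : HasDerivAt (fun x : ℝ => Real.exp (-x)) (-Real.exp (-x)) x := by
    simpa using (hasDerivAt_id' x).neg.exp
  exact (((hφ.hasDerivAt _).comp x h1).fun_add
    (((h2.const_mul k).const_add 1).const_mul (p t))).congr_deriv (by ring)

theorem hasDerivAt_deriv_perturbedWave (hφ : TravelingWave f a c φ) (e k : ℝ) (p ξ : ℝ → ℝ)
    (t x : ℝ) :
    HasDerivAt (deriv (perturbedWave φ c e k p ξ t))
      (e ^ 2 * deriv (deriv φ) (e * x - c * t + ξ t) + p t * (k * Real.exp (-x))) x := by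
  rw [funext fun y => (hasDerivAt_perturbedWave hφ e k p ξ t y).deriv]
  have h1 : HasDerivAt (fun x => e * x - c * t + ξ t) e x := by
    simpa using (((hasDerivAt_id' x).const_mul e).sub_const (c * t)).add_const (ξ t)
  have h2 : HasDerivAt (fun x : ℝ => Real.exp (-x)) (-Real.exp (-x)) x := by
    simpa using (hasDerivAt_id' x).neg.exp
  exact ((((hφ.hasDerivAt_deriv _).comp x h1).const_mul e).fun_sub
    ((h2.const_mul k).const_mul (p t))).congr_deriv (by ring)

theorem hasDerivAt_perturbedWave_time (hφ : TravelingWave f a c φ) (e k : ℝ)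
    (hp : ∀ t, HasDerivAt p (p' t) t) (hξ : ∀ t, HasDerivAt ξ (ξ' t) t) (t x : ℝ) :
    HasDerivAt (fun τ => perturbedWave φ c e k p ξ τ x)
      ((ξ' t - c) * deriv φ (e * x - c * t + ξ t) + p' t * (1 + k * Real.exp (-x))) t := by
  have h1 : HasDerivAt (fun t => e * x - c * t + ξ t) (ξ' t - c) t :=
    ((((hasDerivAt_id' t).const_mul c).const_sub (e * x)).fun_add (hξ t)).congr_deriv (by ring)
  exact (((hφ.hasDerivAt _).comp t h1).fun_add ((hp t).mul_const _)).congr_deriv (by ring)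

theorem starRegular_perturbedWave (hφ : TravelingWave f a c φ) (e k : ℝ)
    (hp : ∀ t, HasDerivAt p (p' t) t) (hξ : ∀ t, HasDerivAt ξ (ξ' t) t) :
    StarRegular (perturbedWave φ c e k p ξ) where
  cont := by
    have h1 : Continuous φ := hφ.1.continuous
    have h2 : Continuous p := continuous_iff_continuousAt.2 fun t => (hp t).continuousAt
    have h3 : Continuous ξ := continuous_iff_continuousAt.2 fun t => (hξ t).continuousAt
    unfold perturbedWave
    exact Continuous.continuousOn (by fun_prop)
  diff_t t x _ := (hasDerivAt_perturbedWave_time hφ e k hp hξ t x).differentiableAt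
  diff_x t x _ := (hasDerivAt_perturbedWave hφ e k p ξ t x).differentiableAt
  diff_xx t x _ := (hasDerivAt_deriv_perturbedWave hφ e k p ξ t x).differentiableAt

theorem heatOp_perturbedWave (hφ : TravelingWave f a c φ) (he : e ^ 2 = 1) (k : ℝ)
    (hp : ∀ t, HasDerivAt p (p' t) t) (hξ : ∀ t, HasDerivAt ξ (ξ' t) t) (t x : ℝ) :
    heatOp (perturbedWave φ c e k p ξ) t x = f (φ (e * x - c * t + ξ t)) +
      ξ' t * deriv φ (e * x - c * t + ξ t) + p' t * (1 + k * Real.exp (-x)) -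
      p t * (k * Real.exp (-x)) := by
  rw [heatOp, (hasDerivAt_perturbedWave_time hφ e k hp hξ t x).deriv,
    (hasDerivAt_deriv_perturbedWave hφ e k p ξ t x).deriv, he]
  linear_combination -hφ.2.1 (e * x - c * t + ξ t)

/-- Sign of the spatial variable in the travelling coordinate: the wave arrives along edge `i`. -/
def edgeSign {N : ℕ} (i j : Fin N) : ℝ := if j = i then -1 else 1

theorem edgeSign_sq {N : ℕ} (i j : Fin N) : edgeSign i j ^ 2 = 1 := by
  unfold edgeSign; split <;> norm_num

/-- Supersolution on the star graph. -/
noncomputable def frontSuper (φ : ℝ → ℝ) (c κ : ℝ) (q ζ : ℝ → ℝ) {N : ℕ} (i j : Fin N) :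
    ℝ → ℝ → ℝ := perturbedWave φ c (edgeSign i j) κ q (fun t => -ζ t)

/-- Subsolution on the edge along which the front arrives. -/
noncomputable def frontSub (φ : ℝ → ℝ) (c : ℝ) (q ζ : ℝ → ℝ) : ℝ → ℝ → ℝ :=
  perturbedWave φ c (-1) 0 (fun t => -q t) ζ

/-- Initial profile of the monotone iteration. -/
noncomputable def frontInit (φ : ℝ → ℝ) (c : ℝ) (q ζ : ℝ → ℝ) {N : ℕ} (i j : Fin N)
    (t x : ℝ) : ℝ := if j = i then max (frontSub φ c q ζ t x) 0 else 0

variable {κ : ℝ} {q q' ζ ζ' : ℝ → ℝ} {N : ℕ} {i : Fin N}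

theorem WaveBarrier.starRegular_frontSuper (hb : WaveBarrier f φ c κ q q' ζ ζ')
    (hφ : TravelingWave f a c φ) (i j : Fin N) : StarRegular (frontSuper φ c κ q ζ i j) :=
  starRegular_perturbedWave hφ _ _ hb.hasDerivAt_q fun t => (hb.hasDerivAt_ζ t).fun_neg

theorem WaveBarrier.starRegular_frontSub (hb : WaveBarrier f φ c κ q q' ζ ζ')
    (hφ : TravelingWave f a c φ) : StarRegular (frontSub φ c q ζ) :=
  starRegular_perturbedWave hφ _ _ (fun t => (hb.hasDerivAt_q t).fun_neg) hb.hasDerivAt_ζ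

theorem WaveBarrier.frontSuper_pos (hb : WaveBarrier f φ c κ q q' ζ ζ')
    (hφ : TravelingWave f a c φ) (i j : Fin N) (t x : ℝ) : 0 < frontSuper φ c κ q ζ i j t x := by
  have := hb.q_pos t
  have := hb.κ_pos
  have := (hφ.2.2.1 (edgeSign i j * x - c * t + -ζ t)).1
  unfold frontSuper perturbedWave
  positivity

theorem WaveBarrier.le_heatOp_frontSuper (hb : WaveBarrier f φ c κ q q' ζ ζ')
    (hφ : TravelingWave f a c φ) (i j : Fin N) (t : ℝ) {x : ℝ} (hx : 0 ≤ x)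
    (h1 : frontSuper φ c κ q ζ i j t x < 1) :
    f (frontSuper φ c κ q ζ i j t x) ≤ heatOp (frontSuper φ c κ q ζ i j) t x := by
  have h2 := hb.super t (edgeSign i j * x - c * t + -ζ t) (Real.exp (-x)) (Real.exp_pos _).le
    (Real.exp_le_one_iff.2 (by linarith)) h1
  rw [frontSuper, heatOp_perturbedWave hφ (edgeSign_sq i j) κ hb.hasDerivAt_q
    (fun t => (hb.hasDerivAt_ζ t).fun_neg)]
  exact h2.trans (le_of_eq (by ring))

theorem WaveBarrier.heatOp_frontSub_le (hb : WaveBarrier f φ c κ q q' ζ ζ')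
    (hφ : TravelingWave f a c φ) {t x : ℝ} (h0 : 0 < frontSub φ c q ζ t x) :
    heatOp (frontSub φ c q ζ) t x ≤ f (frontSub φ c q ζ t x) := by
  have e : ∀ t x, frontSub φ c q ζ t x = φ (-1 * x - c * t + ζ t) - q t := fun t x => by
    simp [frontSub, perturbedWave, sub_eq_add_neg]
  have h2 := hb.sub t (-1 * x - c * t + ζ t) (by rwa [← e])
  rw [e, frontSub, heatOp_perturbedWave hφ (by norm_num) 0 (fun t => (hb.hasDerivAt_q t).fun_neg)
    hb.hasDerivAt_ζ]
  exact (le_of_eq (by ring)).trans h2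

theorem frontSuper_zero (φ : ℝ → ℝ) (c κ : ℝ) (q ζ : ℝ → ℝ) (i j : Fin N) (t : ℝ) :
    frontSuper φ c κ q ζ i j t 0 = φ (-(c * t) - ζ t) + q t * (1 + κ) := by
  simp [frontSuper, perturbedWave, sub_eq_add_neg]

theorem frontSub_eq (φ : ℝ → ℝ) (c : ℝ) (q ζ : ℝ → ℝ) (t x : ℝ) :
    frontSub φ c q ζ t x = φ (-x - c * t + ζ t) - q t := by
  simp [frontSub, perturbedWave, sub_eq_add_neg]

theorem WaveBarrier.sum_deriv_frontSuper_nonpos {ρ : Fin N → ℝ}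
    (hb : WaveBarrier f φ c κ q q' ζ ζ') (hφ : TravelingWave f a c φ) (hρ : ∀ j, 0 < ρ j)
    {j : Fin N} {t : ℝ} (h1 : frontSuper φ c κ q ζ i j t 0 < 1) :
    ∑ k, ρ k * deriv (frontSuper φ c κ q ζ i k t) 0 ≤ 0 := by
  rw [frontSuper_zero] at h1
  have h2 := hb.super_junction t h1
  have h3 := hφ.2.2.2.2.2.1 (-(c * t) - ζ t)
  refine Finset.sum_nonpos fun k _ => mul_nonpos_of_nonneg_of_nonpos (hρ k).le ?_
  rw [frontSuper, (hasDerivAt_perturbedWave hφ _ _ _ _ t 0).deriv, mul_zero, zero_sub,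
    ← sub_eq_add_neg, neg_zero, Real.exp_zero]
  unfold edgeSign
  split_ifs <;> linarith

theorem WaveBarrier.starStep_le_frontSuper {ρ : Fin N → ℝ} {K L : ℝ}
    (hb : WaveBarrier f φ c κ q q' ζ ζ') (hφ : TravelingWave f a c φ) (hρ : ∀ j, 0 < ρ j)
    (hg : MonoReaction (fun v => f v + K * v) K) {V : Fin N → ℝ → ℝ → ℝ} (hV : StarProfile V L)
    (hVW : ∀ j t x, 0 ≤ x → V j t x ≤ frontSuper φ c κ q ζ i j t x) (j : Fin N) (t x : ℝ)
    (hx : 0 ≤ x) :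
    starStep K ρ (fun v => f v + K * v) V j t x ≤ frontSuper φ c κ q ζ i j t x := by
  have hS := hV.comp hg
  have hreg := hS.starRegular_starPot hρ hg.pos
  have hregW := hb.starRegular_frontSuper hφ i
  have hmem := hV.starStep_mem hρ hg
  rw [← sub_nonneg]
  refine star_nonneg_of_ancient hρ (D := fun j t x => frontSuper φ c κ q ζ i j t x -
    starStep K ρ (fun v => f v + K * v) V j t x) (T := t) (κ := K) (B := 1)
    (fun j => (hregW j).sub (hreg j)) hg.pos ?_ ?_ ?_ j t x le_rfl hx
  · intro j t x _ hx
    linarith [hb.frontSuper_pos hφ i j t x, (hmem j t x hx).2]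
  · intro j t x _ hx hneg
    have hW1 : frontSuper φ c κ q ζ i j t x < 1 := by linarith [(hmem j t x hx.le).2]
    have h1 := hb.le_heatOp_frontSuper hφ i j t hx.le hW1
    have h2 := hS.heatOp_starPot hρ hg.pos j t hx.le
    have h3 := hg.strictMono.monotoneOn (hV.mem j t x hx.le)
      ⟨(hb.frontSuper_pos hφ i j t x).le, hW1.le⟩ (hVW j t x hx.le)
    unfold starStep
    rw [(hregW j).heatOp_sub (hreg j) t hx, h2]
    linarith
  · intro j t _ hneg
    have hW1 : frontSuper φ c κ q ζ i j t 0 < 1 := by linarith [(hmem j t 0 le_rfl).2]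
    refine ⟨fun k => ?_, ?_⟩
    · simp only [frontSuper_zero]
      rw [starStep, hS.starPot_junction hρ hg.pos k j]
    · have h1 := hb.sum_deriv_frontSuper_nonpos hφ hρ hW1
      have h2 := hS.sum_deriv_starPot hρ hg.pos t
      have h3 : ∀ k, ρ k * deriv (fun x => frontSuper φ c κ q ζ i k t x -
          starStep K ρ (fun v => f v + K * v) V k t x) 0 =
          ρ k * deriv (frontSuper φ c κ q ζ i k t) 0 -
            ρ k * deriv (starPot K ρ (fun j t x => f (V j t x) + K * V j t x) k t) 0 := fun k => by
        rw [← mul_sub]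
        congr 1
        exact deriv_fun_sub ((hregW k).diff_x t 0 le_rfl) ((hreg k).diff_x t 0 le_rfl)
      simp only [h3, Finset.sum_sub_distrib]
      linarith

theorem WaveBarrier.frontSub_zero_nonpos (hb : WaveBarrier f φ c κ q q' ζ ζ') (t : ℝ) :
    frontSub φ c q ζ t 0 ≤ 0 := by
  rw [frontSub_eq, neg_zero, zero_sub]
  linarith [hb.sub_junction t]

theorem WaveBarrier.frontSub_lt_one (hb : WaveBarrier f φ c κ q q' ζ ζ')
    (hφ : TravelingWave f a c φ) (t x : ℝ) : frontSub φ c q ζ t x < 1 := by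
  rw [frontSub_eq]
  linarith [hb.q_pos t, (hφ.2.2.1 (-x - c * t + ζ t)).2]

theorem frontInit_mem (hb : WaveBarrier f φ c κ q q' ζ ζ') (hφ : TravelingWave f a c φ)
    (i j : Fin N) (t x : ℝ) : frontInit φ c q ζ i j t x ∈ Icc (0 : ℝ) 1 := by
  unfold frontInit
  split_ifs
  · exact ⟨le_max_right _ _, max_le (hb.frontSub_lt_one hφ t x).le zero_le_one⟩
  · exact ⟨le_rfl, zero_le_one⟩

theorem WaveBarrier.starProfile_frontInit {L : ℝ} (hb : WaveBarrier f φ c κ q q' ζ ζ')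
    (hf : Bistable f a) (hc : 0 < c)
    (hφ : TravelingWave f a c φ) (i : Fin N) (hL : c - deriv φ 0 ≤ L) :
    StarProfile (frontInit φ c q ζ i) L where
  mem j t x _ := frontInit_mem hb hφ i j t x
  source := by
    refine ⟨fun j => ?_, fun j t x _ => ?_, fun j t x y _ _ => ?_, ?_⟩
    · unfold frontInit
      split_ifs
      · exact (hb.starRegular_frontSub hφ).cont.sup continuousOn_const
      · exact continuousOn_const
    · have := frontInit_mem hb hφ i j t x
      rw [abs_of_nonneg this.1]
      exact this.2
    · have hL0 : 0 ≤ L := by linarith [hφ.2.2.2.2.2.1 0]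
      unfold frontInit
      split_ifs
      · refine (abs_max_zero_sub_le _ _).trans ?_
        rw [frontSub_eq, frontSub_eq, sub_sub_sub_cancel_right]
        refine (hφ.abs_sub_le hf hc _ _).trans ?_
        rw [show -x - c * t + ζ t - (-y - c * t + ζ t) = -(x - y) by ring, abs_neg]
        exact mul_le_mul_of_nonneg_right hL (abs_nonneg _)
      · rw [sub_self, abs_zero]
        positivity
    · have h0 : ∀ j t, frontInit φ c q ζ i j t 0 = 0 := fun j t => by
        unfold frontInit
        split_ifs
        · exact max_eq_right (hb.frontSub_zero_nonpos t)
        · rfl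
      intro j k t
      rw [h0, h0]

theorem WaveBarrier.frontInit_le_frontSuper (hb : WaveBarrier f φ c κ q q' ζ ζ')
    (hφ : TravelingWave f a c φ) (i j : Fin N) (t x : ℝ) :
    frontInit φ c q ζ i j t x ≤ frontSuper φ c κ q ζ i j t x := by
  unfold frontInit
  split_ifs with h
  · refine max_le ?_ (hb.frontSuper_pos hφ i j t x).le
    have h1 := hφ.strictAnti.antitone
      (show -1 * x - c * t + -ζ t ≤ -x - c * t + ζ t by linarith [hb.ζ_nonneg t])
    have h2 := hb.q_pos t
    have h3 := hb.κ_pos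
    have h4 : 0 ≤ q t * (1 + κ * Real.exp (-x)) := by positivity
    rw [frontSub_eq, frontSuper, perturbedWave, edgeSign, if_pos h]
    linarith
  · exact (hb.frontSuper_pos hφ i j t x).le

theorem WaveBarrier.frontInit_le_starStep {ρ : Fin N → ℝ} {K L : ℝ}
    (hb : WaveBarrier f φ c κ q q' ζ ζ') (hφ : TravelingWave f a c φ) (hρ : ∀ j, 0 < ρ j)
    (hg : MonoReaction (fun v => f v + K * v) K) (hV : StarProfile (frontInit φ c q ζ i) L)
    (j : Fin N) (t x : ℝ) (hx : 0 ≤ x) : frontInit φ c q ζ i j t x ≤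
      starStep K ρ (fun v => f v + K * v) (frontInit φ c q ζ i) j t x := by
  have hS := hV.comp hg
  have hreg := hS.starRegular_starPot hρ hg.pos
  have hregw := hb.starRegular_frontSub hφ
  have hmem := hV.starStep_mem hρ hg
  by_cases hji : j = i
  swap
  · rw [frontInit, if_neg hji]
    exact (hmem j t x hx).1
  rw [frontInit, if_pos hji]
  refine max_le ?_ (hmem j t x hx).1
  have key := star_nonneg_of_ancient hρ (D := fun j t x =>
    starStep K ρ (fun v => f v + K * v) (frontInit φ c q ζ i) j t x -
      if j = i then frontSub φ c q ζ t x else 0) (T := t) (κ := K) (B := 1) ?_ hg.pos ?_ ?_ ?_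
      j t x le_rfl hx
  · simp only [if_pos hji] at key
    linarith
  · intro j
    split_ifs
    · exact (hreg j).sub hregw
    · simp only [sub_zero]
      exact hreg j
  · intro j t x _ hx
    split_ifs <;> linarith [hb.frontSub_lt_one hφ t x, (hmem j t x hx).1]
  · intro j t x _ hx hneg
    have h0 := (hmem j t x hx.le).1
    split_ifs at hneg with hji
    swap
    · linarith
    simp only [if_pos hji]
    have hw : 0 < frontSub φ c q ζ t x := by linarith
    have h1 := hb.heatOp_frontSub_le hφ hw
    have h2 := hS.heatOp_starPot hρ hg.pos j t hx.le
    have h3 : frontInit φ c q ζ i j t x = frontSub φ c q ζ t x := by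
      rw [frontInit, if_pos hji, max_eq_left hw.le]
    unfold starStep
    rw [(hreg j).heatOp_sub hregw t hx, h2]
    simp only [h3]
    linarith
  · intro j t _ hneg
    exfalso
    have h0 := (hmem j t 0 le_rfl).1
    have h1 := hb.frontSub_zero_nonpos t
    split_ifs at hneg <;> linarith

end barriers

section existence

variable {f φ : ℝ → ℝ} {a c κ K L B : ℝ} {q q' ζ ζ' : ℝ → ℝ} {N : ℕ} {i : Fin N} {ρ : Fin N → ℝ}
  {u : Fin N → ℝ → ℝ → ℝ}

/-- Asymptotics in the far past of a solution lying between the two barriers. -/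
theorem WaveBarrier.exists_asymptotic (hb : WaveBarrier f φ c κ q q' ζ ζ') (hf : Bistable f a)
    (hc : 0 < c) (hφ : TravelingWave f a c φ)
    (hlo : ∀ j t x, 0 ≤ x → frontInit φ c q ζ i j t x ≤ u j t x)
    (hup : ∀ j t x, 0 ≤ x → u j t x ≤ frontSuper φ c κ q ζ i j t x) {ε : ℝ} (hε : 0 < ε) :
    ∃ T : ℝ, ∀ t : ℝ, t ≤ T → ∀ x : ℝ, 0 ≤ x →
      |u i t x - φ (-x - c * t)| < ε ∧ ∀ j, j ≠ i → |u j t x| < ε := by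
  set M := c - deriv φ 0 with hM
  have hM0 : 0 ≤ M := by linarith [hφ.2.2.2.2.2.1 0]
  have hlim : Tendsto (fun t => φ (-c * t) + M * ζ t + q t * (1 + κ)) atBot (𝓝 0) := by
    have h1 : Tendsto (fun t => φ (-c * t)) atBot (𝓝 0) :=
      hφ.2.2.2.2.1.comp (tendsto_id.const_mul_atBot_of_neg (neg_neg_of_pos hc))
    simpa using (h1.add (hb.tendsto_ζ.const_mul M)).add (hb.tendsto_q.mul_const (1 + κ))
  obtain ⟨T, hT⟩ := eventually_atBot.1 (hlim.eventually (gt_mem_nhds hε))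
  refine ⟨T, fun t ht x hx => ?_⟩
  have h1 := hT t ht
  have hφ0 := (hφ.2.2.1 (-c * t)).1
  have hζ := mul_nonneg hM0 (hb.ζ_nonneg t)
  have hq := hb.q_pos t
  have hκ := mul_pos hq hb.κ_pos
  have hlip : ∀ z, φ (z + ζ t) ≥ φ z - M * ζ t ∧ φ (z + -ζ t) ≤ φ z + M * ζ t := fun z => by
    have h2 := hφ.abs_sub_le hf hc (z + ζ t) z
    have h3 := hφ.abs_sub_le hf hc (z + -ζ t) z
    rw [add_sub_cancel_left, abs_of_nonneg (hb.ζ_nonneg t)] at h2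
    rw [add_sub_cancel_left, abs_neg, abs_of_nonneg (hb.ζ_nonneg t)] at h3
    constructor
    · linarith [(abs_le.1 h2).1]
    · linarith [(abs_le.1 h3).2]
  have hsup : ∀ j, u j t x ≤ φ (edgeSign i j * x - c * t) + M * ζ t + q t * (1 + κ) := fun j => by
    have h2 := hup j t x hx
    have h3 := (hlip (edgeSign i j * x - c * t)).2
    have h4 : q t * (1 + κ * Real.exp (-x)) ≤ q t * (1 + κ) := by
      refine mul_le_mul_of_nonneg_left ?_ hq.le
      have := mul_le_mul_of_nonneg_left (Real.exp_le_one_iff.2 (neg_nonpos.2 hx)) hb.κ_pos.le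
      linarith
    rw [frontSuper, perturbedWave] at h2
    linarith
  constructor
  · have h2 := hsup i
    rw [edgeSign, if_pos rfl, neg_one_mul] at h2
    have h3 := hlo i t x hx
    rw [frontInit, if_pos rfl, frontSub_eq] at h3
    have h4 := (le_max_left _ _).trans h3
    have h5 := (hlip (-x - c * t)).1
    rw [abs_lt]
    constructor <;> linarith
  · intro j hj
    have h2 := hsup j
    rw [edgeSign, if_neg hj, one_mul] at h2
    have h3 := hlo j t x hx
    rw [frontInit, if_neg hj] at h3
    have h4 := hφ.strictAnti.antitone (show -c * t ≤ x - c * t by linarith)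
    rw [abs_of_nonneg h3]
    linarith

theorem StarSource.isEntireSol_starPot {S : Fin N → ℝ → ℝ → ℝ} (h : StarSource S B L)
    (hρ : ∀ j, 0 < ρ j) (hK : 0 < K)
    (hS : ∀ j t x, 0 ≤ x → S j t x = f (starPot K ρ S j t x) + K * starPot K ρ S j t x)
    (j : Fin N) : IsEntireSol f (starPot K ρ S j) := by
  have hj := h.heatSource hρ j
  have hdt : ∀ t x, deriv (fun τ => starPot K ρ S j τ x) t =
      heatPotXX K (starExt ρ S j) t x - K * heatPot K (starExt ρ S j) t x + starExt ρ S j t x :=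
    fun t x => (hj.hasDerivAt_heatPot_time hK t x).deriv
  have hdx : ∀ t, deriv (starPot K ρ S j t) = heatPotX K (starExt ρ S j) t :=
    hj.deriv_heatPot hK
  have hdxx : ∀ t, deriv (deriv (starPot K ρ S j t)) = heatPotXX K (starExt ρ S j) t :=
    hj.deriv_deriv_heatPot hK
  have hreg := h.starRegular_starPot hρ hK j
  refine ⟨hreg.cont, fun t x hx => ⟨hreg.diff_t t x hx, hreg.diff_x t x hx, ?_⟩, ?_, ?_, ?_,
    fun t x hx => ?_⟩
  · rw [hdx]
    exact (hj.hasDerivAt_heatPotX hK t x).differentiableAt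
  · simp only [hdt]
    exact (((hj.continuous_heatPotXX hK).sub (continuous_const.mul
      (hj.continuous_heatPot hK))).add hj.cont).continuousOn
  · simp only [hdx]
    exact (hj.continuous_heatPotX hK).continuousOn
  · simp only [hdxx]
    exact (hj.continuous_heatPotXX hK).continuousOn
  · rw [hdt, hdxx, h.starExt_of_nonneg hρ j t hx, hS j t x hx, starPot]
    ring

/-- A fixed point of the iteration which looks like the wave in the far past. -/
structure FrontFixedPoint (f : ℝ → ℝ) (c : ℝ) (φ : ℝ → ℝ) (K L : ℝ) (ρ : Fin N → ℝ) (i : Fin N)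
    (u : Fin N → ℝ → ℝ → ℝ) : Prop where
  profile : StarProfile u L
  eq : starStep K ρ (fun v => f v + K * v) u = u
  asymptotic : ∀ ε : ℝ, 0 < ε → ∃ T : ℝ, ∀ t : ℝ, t ≤ T → ∀ x : ℝ, 0 ≤ x →
    |u i t x - φ (-x - c * t)| < ε ∧ ∀ j, j ≠ i → |u j t x| < ε

theorem exists_frontFixedPoint (hf : Bistable f a) (hc : 0 < c) (hφ : TravelingWave f a c φ)
    (hρ : ∀ j, 0 < ρ j) (i : Fin N) (hg : MonoReaction (fun v => f v + K * v) K) :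
    ∃ L u, FrontFixedPoint f c φ K L ρ i u := by
  obtain ⟨κ, q, q', ζ, ζ', hb⟩ := exists_waveBarrier hf hc hφ
  have hV := hb.starProfile_frontInit hf hc hφ i (le_max_right (stepLip K) (c - deriv φ 0))
  obtain ⟨U, hU, heq, hlo, hup⟩ := exists_starStep_eq hρ hg hV (le_max_left _ _)
    (hb.frontInit_le_starStep hφ hρ hg hV)
    (fun j t x _ => hb.frontInit_le_frontSuper hφ i j t x)
    (fun V hV hVW => hb.starStep_le_frontSuper hφ hρ hg hV hVW)
  refine ⟨_, starStep K ρ (fun v => f v + K * v) U, hU.step hρ hg le_rfl, ?_,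
    fun ε hε => ?_⟩
  · have h : starExt ρ (fun j t x => f (starStep K ρ (fun v => f v + K * v) U j t x) +
        K * starStep K ρ (fun v => f v + K * v) U j t x) =
        starExt ρ fun j t x => f (U j t x) + K * U j t x :=
      starExt_congr fun j t x hx => by rw [heq j t x hx]
    funext j
    rw [starStep, starPot, h]
    rfl
  · exact hb.exists_asymptotic hf hc hφ (fun j t x hx => by rw [heq j t x hx]; exact hlo j t x hx)
      (fun j t x hx => by rw [heq j t x hx]; exact hup j t x hx) hε

/-- Arbitrarily early, the solution is close to `φ 0` at some point of edge `i`. -/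
theorem FrontFixedPoint.exists_close (hu : FrontFixedPoint f c φ K L ρ i u) (hc : 0 < c) (t : ℝ)
    {τ : ℝ} (hτ : 0 ≤ τ) {ε : ℝ} (hε : 0 < ε) :
    ∃ s < t, ∃ x, 0 ≤ x ∧ |u i s x - φ 0| < ε ∧ |u i (s + τ) x - φ (-(c * τ))| < ε := by
  obtain ⟨T, hT⟩ := hu.asymptotic ε hε
  set s := min (min (T - τ) (t - 1)) 0 with hs
  have h1 : s ≤ T - τ := (min_le_left _ _).trans (min_le_left _ _)
  have h2 : s ≤ t - 1 := (min_le_left _ _).trans (min_le_right _ _)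
  have h3 : s ≤ 0 := min_le_right _ _
  have hx : 0 ≤ -(c * s) := by nlinarith
  refine ⟨s, by linarith, -(c * s), hx, ?_, ?_⟩
  · simpa using (hT s (by linarith) _ hx).1
  · have := (hT (s + τ) (by linarith) _ hx).1
    rwa [show -(-(c * s)) - c * (s + τ) = -(c * τ) by ring] at this

theorem FrontFixedPoint.pos (hu : FrontFixedPoint f c φ K L ρ i u) (hc : 0 < c)
    (hφ : TravelingWave f a c φ) (hρ : ∀ j, 0 < ρ j) (hg : MonoReaction (fun v => f v + K * v) K)
    (j : Fin N) (t : ℝ) {x : ℝ} (hx : 0 ≤ x) : 0 < u j t x := by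
  refine (hu.profile.mem j t x hx).1.lt_of_ne' fun h0 => ?_
  obtain ⟨s, hs, y, hy, h1, -⟩ := hu.exists_close hc t le_rfl (hφ.2.2.1 0).1
  rw [← hu.eq] at h0
  have h2 := (hu.profile.comp hg).eq_zero_of_starPot_eq_zero hρ hg.pos
    (fun j t x hx => (hg.mem_Icc (hu.profile.mem j t x hx)).1) hx h0 i hs hy
  have h3 : u i s y = 0 := hg.strictMono.injOn (hu.profile.mem i s y hy) ⟨le_rfl, zero_le_one⟩
    (h2.trans hg.zero.symm)
  rw [h3, zero_sub, abs_neg, abs_of_pos (hφ.2.2.1 0).1] at h1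
  exact lt_irrefl _ h1

theorem FrontFixedPoint.lt_one (hu : FrontFixedPoint f c φ K L ρ i u) (hc : 0 < c)
    (hφ : TravelingWave f a c φ) (hρ : ∀ j, 0 < ρ j) (hg : MonoReaction (fun v => f v + K * v) K)
    (j : Fin N) (t : ℝ) {x : ℝ} (hx : 0 ≤ x) : u j t x < 1 := by
  refine (hu.profile.mem j t x hx).2.lt_of_ne fun h0 => ?_
  have hφ1 := (hφ.2.2.1 0).2
  obtain ⟨s, hs, y, hy, h1, -⟩ := hu.exists_close hc t le_rfl (sub_pos.2 hφ1)
  rw [← hu.eq] at h0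
  have hS := hu.profile.comp hg
  have h2 : K - (f (u i s y) + K * u i s y) = 0 :=
    ((starSource_const K).sub hS).eq_zero_of_starPot_eq_zero hρ hg.pos
      (fun j t x hx => sub_nonneg.2 (hg.mem_Icc (hu.profile.mem j t x hx)).2) hx
      (by rw [(starSource_const K).starPot_sub hρ hg.pos hS, starPot_const hρ hg.pos,
        div_self hg.pos.ne', sub_eq_zero]
          exact h0.symm) i hs hy
  have h3 : u i s y = 1 := hg.strictMono.injOn (hu.profile.mem i s y hy) ⟨zero_le_one, le_rfl⟩
    ((sub_eq_zero.1 h2).symm.trans hg.one.symm)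
  rw [h3, abs_of_pos (sub_pos.2 hφ1)] at h1
  exact lt_irrefl _ h1

theorem FrontFixedPoint.frontLike (hu : FrontFixedPoint f c φ K L ρ i u) (hc : 0 < c)
    (hφ : TravelingWave f a c φ) (hρ : ∀ j, 0 < ρ j)
    (hg : MonoReaction (fun v => f v + K * v) K) : FrontLike f c φ ρ i u := by
  have hS := hu.profile.comp hg
  have hsol : ∀ j, IsEntireSol f (u j) := fun j => by
    have h := hS.isEntireSol_starPot (f := f) hρ hg.pos (fun j t x _ => by
      change _ = f (starStep K ρ (fun v => f v + K * v) u j t x) +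
        K * starStep K ρ (fun v => f v + K * v) u j t x
      rw [hu.eq]) j
    rw [← hu.eq]
    exact h
  refine ⟨hsol, fun j t x hx => ⟨hu.pos hc hφ hρ hg j t hx, hu.lt_one hc hφ hρ hg j t hx⟩,
    fun t j k => hu.profile.source.junction j k t, fun t => ?_, hu.asymptotic⟩
  simp only [(hsol _).derivWithin_eq]
  rw [← hu.eq]
  exact hS.sum_deriv_starPot hρ hg.pos t

theorem StarSource.shift {S : Fin N → ℝ → ℝ → ℝ} (h : StarSource S B L) (τ : ℝ) :
    StarSource (fun j t x => S j (t + τ) x) B L where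
  cont j := (h.cont j).comp (f := fun p : ℝ × ℝ => (p.1 + τ, p.2)) (by fun_prop)
    fun p hp => ⟨mem_univ _, hp.2⟩
  bdd j t x hx := h.bdd j (t + τ) x hx
  lip j t x y hx hy := h.lip j (t + τ) x y hx hy
  junction j k t := h.junction j k (t + τ)

theorem starPot_shift (K : ℝ) (ρ : Fin N → ℝ) (S : Fin N → ℝ → ℝ → ℝ) (τ : ℝ) (j : Fin N)
    (t x : ℝ) : starPot K ρ (fun j t x => S j (t + τ) x) j t x = starPot K ρ S j (t + τ) x := by
  have h : ∀ s y, starExt ρ (fun j t x => S j (t + τ) x) j s y = starExt ρ S j (s + τ) y :=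
    fun _ _ => rfl
  simp only [starPot, heatPot, h, sub_add_eq_add_sub]

theorem FrontFixedPoint.strictMono (hu : FrontFixedPoint f c φ K L ρ i u) (hf : Bistable f a)
    (hc : 0 < c) (hφ : TravelingWave f a c φ) (hρ : ∀ j, 0 < ρ j)
    (hg : MonoReaction (fun v => f v + K * v) K) (j : Fin N) {x : ℝ} (hx : 0 ≤ x) :
    StrictMono fun t => u j t x := by
  have hmono : ∀ j {x : ℝ}, 0 ≤ x → Monotone fun t => u j t x := fun j x hx =>
    (hu.frontLike hc hφ hρ hg).mono hf hc hφ hρ j hx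
  refine (hmono j hx).strictMono_of_injective fun s₁ s₂ h12 => ?_
  by_contra hne
  wlog hlt : s₁ < s₂ generalizing s₁ s₂
  · exact this _ _ h12.symm (Ne.symm hne) (lt_of_le_of_ne (not_lt.1 hlt) (Ne.symm hne))
  set τ := s₂ - s₁ with hτ
  have hτ0 : 0 < τ := sub_pos.2 hlt
  have hgap : 0 < (φ (-(c * τ)) - φ 0) / 2 := by
    have := hφ.strictAnti (show -(c * τ) < 0 by nlinarith)
    linarith
  obtain ⟨s, hs, y, hy, h1, h2⟩ := hu.exists_close hc s₁ hτ0.le hgap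
  have hS := hu.profile.comp hg
  have h0 : starPot K ρ (fun j t x => f (u j t x) + K * u j t x) j (s₁ + τ) x -
      starPot K ρ (fun j t x => f (u j t x) + K * u j t x) j s₁ x = 0 := by
    change starStep K ρ (fun v => f v + K * v) u j (s₁ + τ) x -
      starStep K ρ (fun v => f v + K * v) u j s₁ x = 0
    rw [hu.eq, hτ, add_sub_cancel, sub_eq_zero]
    exact h12.symm
  rw [← starPot_shift, ← (hS.shift τ).starPot_sub hρ hg.pos hS] at h0
  have h3 := ((hS.shift τ).sub hS).eq_zero_of_starPot_eq_zero hρ hg.pos (fun k t z hz => sub_nonneg.2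
    (hg.strictMono.monotoneOn (hu.profile.mem k t z hz) (hu.profile.mem k (t + τ) z hz)
      (hmono k hz (by linarith)))) hx h0 i hs hy
  have h4 : u i (s + τ) y = u i s y := hg.strictMono.injOn (hu.profile.mem i _ y hy)
    (hu.profile.mem i s y hy) (sub_eq_zero.1 h3)
  rw [h4] at h2
  linarith [(abs_lt.1 h1).2, (abs_lt.1 h2).1]

end existence

/-- Existence, uniqueness and strict time-monotonicity of the front-like entire
solution approaching along edge `i` of a star graph (Theorem 1.1). -/
theorem frontlike_exists_unique_monotone (f : ℝ → ℝ) (a : ℝ) (hf : Bistable f a)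
    (c : ℝ) (hc : 0 < c) (φ : ℝ → ℝ) (hφ : TravelingWave f a c φ)
    (N : ℕ) (hN : 2 ≤ N) (ρ : Fin N → ℝ) (hρ : ∀ j, 0 < ρ j) (i : Fin N) :
    (∃ u : Fin N → ℝ → ℝ → ℝ, FrontLike f c φ ρ i u) ∧
    (∀ u v : Fin N → ℝ → ℝ → ℝ, FrontLike f c φ ρ i u → FrontLike f c φ ρ i v →
      ∀ j, ∀ t : ℝ, ∀ x : ℝ, 0 ≤ x → u j t x = v j t x) ∧
    (∀ u : Fin N → ℝ → ℝ → ℝ, FrontLike f c φ ρ i u →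
      ∀ j, ∀ x : ℝ, 0 ≤ x → ∀ s t : ℝ, s < t → u j s x < u j t x) := by
  obtain ⟨K, hg⟩ := hf.exists_monoReaction
  obtain ⟨L, w, hw⟩ := exists_frontFixedPoint hf hc hφ hρ i hg
  have hwf := hw.frontLike hc hφ hρ hg
  refine ⟨⟨w, hwf⟩, fun u v hu hv j t x hx => hu.unique hf hc hφ hρ hv j t hx,
    fun u hu j x hx s t hst => ?_⟩
  rw [hu.unique hf hc hφ hρ hwf j s hx, hu.unique hf hc hφ hρ hwf j t hx]
  exact hw.strictMono hf hc hφ hρ hg j hx hst
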